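/- arXiv:1202.0747 — 3 statements merged into one kernel-verified Lean document; each statement's English description precedes it below -/
import Mathlib

section
/- For all positive integers m and n, M(m,n) ≥ 2mn - m - n + 1. Equivalently, there exists an acyclic directed graph with two distinct sources S_1, S_2 and two distinct sinks R_1, R_2, with min-cut m from S_1 to R_1 and min-cut n from S_2 to R_2, in which every choice of Menger path systems yields at least 2mn - m - n + 1 mergings. -/
/-- A finite directed multigraph. -/
structure MultiDigraph where
  V : Type
  E : Type
  fintV : Fintype V
  fintE : Fintype E
  src : E → V
  dst : E → V

namespace MultiDigraph

/-- `p` is a (nonempty) directed path from `u` to `v`, given as its list of edges. -/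
def IsPathFrom (G : MultiDigraph) (u v : G.V) (p : List G.E) : Prop :=
  p ≠ [] ∧ List.Chain' (fun e f => G.dst e = G.src f) p ∧
    (∀ e ∈ p.head?, G.src e = u) ∧ ∀ e ∈ p.getLast?, G.dst e = v

/-- `G` is acyclic: there is no (nonempty) directed path from a vertex to itself. -/
def Acyclic (G : MultiDigraph) : Prop :=
  ∀ (v : G.V) (p : List G.E), ¬ G.IsPathFrom v v p

/-- `α` is a family of `c` pairwise edge-disjoint directed paths from `u` to `v`. -/
def MengerSystem (G : MultiDigraph) (u v : G.V) (c : ℕ) (α : Fin c → List G.E) : Prop :=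
  (∀ i, G.IsPathFrom u v (α i)) ∧ ∀ i j, i ≠ j → ∀ e, e ∈ α i → e ∉ α j

/-- The min-cut between `u` and `v` equals `c`: by Menger's theorem, this means the
maximum number of pairwise edge-disjoint directed paths from `u` to `v` is exactly `c`. -/
def MinCut (G : MultiDigraph) (u v : G.V) (c : ℕ) : Prop :=
  (∃ α : Fin c → List G.E, G.MengerSystem u v c α) ∧
    ¬∃ α : Fin (c + 1) → List G.E, G.MengerSystem u v (c + 1) α

/-- Edge `e` is the starting edge of a merging among paths from (at least) two different
groups: `e` lies on a path of group `i` and on a path of group `j ≠ i`, and there are two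
distinct edges immediately ahead of `e` on these two paths.  Mergings are counted without
multiplicity: one merging per such edge `e`. -/
def MergingEdge (G : MultiDigraph) {l : ℕ} {c : Fin l → ℕ}
    (α : (i : Fin l) → Fin (c i) → List G.E) (e : G.E) : Prop :=
  ∃ i j : Fin l, i ≠ j ∧ ∃ (a : Fin (c i)) (b : Fin (c j)) (f g : G.E),
    f ≠ g ∧ [f, e] <:+: α i a ∧ [g, e] <:+: α j b

/-- The number of mergings among paths from different groups, `|G|_M(α₁,…,α_l)`. -/
noncomputable def mergingCount (G : MultiDigraph) {l : ℕ} {c : Fin l → ℕ}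
    (α : (i : Fin l) → Fin (c i) → List G.E) : ℕ :=
  Set.ncard {e : G.E | G.MergingEdge α e}

end MultiDigraph

open MultiDigraph

/-- `G` is a finite acyclic directed multigraph with designated sources `S i`, pairwise
distinct sinks `R i`, and min-cut `c i` between `S i` and `R i`. -/
def GoodConfig {l : ℕ} (G : MultiDigraph) (S R : Fin l → G.V) (c : Fin l → ℕ) : Prop :=
  G.Acyclic ∧ Function.Injective R ∧ ∀ i, G.MinCut (S i) (R i) (c i)

/-- `M(c₁,…,c_l) ≤ B`: in every acyclic graph with distinct sources, distinct sinks and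
the given min-cuts, some choice of Menger path systems yields at most `B` mergings. -/
def MAtMost {l : ℕ} (c : Fin l → ℕ) (B : ℕ) : Prop :=
  ∀ (G : MultiDigraph) (S R : Fin l → G.V), GoodConfig G S R c → Function.Injective S →
    ∃ α : (i : Fin l) → Fin (c i) → List G.E,
      (∀ i, G.MengerSystem (S i) (R i) (c i) (α i)) ∧ G.mergingCount α ≤ B

/-- `M(c₁,…,c_l) ≥ B`: some acyclic graph with distinct sources, distinct sinks and the
given min-cuts yields at least `B` mergings for every choice of Menger path systems. -/
def MAtLeast {l : ℕ} (c : Fin l → ℕ) (B : ℕ) : Prop :=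
  ∃ (G : MultiDigraph) (S R : Fin l → G.V), GoodConfig G S R c ∧ Function.Injective S ∧
    ∀ α : (i : Fin l) → Fin (c i) → List G.E,
      (∀ i, G.MengerSystem (S i) (R i) (c i) (α i)) → B ≤ G.mergingCount α

/-- `M(c₁,…,c_l) = B`: the largest possible value, over all acyclic graphs with distinct
sources and distinct sinks realizing the min-cuts `c`, of the minimum number of mergings
over all choices of Menger path systems, equals `B`. -/
def MEq {l : ℕ} (c : Fin l → ℕ) (B : ℕ) : Prop := MAtMost c B ∧ MAtLeast c B

/-- `M*(c₁,…,c_l) ≤ B`: as `MAtMost`, but with all sources identical. -/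
def MstarAtMost {l : ℕ} (c : Fin l → ℕ) (B : ℕ) : Prop :=
  ∀ (G : MultiDigraph) (S R : Fin l → G.V), GoodConfig G S R c → (∀ i j, S i = S j) →
    ∃ α : (i : Fin l) → Fin (c i) → List G.E,
      (∀ i, G.MengerSystem (S i) (R i) (c i) (α i)) ∧ G.mergingCount α ≤ B

/-- `M*(c₁,…,c_l) ≥ B`: as `MAtLeast`, but with all sources identical. -/
def MstarAtLeast {l : ℕ} (c : Fin l → ℕ) (B : ℕ) : Prop :=
  ∃ (G : MultiDigraph) (S R : Fin l → G.V), GoodConfig G S R c ∧ (∀ i j, S i = S j) ∧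
    ∀ α : (i : Fin l) → Fin (c i) → List G.E,
      (∀ i, G.MengerSystem (S i) (R i) (c i) (α i)) → B ≤ G.mergingCount α

/-- `M*(c₁,…,c_l) = B`: as `MEq`, but with all sources identical. -/
def MstarEq {l : ℕ} (c : Fin l → ℕ) (B : ℕ) : Prop := MstarAtMost c B ∧ MstarAtLeast c B


def Pr (f : ℕ → ℕ) (z w : ℕ) : Prop := z < w ∧ f z = f w ∧ ∀ k, z < k → k < w → f k ≠ f w

/-- validity of a word -/
def Valid (N : ℕ) (r c a b : ℕ → ℕ) : Prop :=
  (∀ w < N, ∀ z, Pr r z w → a z < a w) ∧ (∀ w < N, ∀ u, Pr c u w → b u < b w) ∧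
  ∀ w < N, ∀ z u, Pr r z w → Pr c u w → a z < a u ∧ b u < b z

def Good (m n N : ℕ) : Prop := ∃ r c a b : ℕ → ℕ, 0 < N ∧ (∀ k < N, r k < m) ∧
  (∀ k < N, c k < n) ∧ r 0 = 0 ∧ c 0 = 0 ∧ Valid N r c a b

theorem Good.swap {m n N : ℕ} (h : Good m n N) : Good n m N := by
  obtain ⟨r, c, a, b, h0, h1, h2, h3, h4, h5, h6, h7⟩ := h
  exact ⟨c, r, b, a, h0, h2, h1, h4, h3, h6, h5, fun w hw z u hz hu => (h7 w hw u z hu hz).symm⟩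

theorem good_one (m : ℕ) (hm : 0 < m) : Good m 1 m := by
  refine ⟨id, fun _ => 0, fun _ => 0, id, hm, fun k hk => hk, fun _ _ => Nat.one_pos, rfl, rfl, ?_, ?_, ?_⟩
  · rintro w hw z ⟨h1, h2, h3⟩
    simp at h2; omega
  · rintro w hw z ⟨h1, h2, h3⟩
    exact h1
  · rintro w hw z u ⟨h1, h2, h3⟩ _
    simp at h2; omega

/-- residue -/
def Mo (d q ρ : ℕ) : ℕ := if ρ ≤ q then q - ρ else q + (d + 1) - ρ

def Tr (d s q : ℕ) : ℕ := if s % 2 = 0 then Mo d 0 (s / 2) else Mo d q (s / 2)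
def Tc (d s q : ℕ) : ℕ := if s % 2 = 0 then Mo d q (s / 2) else Mo d d (s / 2)
def Ta (d s q : ℕ) : ℕ :=
  if s % 2 = 0 then 2 * d + q - s / 2 else if q ≤ s / 2 then 4 * d + s / 2 else s / 2
def Tb (d s q : ℕ) : ℕ :=
  if s % 2 = 0 then (if s / 2 ≤ q then s / 2 else 4 * d + s / 2) else 2 * d + q - s / 2

/-- lexicographic order -/
def Lx (s q s' q' : ℕ) : Prop := s < s' ∨ (s = s' ∧ q < q')

theorem lx_iff {d : ℕ} (hd : 0 < d) (k k' : ℕ) :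
    k < k' ↔ Lx (k / d) (k % d) (k' / d) (k' % d) := by
  have e1 := Nat.div_add_mod k d
  have e2 := Nat.div_add_mod k' d
  have l1 := Nat.mod_lt k hd
  have l2 := Nat.mod_lt k' hd
  unfold Lx
  constructor
  · intro h
    have := Nat.div_le_div_right (c := d) h.le
    rcases this.lt_or_eq with h' | h'
    · exact Or.inl h'
    · right; refine ⟨h', ?_⟩
      rw [h'] at e1; omega
  · rintro (h | ⟨h, h'⟩)
    · by_contra hc
      have := Nat.div_le_div_right (c := d) (not_lt.mp hc)
      omega
    · rw [h] at e1; omega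

/-- predecessors in lexicographic form -/
def PL (d : ℕ) (F : ℕ → ℕ → ℕ) (s q s' q' : ℕ) : Prop :=
  Lx s q s' q' ∧ F s q = F s' q' ∧ ∀ x y, y < d → Lx s q x y → Lx x y s' q' → F x y ≠ F s' q'

theorem pl_of_pr {d : ℕ} (hd : 0 < d) (F : ℕ → ℕ → ℕ) {z w : ℕ}
    (h : Pr (fun k => F (k / d) (k % d)) z w) : PL d F (z / d) (z % d) (w / d) (w % d) := by
  obtain ⟨h1, h2, h3⟩ := h
  refine ⟨(lx_iff hd _ _).1 h1, h2, fun x y hy hx hx' => ?_⟩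
  have e1 : (d * x + y) / d = x := by
    rw [Nat.mul_add_div hd, Nat.div_eq_of_lt hy, add_zero]
  have e2 : (d * x + y) % d = y := by
    rw [Nat.mul_add_mod, Nat.mod_eq_of_lt hy]
  have := h3 (d * x + y)
  simp only [lx_iff hd, e1, e2] at this
  exact this hx hx'

theorem pl_uniq {d : ℕ} {F : ℕ → ℕ → ℕ} {s q s' q' : ℕ} (h : PL d F s q s' q') (s0 q0 : ℕ)
    (hq0 : q0 < d)
    (h1 : Lx s0 q0 s' q') (h2 : F s0 q0 = F s' q')
    (h3 : ∀ x y, y < d → Lx s0 q0 x y → Lx x y s' q' → F x y ≠ F s' q') (hq : q < d) :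
    s = s0 ∧ q = q0 := by
  obtain ⟨k1, k2, k3⟩ := h
  by_contra hc
  have : Lx s q s0 q0 ∨ Lx s0 q0 s q := by unfold Lx; omega
  rcases this with h | h
  · exact k3 _ _ hq0 h h1 h2
  · exact h3 _ _ hq h k1 k2

theorem row_pred {d s q s' q' : ℕ} (hd : 0 < d) (hq : q < d) (hq' : q' < d)
    (hs : s' < 2 * d + 1 ∨ (s' = 2 * d + 1 ∧ q' = 0))
    (h : PL d (Tr d) s q s' q') :
    (s' % 2 = 0 ∧ 1 ≤ q' ∧ s = s' ∧ q + 1 = q') ∨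
    (s' % 2 = 0 ∧ q' = 0 ∧ 4 ≤ s' ∧ s + 3 = s' ∧ q + 1 = d) ∨
    (s' % 2 = 1 ∧ 1 ≤ q' ∧ 3 ≤ s' ∧ s + 2 = s' ∧ q + 1 = q') ∨
    (s' % 2 = 1 ∧ q' = 0 ∧ s + 1 = s' ∧ q + 1 = d) := by
  rcases Nat.mod_two_eq_zero_or_one s' with hp | hp
  · rcases Nat.eq_zero_or_pos q' with hz | hz
    · by_cases h4 : 4 ≤ s'
      · have := pl_uniq h (s' - 3) (d - 1) (by omega) (by unfold Lx; omega)
          (by unfold Tr Mo; split_ifs <;> omega)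
          (by intro x y hy; unfold Lx Tr Mo; split_ifs <;> omega) hq
        omega
      · exfalso
        obtain ⟨k1, k2, k3⟩ := h
        revert k1 k2; unfold Lx Tr Mo; split_ifs <;> omega
    · have := pl_uniq h s' (q' - 1) (by omega) (by unfold Lx; omega)
          (by unfold Tr Mo; split_ifs <;> omega)
          (by intro x y hy; unfold Lx Tr Mo; split_ifs <;> omega) hq
      omega
  · rcases Nat.eq_zero_or_pos q' with hz | hz
    · have := pl_uniq h (s' - 1) (d - 1) (by omega) (by unfold Lx; omega)
          (by unfold Tr Mo; split_ifs <;> omega)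
          (by intro x y hy; unfold Lx Tr Mo; split_ifs <;> omega) hq
      omega
    · by_cases h4 : 3 ≤ s'
      · have := pl_uniq h (s' - 2) (q' - 1) (by omega) (by unfold Lx; omega)
          (by unfold Tr Mo; split_ifs <;> omega)
          (by intro x y hy; unfold Lx Tr Mo; split_ifs <;> omega) hq
        omega
      · exfalso
        obtain ⟨k1, k2, k3⟩ := h
        revert k1 k2; unfold Lx Tr Mo; split_ifs <;> omega

theorem col_pred {d s q s' q' : ℕ} (hd : 0 < d) (hq : q < d) (hq' : q' < d)
    (hs : s' < 2 * d + 1 ∨ (s' = 2 * d + 1 ∧ q' = 0))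
    (h : PL d (Tc d) s q s' q') :
    (s' % 2 = 0 ∧ 1 ≤ q' ∧ 2 ≤ s' ∧ s + 2 = s' ∧ q + 1 = q') ∨
    (s' % 2 = 0 ∧ q' = 0 ∧ 2 ≤ s' ∧ s + 1 = s' ∧ q + 1 = d) ∨
    (s' % 2 = 1 ∧ 1 ≤ q' ∧ s = s' ∧ q + 1 = q') ∨
    (s' % 2 = 1 ∧ q' = 0 ∧ 3 ≤ s' ∧ s + 3 = s' ∧ q + 1 = d) := by
  rcases Nat.mod_two_eq_zero_or_one s' with hp | hp
  · rcases Nat.eq_zero_or_pos q' with hz | hz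
    · by_cases h4 : 2 ≤ s'
      · have := pl_uniq h (s' - 1) (d - 1) (by omega) (by unfold Lx; omega)
          (by unfold Tc Mo; split_ifs <;> omega)
          (by intro x y hy; unfold Lx Tc Mo; split_ifs <;> omega) hq
        omega
      · exfalso
        obtain ⟨k1, k2, k3⟩ := h
        revert k1 k2; unfold Lx Tc Mo; split_ifs <;> omega
    · by_cases h4 : 2 ≤ s'
      · have := pl_uniq h (s' - 2) (q' - 1) (by omega) (by unfold Lx; omega)
          (by unfold Tc Mo; split_ifs <;> omega)
          (by intro x y hy; unfold Lx Tc Mo; split_ifs <;> omega) hq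
        omega
      · exfalso
        obtain ⟨k1, k2, k3⟩ := h
        revert k1 k2; unfold Lx Tc Mo; split_ifs <;> omega
  · rcases Nat.eq_zero_or_pos q' with hz | hz
    · by_cases h4 : 3 ≤ s'
      · have := pl_uniq h (s' - 3) (d - 1) (by omega) (by unfold Lx; omega)
          (by unfold Tc Mo; split_ifs <;> omega)
          (by intro x y hy; unfold Lx Tc Mo; split_ifs <;> omega) hq
        omega
      · exfalso
        obtain ⟨k1, k2, k3⟩ := h
        revert k1 k2; unfold Lx Tc Mo; split_ifs <;> omega
    · have := pl_uniq h s' (q' - 1) (by omega) (by unfold Lx; omega)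
          (by unfold Tc Mo; split_ifs <;> omega)
          (by intro x y hy; unfold Lx Tc Mo; split_ifs <;> omega) hq
      omega


theorem T_row {d s q s' q' : ℕ} (hd : 0 < d) (hq : q < d) (hq' : q' < d)
    (hs : s' < 2 * d + 1 ∨ (s' = 2 * d + 1 ∧ q' = 0))
    (h : PL d (Tr d) s q s' q') : Ta d s q < Ta d s' q' := by
  have := row_pred hd hq hq' hs h
  unfold Ta
  rcases this with h | h | h | h <;> split_ifs <;> omega

theorem T_col {d s q s' q' : ℕ} (hd : 0 < d) (hq : q < d) (hq' : q' < d)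
    (hs : s' < 2 * d + 1 ∨ (s' = 2 * d + 1 ∧ q' = 0))
    (h : PL d (Tc d) s q s' q') : Tb d s q < Tb d s' q' := by
  have := col_pred hd hq hq' hs h
  unfold Tb
  rcases this with h | h | h | h <;> split_ifs <;> omega

theorem T_both {d s q s' q' s2 q2 : ℕ} (hd : 0 < d) (hq : q < d) (hq' : q' < d) (hq2 : q2 < d)
    (hs : s' < 2 * d + 1 ∨ (s' = 2 * d + 1 ∧ q' = 0))
    (h : PL d (Tr d) s q s' q') (h' : PL d (Tc d) s2 q2 s' q') :
    Ta d s q < Ta d s2 q2 ∧ Tb d s2 q2 < Tb d s q := by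
  have h1 := row_pred hd hq hq' hs h
  have h2 := col_pred hd hq2 hq' hs h'
  unfold Ta Tb
  rcases h1 with h1 | h1 | h1 | h1 <;> rcases h2 with h2 | h2 | h2 | h2 <;>
    first
    | (exfalso; omega)
    | (constructor <;> split_ifs <;> omega)

def Block (m K : ℕ) : Prop := ∃ r c a b : ℕ → ℕ, 0 < K ∧ (∀ k ≤ K, r k < m) ∧
  (∀ k ≤ K, c k < m) ∧ r 0 = 0 ∧ c 0 = 0 ∧ r K = 1 ∧ c K = 0 ∧ Valid (K + 1) r c a b ∧
  ∀ z < K, r z ≠ 1 → (∀ k, z < k → k < K → r k ≠ r z) → b K < b z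

theorem Tr_lt {d s q : ℕ} (hq : q < d) (hs : s ≤ 2 * d + 1) : Tr d s q < d + 1 := by
  unfold Tr Mo; split_ifs <;> omega

theorem Tc_lt {d s q : ℕ} (hq : q < d) (hs : s ≤ 2 * d + 1) : Tc d s q < d + 1 := by
  unfold Tc Mo; split_ifs <;> omega

theorem T_later {d v : ℕ} (hd : 0 < d) (hv : v < d + 1) (hv1 : v ≠ 1) :
    ∃ q0 < d, Tr d (2 * d - 1) q0 = v := by
  by_cases h : v = 0
  · refine ⟨d - 1, by omega, ?_⟩
    rw [h]; unfold Tr Mo; split_ifs <;> omega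
  · refine ⟨v - 2, by omega, ?_⟩
    unfold Tr Mo; split_ifs <;> omega

theorem block (d : ℕ) (hd : 0 < d) : Block (d + 1) (d * (2 * d + 1)) := by
  have hK1 : (d * (2 * d + 1)) / d = 2 * d + 1 := Nat.mul_div_cancel_left _ hd
  have hK2 : (d * (2 * d + 1)) % d = 0 := Nat.mul_mod_right _ _
  have hs : ∀ k ≤ d * (2 * d + 1), k / d < 2 * d + 1 ∨ (k / d = 2 * d + 1 ∧ k % d = 0) := by
    intro k hk
    rcases hk.lt_or_eq with h | h
    · have := (lx_iff hd _ _).1 h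
      rw [hK1, hK2] at this
      unfold Lx at this; omega
    · right; rw [h]; exact ⟨hK1, hK2⟩
  have hm : ∀ k, k % d < d := fun k => Nat.mod_lt k hd
  refine ⟨fun k => Tr d (k / d) (k % d), fun k => Tc d (k / d) (k % d),
    fun k => Ta d (k / d) (k % d), fun k => Tb d (k / d) (k % d), by positivity, ?_, ?_, ?_, ?_,
    ?_, ?_, ⟨?_, ?_, ?_⟩, ?_⟩
  · intro k hk
    have h1 := hs k hk
    exact Tr_lt (hm k) (by omega)
  · intro k hk
    have h1 := hs k hk
    exact Tc_lt (hm k) (by omega)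
  · simp [Tr, Mo]
  · simp [Tc, Mo]
  · simp only [hK1, hK2]
    unfold Tr Mo; split_ifs <;> omega
  · simp only [hK1, hK2]
    unfold Tc Mo; split_ifs <;> omega
  · intro w hw z hz
    exact T_row hd (hm _) (hm _) (hs w (by omega)) (pl_of_pr hd _ hz)
  · intro w hw z hz
    exact T_col hd (hm _) (hm _) (hs w (by omega)) (pl_of_pr hd _ hz)
  · intro w hw z u hz hu
    exact T_both hd (hm _) (hm _) (hm _) (hs w (by omega)) (pl_of_pr hd _ hz) (pl_of_pr hd _ hu)
  · intro z hz hz1 hz2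
    simp only [hK1, hK2]
    have h1 : z / d < 2 * d + 1 := by
      have := (lx_iff hd _ _).1 hz
      rw [hK1, hK2] at this
      unfold Lx at this; omega
    have h2 := hm z
    -- the later visit of the same row
    obtain ⟨v, hv⟩ : ∃ v, v = Tr d (z / d) (z % d) := ⟨_, rfl⟩
    have hvd : v < d + 1 := hv ▸ Tr_lt h2 (by omega)
    replace hz1 : v ≠ 1 := hv ▸ hz1
    obtain ⟨q0, hq0, hq1⟩ := T_later hd hvd hz1
    have e1 : (d * (2 * d - 1) + q0) / d = 2 * d - 1 := by
      rw [Nat.mul_add_div hd, Nat.div_eq_of_lt hq0, add_zero]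
    have e2 : (d * (2 * d - 1) + q0) % d = q0 := by
      rw [Nat.mul_add_mod, Nat.mod_eq_of_lt hq0]
    have := hz2 (d * (2 * d - 1) + q0)
    simp only [lx_iff hd, e1, e2, hK1, hK2] at this
    have h3 : ¬ Lx (z / d) (z % d) (2 * d - 1) q0 := fun h =>
      this h (by unfold Lx; omega) (hq1.trans hv)
    clear hz2 this e1 e2
    generalize z / d = s at *
    generalize z % d = q at *
    by_cases hs2 : s = 2 * d
    · exfalso; apply hz1; rw [hv, hs2]
      unfold Tr Mo; split_ifs <;> omega
    · have : s = 2 * d - 1 := by unfold Lx at h3; omega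
      subst this
      unfold Tb; split_ifs <;> omega

theorem glue {m n K N : ℕ} (hm : 2 ≤ m) (hB : Block m K) (hG : Good m n N) :
    Good m (n + m - 1) (K + N) := by
  obtain ⟨r, c, a, b, hK, hr, hc, hr0, hc0, hrK, hcK, ⟨hv1, hv2, hv3⟩, hz⟩ := hB
  obtain ⟨r2, c2, a2, b2, hN, hr', hc', hr0', hc0', hv1', hv2', hv3'⟩ := hG
  have hn : 0 < n := by have := hc' 0 hN; omega
  let sw : ℕ → ℕ := fun v => if v = 0 then 1 else if v = 1 then 0 else v
  let cm : ℕ → ℕ := fun v => if v = 0 then 0 else v + n - 1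
  have hsw : ∀ x y, sw x = sw y → x = y := by
    intro x y h; simp only [sw] at h; split_ifs at h <;> omega
  have hcm : ∀ x y, cm x = cm y → x = y := by
    intro x y h; simp only [cm] at h; split_ifs at h <;> omega
  let MA := ∑ i ∈ Finset.range K, a i
  let MB := ∑ i ∈ Finset.range N, b2 i
  have hMA : ∀ i < K, a i ≤ MA := fun i hi =>
    Finset.single_le_sum (f := a) (fun _ _ => Nat.zero_le _) (Finset.mem_range.2 hi)
  have hMB : ∀ i < N, b2 i ≤ MB := fun i hi =>
    Finset.single_le_sum (f := b2) (fun _ _ => Nat.zero_le _) (Finset.mem_range.2 hi)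
  let r3 : ℕ → ℕ := fun k => if k < K then r k else sw (r2 (k - K))
  let c3 : ℕ → ℕ := fun k => if k < K then cm (c k) else c2 (k - K)
  let a3 : ℕ → ℕ := fun k => if k < K then a k else MA + 1 + a2 (k - K)
  let b3 : ℕ → ℕ := fun k => if k < K then (if b k ≤ b K then b k else b k + MB + 1)
    else b K + 1 + b2 (k - K)
  have r3l : ∀ k < K, r3 k = r k := fun k hk => if_pos hk
  have r3r : ∀ j, r3 (K + j) = sw (r2 j) := fun j => by simp [r3]
  have c3l : ∀ k < K, c3 k = cm (c k) := fun k hk => if_pos hk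
  have c3r : ∀ j, c3 (K + j) = c2 j := fun j => by simp [c3]
  have a3l : ∀ k < K, a3 k = a k := fun k hk => if_pos hk
  have a3r : ∀ j, a3 (K + j) = MA + 1 + a2 j := fun j => by simp [a3]
  have b3l : ∀ k < K, b3 k = if b k ≤ b K then b k else b k + MB + 1 := fun k hk => if_pos hk
  have b3r : ∀ j, b3 (K + j) = b K + 1 + b2 j := fun j => by simp [b3]
  have r3K : r3 K = 1 := by have := r3r 0; simpa [hr0', sw] using this
  have c3K : c3 K = 0 := by have := c3r 0; simpa [hc0'] using this
  have rw1 : ∀ k ≤ K, r3 k = r k := by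
    intro k hk
    rcases hk.lt_or_eq with h | h
    · exact r3l k h
    · rw [h, r3K, hrK]
  have cw1 : ∀ k ≤ K, c3 k = cm (c k) := by
    intro k hk
    rcases hk.lt_or_eq with h | h
    · exact c3l k h
    · rw [h, c3K, hcK]; simp [cm]
  -- transfer of predecessors
  have pr1 : ∀ w ≤ K, ∀ z, Pr r3 z w → Pr r z w := by
    rintro w hw z ⟨h1, h2, h3⟩
    refine ⟨h1, ?_, fun k hk hk' => ?_⟩
    · rw [rw1 z (by omega), rw1 w hw] at h2; exact h2
    · have := h3 k hk hk'
      rw [rw1 k (by omega), rw1 w hw] at this; exact this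
  have pc1 : ∀ w ≤ K, ∀ z, Pr c3 z w → Pr c z w := by
    rintro w hw z ⟨h1, h2, h3⟩
    refine ⟨h1, ?_, fun k hk hk' => ?_⟩
    · rw [cw1 z (by omega), cw1 w hw] at h2; exact hcm _ _ h2
    · have := h3 k hk hk'
      rw [cw1 k (by omega), cw1 w hw] at this
      intro h; exact this (by rw [h])
  have pr2 : ∀ i j, Pr r3 (K + i) (K + j) → Pr r2 i j := by
    rintro i j ⟨h1, h2, h3⟩
    refine ⟨by omega, ?_, fun k hk hk' => ?_⟩
    · rw [r3r, r3r] at h2; exact hsw _ _ h2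
    · have := h3 (K + k) (by omega) (by omega)
      rw [r3r, r3r] at this
      intro h; exact this (by rw [h])
  have pc2 : ∀ i j, Pr c3 (K + i) (K + j) → Pr c2 i j := by
    rintro i j ⟨h1, h2, h3⟩
    refine ⟨by omega, ?_, fun k hk hk' => ?_⟩
    · rw [c3r, c3r] at h2; exact h2
    · have := h3 (K + k) (by omega) (by omega)
      rw [c3r, c3r] at this
      exact this
  have pc3 : ∀ z < K, ∀ j < N, 0 < j → ¬ Pr c3 z (K + j) := by
    rintro z hzK j hj hj0 ⟨h1, h2, h3⟩
    have h4 := h3 K hzK (by omega)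
    rw [c3K, c3r] at h4
    rw [c3l z hzK, c3r] at h2
    have h5 := hc' j hj
    simp only [cm] at h2
    split_ifs at h2 <;> omega
  have pr3 : ∀ z < K, ∀ j, 0 < j → Pr r3 z (K + j) → b K < b z := by
    rintro z hzK j hj0 ⟨h1, h2, h3⟩
    apply hz z hzK
    · have := h3 K hzK (by omega)
      rw [r3K, ← h2, r3l z hzK] at this
      exact this.symm
    · intro k hk hk'
      have := h3 k hk (by omega)
      rw [r3l k hk', ← h2, r3l z hzK] at this
      exact this
  -- decomposition of indices
  have split : ∀ w, w < K ∨ ∃ j, w = K + j := by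
    intro w
    rcases lt_or_ge w K with h | h
    · exact Or.inl h
    · exact Or.inr ⟨w - K, by omega⟩
  refine ⟨r3, c3, a3, b3, by omega, ?_, ?_, ?_, ?_, ?_, ?_, ?_⟩
  · intro k hk
    rcases split k with h | ⟨j, rfl⟩
    · rw [r3l k h]; exact hr k h.le
    · rw [r3r]
      have := hr' j (by omega)
      simp only [sw]; split_ifs <;> omega
  · intro k hk
    rcases split k with h | ⟨j, rfl⟩
    · rw [c3l k h]
      have := hc k h.le
      simp only [cm]; split_ifs <;> omega
    · rw [c3r]
      have := hc' j (by omega)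
      omega
  · rw [r3l 0 hK, hr0]
  · rw [c3l 0 hK, hc0]; simp [cm]
  · intro w hw z hp
    rcases split w with h | ⟨j, rfl⟩
    · have h1 := pr1 w h.le z hp
      rw [a3l z (by have := h1.1; omega), a3l w h]
      exact hv1 w (by omega) z h1
    · rcases split z with h | ⟨i, rfl⟩
      · rw [a3l z h, a3r]
        have := hMA z h
        omega
      · rw [a3r, a3r]
        have := hv1' j (by omega) i (pr2 i j hp)
        omega
  · intro w hw z hp
    rcases split w with h | ⟨j, rfl⟩
    · have h1 := pc1 w h.le z hp
      rw [b3l z (by have := h1.1; omega), b3l w h]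
      have := hv2 w (by omega) z h1
      split_ifs <;> omega
    · rcases split z with h | ⟨i, rfl⟩
      · rcases Nat.eq_zero_or_pos j with h0 | h0
        · subst h0
          have := hv2 K (by omega) z (pc1 K le_rfl z hp)
          rw [b3l z h, b3r]
          split_ifs <;> omega
        · exact absurd hp (pc3 z h j (by omega) h0)
      · rw [b3r, b3r]
        have := hv2' j (by omega) i (pc2 i j hp)
        omega
  · intro w hw z u hp hp'
    rcases Nat.lt_or_ge K w with h | h
    · obtain ⟨j, rfl⟩ : ∃ j, w = K + j := ⟨w - K, by omega⟩
      rcases split u with hu | ⟨i, rfl⟩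
      · exact absurd hp' (pc3 u hu j (by omega) (by omega))
      · have hi : i < j := by have := hp'.1; omega
        rcases split z with hzz | ⟨l, rfl⟩
        · rw [a3l z hzz, a3r, b3l z hzz, b3r]
          have h1 := pr3 z hzz j (by omega) hp
          have h2 := hMA z hzz
          have h3 := hMB i (by omega)
          split_ifs <;> omega
        · rw [a3r, a3r, b3r, b3r]
          have := hv3' j (by omega) l i (pr2 _ _ hp) (pc2 _ _ hp')
          omega
    · have h1 := pr1 w h z hp
      have h2 := pc1 w h u hp'
      have h3 := hv3 w (by omega) z u h1 h2
      have h4 := h1.1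
      have h5 := h2.1
      rw [a3l z (by omega), a3l u (by omega), b3l z (by omega), b3l u (by omega)]
      refine ⟨h3.1, ?_⟩
      split_ifs <;> omega

theorem good_all : ∀ t m n : ℕ, m + n ≤ t → 0 < m → 0 < n →
    ∃ N, N + m + n = 2 * m * n + 1 ∧ Good m n N := by
  intro t
  induction t with
  | zero => intro m n h1 h2; omega
  | succ t ih =>
    have key : ∀ m n : ℕ, m + n ≤ t + 1 → 0 < m → m ≤ n →
        ∃ N, N + m + n = 2 * m * n + 1 ∧ Good m n N := by
      intro m n h hm hmn
      rcases Nat.lt_or_ge 1 m with h1 | h1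
      · obtain ⟨d, rfl⟩ : ∃ d, m = d + 1 := ⟨m - 1, by omega⟩
        obtain ⟨e, rfl⟩ : ∃ e, n = e + d := ⟨n - d, by omega⟩
        obtain ⟨N, hN, hG⟩ := ih (d + 1) e (by omega) (by omega) (by omega)
        refine ⟨d * (2 * d + 1) + N, by nlinarith, ?_⟩
        have := glue (by omega) (block d (by omega)) hG
        exact this
      · obtain rfl : m = 1 := by omega
        exact ⟨n, by ring, (good_one n (by omega)).swap⟩
    intro m n h hm hn
    rcases le_total m n with h1 | h1
    · exact key m n h hm h1
    · obtain ⟨N, hN, hG⟩ := key n m (by omega) hn h1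
      exact ⟨N, by rw [mul_right_comm] at hN; omega, hG.swap⟩

namespace MultiDigraph

theorem IsPathFrom.snoc {G : MultiDigraph} {u v : G.V} {P : List G.E} (h : G.IsPathFrom u v P)
    (e : G.E) (he : G.src e = v) : G.IsPathFrom u (G.dst e) (P ++ [e]) := by
  obtain ⟨h1, h2, h3, h4⟩ := h
  refine ⟨by simp, ?_, ?_, ?_⟩
  · refine List.isChain_append.2 ⟨h2, by simp, ?_⟩
    intro x hx y hy
    simp at hy
    subst hy
    rw [he]; exact h4 x hx
  · rw [List.head?_append_of_ne_nil _ h1]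
    exact h3
  · simp

theorem IsPathFrom.single {G : MultiDigraph} (e : G.E) :
    G.IsPathFrom (G.src e) (G.dst e) [e] := by
  refine ⟨by simp, List.isChain_singleton _, by simp, by simp⟩

theorem mem_snoc {G : MultiDigraph} {P : List G.E} {e x : G.E} (h : x ∈ P ++ [e]) :
    x ∈ P ∨ x = e := by
  simpa using h

theorem IsPathFrom.next {G : MultiDigraph} {u v : G.V} {P : List G.E} (h : G.IsPathFrom u v P)
    {e : G.E} (he : e ∈ P) (hv : G.dst e ≠ v) : ∃ f, [e, f] <:+: P ∧ G.dst e = G.src f := by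
  obtain ⟨h1, h2, h3, h4⟩ := h
  obtain ⟨l1, l2, rfl⟩ := List.append_of_mem he
  cases l2 with
  | nil => exact absurd (h4 e (by simp)) hv
  | cons f l3 =>
    refine ⟨f, ⟨l1, l3, by simp⟩, ?_⟩
    have := (List.isChain_append.1 h2).2.1
    simp at this
    exact this.1

theorem IsPathFrom.pw {G : MultiDigraph} (rk : G.V → ℕ) (hrk : ∀ e, rk (G.src e) < rk (G.dst e))
    {u v : G.V} {P : List G.E} (h : G.IsPathFrom u v P) :
    P.Pairwise (fun e f => rk (G.dst e) ≤ rk (G.src f)) := by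
  have h2 := h.2.1
  have h3 : List.IsChain (fun e f => rk (G.dst e) ≤ rk (G.src f)) P :=
    List.IsChain.imp (fun a b hab => by rw [hab]) h2
  haveI : IsTrans G.E (fun e f => rk (G.dst e) ≤ rk (G.src f)) :=
    ⟨fun a b c h1 h2 => h1.trans ((hrk b).le.trans h2)⟩
  exact List.isChain_iff_pairwise.1 h3

theorem IsPathFrom.uniq {G : MultiDigraph} (rk : G.V → ℕ)
    (hrk : ∀ e, rk (G.src e) < rk (G.dst e))
    {u v : G.V} {P : List G.E} (h : G.IsPathFrom u v P) {e f g : G.E}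
    (hf : [f, e] <:+: P) (hg : [g, e] <:+: P) : f = g := by
  have hn : P.Nodup := (h.pw rk hrk).imp (fun {a b} hab hh => by
    subst hh; have := hrk a; omega)
  obtain ⟨l1, r1, h1⟩ := hf
  obtain ⟨l2, r2, h2⟩ := hg
  have e1 : (l1 ++ [f]) ++ e :: r1 = P := by simpa using h1
  have e2 : (l2 ++ [g]) ++ e :: r2 = P := by simpa using h2
  have n1 : e ∉ l1 ++ [f] := by
    rw [← e1] at hn
    intro hh
    exact (List.nodup_append.1 hn).2.2 e hh e (by simp) rfl
  have n2 : e ∉ r1 := by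
    rw [← e1] at hn
    exact (List.nodup_cons.1 (List.nodup_append.1 hn).2.1).1
  have := (List.append_cons_inj_of_notMem n1 n2).1 (e1.trans e2.symm)
  have h3 := this.1
  simpa using (List.append_inj' h3 rfl).2

theorem acyclic_of_rank {G : MultiDigraph} (rk : G.V → ℕ)
    (hrk : ∀ e, rk (G.src e) < rk (G.dst e)) : G.Acyclic := by
  intro v P h
  have hp := h.pw rk hrk
  obtain ⟨h1, h2, h3, h4⟩ := h
  cases P with
  | nil => exact h1 rfl
  | cons a l =>
    have ha := h3 a (by simp)
    have hl := h4 ((a :: l).getLast h1) (by rw [List.getLast?_eq_getLast_of_ne_nil h1]; simp)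
    have h5 := List.getLast_mem h1
    have h6 := hrk a
    have h7 := hrk ((a :: l).getLast h1)
    rw [List.mem_cons] at h5
    rcases h5 with h5 | h5
    · rw [h5] at hl
      rw [ha, hl] at h6
      omega
    · have := (List.pairwise_cons.1 hp).1 _ h5
      rw [hl] at h7
      rw [ha] at h6
      omega

end MultiDigraph

/-- last occurrence of label `i` before time `t` -/
def cur (f : ℕ → ℕ) (N : ℕ) : ℕ → ℕ → Option (Fin N)
  | 0, _ => none
  | t + 1, i => if h : t < N ∧ f t = i then some ⟨t, h.1⟩ else cur f N t i

theorem cur_some {f : ℕ → ℕ} {N t i : ℕ} (ht : t ≤ N) {z : Fin N} (h : cur f N t i = some z) :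
    z.1 < t ∧ f z = i ∧ ∀ k, z.1 < k → k < t → f k ≠ i := by
  induction t with
  | zero => simp [cur] at h
  | succ t ih =>
    rw [cur] at h
    split_ifs at h with h1
    · simp at h
      subst h
      refine ⟨by simp, h1.2, fun k hk hk' => ?_⟩
      simp at hk; omega
    · obtain ⟨a1, a2, a3⟩ := ih (by omega) h
      refine ⟨by omega, a2, fun k hk hk' => ?_⟩
      by_cases hkt : k = t
      · subst hkt; intro h2; exact h1 ⟨by omega, h2⟩
      · exact a3 k hk (by omega)

theorem cur_none {f : ℕ → ℕ} {N t i : ℕ} (ht : t ≤ N) (h : cur f N t i = none) :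
    ∀ k < t, f k ≠ i := by
  induction t with
  | zero => intro k hk; omega
  | succ t ih =>
    rw [cur] at h
    split_ifs at h with h1
    · intro k hk
      by_cases hkt : k = t
      · subst hkt; intro h2; exact h1 ⟨by omega, h2⟩
      · exact ih (by omega) h k (by omega)

inductive VV (c : Fin 2 → ℕ) (N : ℕ) : Type
  | S (g : Fin 2)
  | R (g : Fin 2)
  | St (g : Fin 2) (i : Fin (c g))
  | A (k : Fin N)
  | B (k : Fin N)

inductive EE (c : Fin 2 → ℕ) (N : ℕ) : Type
  | s (g : Fin 2) (i : Fin (c g))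
  | p (g : Fin 2) (k : Fin N)
  | e (k : Fin N)
  | t (g : Fin 2) (i : Fin (c g))

instance VVfin (c : Fin 2 → ℕ) (N : ℕ) : Finite (VV c N) := by
  refine Finite.of_surjective
    (fun x : (Fin 2 ⊕ Fin 2) ⊕ (Σ g : Fin 2, Fin (c g)) ⊕ (Fin N ⊕ Fin N) =>
      match x with
      | .inl (.inl g) => VV.S g
      | .inl (.inr g) => VV.R g
      | .inr (.inl ⟨g, i⟩) => VV.St g i
      | .inr (.inr (.inl k)) => VV.A k
      | .inr (.inr (.inr k)) => VV.B k) ?_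
  intro y
  cases y with
  | S g => exact ⟨.inl (.inl g), rfl⟩
  | R g => exact ⟨.inl (.inr g), rfl⟩
  | St g i => exact ⟨.inr (.inl ⟨g, i⟩), rfl⟩
  | A k => exact ⟨.inr (.inr (.inl k)), rfl⟩
  | B k => exact ⟨.inr (.inr (.inr k)), rfl⟩

instance EEfin (c : Fin 2 → ℕ) (N : ℕ) : Finite (EE c N) := by
  refine Finite.of_surjective
    (fun x : ((Σ g : Fin 2, Fin (c g)) ⊕ (Σ g : Fin 2, Fin (c g))) ⊕ ((Fin 2 × Fin N) ⊕ Fin N) =>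
      match x with
      | .inl (.inl ⟨g, i⟩) => EE.s g i
      | .inl (.inr ⟨g, i⟩) => EE.t g i
      | .inr (.inl (g, k)) => EE.p g k
      | .inr (.inr k) => EE.e k) ?_
  intro y
  cases y with
  | s g i => exact ⟨.inl (.inl ⟨g, i⟩), rfl⟩
  | t g i => exact ⟨.inl (.inr ⟨g, i⟩), rfl⟩
  | p g k => exact ⟨.inr (.inl (g, k)), rfl⟩
  | e k => exact ⟨.inr (.inr k), rfl⟩

/-- current node on path `i` of group `g` at time `t` -/
def nd (c : Fin 2 → ℕ) (N : ℕ) (f : Fin 2 → ℕ → ℕ) (g : Fin 2) (t : ℕ) (i : Fin (c g)) : VV c N :=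
  match cur (f g) N t i with
  | none => VV.St g i
  | some z => VV.B z

section graph
variable {c : Fin 2 → ℕ} {N : ℕ} {f : Fin 2 → ℕ → ℕ} (hf : ∀ g k, k < N → f g k < c g)

noncomputable abbrev GG (hf : ∀ g k, k < N → f g k < c g) : MultiDigraph where
  V := VV c N
  E := EE c N
  fintV := Fintype.ofFinite _
  fintE := Fintype.ofFinite _
  src := fun x => match x with
    | .s g _ => .S g
    | .p g k => nd c N f g k ⟨f g k, hf g k k.2⟩
    | .e k => .A k
    | .t g i => nd c N f g N i
  dst := fun x => match x with
    | .s g i => .St g i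
    | .p _ k => .A k
    | .e k => .B k
    | .t g _ => .R g

def rkk : VV c N → ℕ
  | .S _ => 0
  | .St _ _ => 1
  | .A k => 2 * k + 2
  | .B k => 2 * k + 3
  | .R _ => 2 * N + 5

theorem rk_nd (g : Fin 2) (t : ℕ) (ht : t ≤ N) (i : Fin (c g)) :
    rkk (nd c N f g t i) < 2 * t + 2 := by
  unfold nd
  split
  · simp [rkk]
  · rename_i z hz
    have := cur_some ht hz
    simp only [rkk]; omega

theorem rk_lt (x : (GG hf).E) : rkk ((GG hf).src x) < rkk ((GG hf).dst x) := by
  cases x with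
  | s g i => simp [GG, rkk]
  | p g k => exact rk_nd g k k.2.le _
  | e k => simp [GG, rkk]
  | t g i =>
    have := rk_nd (f := f) g N le_rfl i
    show rkk (nd c N f g N i) < 2 * N + 5
    omega

theorem nd_St {g g' : Fin 2} {t : ℕ} {i : Fin (c g)} {i' : Fin (c g')}
    (h : VV.St g' i' = nd c N f g t i) : g' = g ∧ i'.1 = i.1 ∧ cur (f g) N t i = none := by
  unfold nd at h
  split at h
  · rename_i h1
    cases h
    exact ⟨rfl, rfl, h1⟩
  · cases h

theorem nd_B {g : Fin 2} {t : ℕ} {i : Fin (c g)} {y : Fin N}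
    (h : VV.B y = nd c N f g t i) : cur (f g) N t i = some y := by
  unfold nd at h
  split at h
  · cases h
  · rename_i h1
    cases h
    exact h1

theorem nd_A {g : Fin 2} {t : ℕ} {i : Fin (c g)} {y : Fin N}
    (h : VV.A y = nd c N f g t i) : False := by
  unfold nd at h
  split at h <;> cases h

theorem nd_S {g g' : Fin 2} {t : ℕ} {i : Fin (c g)}
    (h : VV.S g' = nd c N f g t i) : False := by
  unfold nd at h
  split at h <;> cases h

theorem nd_R {g g' : Fin 2} {t : ℕ} {i : Fin (c g)}
    (h : VV.R g' = nd c N f g t i) : False := by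
  unfold nd at h
  split at h <;> cases h

theorem src_S {g : Fin 2} {x : (GG hf).E} (h : VV.S g = (GG hf).src x) : ∃ i, x = EE.s g i := by
  cases x with
  | s g' i => cases h; exact ⟨i, rfl⟩
  | p g' k => exact (nd_S h).elim
  | e k => cases h
  | t g' i => exact (nd_S h).elim

theorem src_R {g : Fin 2} {x : (GG hf).E} (h : VV.R g = (GG hf).src x) : False := by
  cases x with
  | s g' i => cases h
  | p g' k => exact (nd_R h).elim
  | e k => cases h
  | t g' i => exact (nd_R h).elim

theorem src_A {k : Fin N} {x : (GG hf).E} (h : VV.A k = (GG hf).src x) : x = EE.e k := by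
  cases x with
  | s g' i => cases h
  | p g' k => exact (nd_A h).elim
  | e k => cases h; rfl
  | t g' i => exact (nd_A h).elim

/-- label relative to group `g` -/
def lab (c : Fin 2 → ℕ) (N : ℕ) (f : Fin 2 → ℕ → ℕ) (g : Fin 2) : EE c N → ℕ
  | .s _ i => i
  | .p _ k => f g k
  | .e k => f g k
  | .t _ i => i

theorem exists_path (g : Fin 2) (i : Fin (c g)) (t : ℕ) (ht : t ≤ N) :
    ∃ P : List (GG hf).E, (GG hf).IsPathFrom (VV.S g) (nd c N f g t i) P ∧
      ∀ x ∈ P, lab c N f g x = i := by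
  induction t with
  | zero =>
    refine ⟨[EE.s g i], IsPathFrom.single (G := GG hf) (EE.s g i), ?_⟩
    intro x hx
    rw [List.mem_singleton.1 hx]
    rfl
  | succ t ih =>
    obtain ⟨P, h1, h2⟩ := ih (by omega)
    by_cases hi : f g t = i
    · have hn : nd c N f g (t + 1) i = VV.B ⟨t, ht⟩ := by
        unfold nd
        rw [cur, dif_pos ⟨ht, hi⟩]
      have k1 := h1.snoc (G := GG hf) (EE.p g ⟨t, ht⟩) (by
        have : (⟨f g t, hf g t ht⟩ : Fin (c g)) = i := Fin.ext hi
        simp only [GG, this])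
      have k2 := k1.snoc (G := GG hf) (EE.e ⟨t, ht⟩) rfl
      refine ⟨_, by rw [hn]; exact k2, ?_⟩
      intro x hx
      rcases mem_snoc (G := GG hf) hx with hx | rfl
      · rcases mem_snoc (G := GG hf) hx with hx | rfl
        · exact h2 x hx
        · exact hi
      · exact hi
    · have hn : nd c N f g (t + 1) i = nd c N f g t i := by
        unfold nd
        rw [cur, dif_neg (fun h => hi h.2)]
      exact ⟨P, by rw [hn]; exact h1, h2⟩

theorem exists_system (g : Fin 2) :
    ∃ α : Fin (c g) → List (GG hf).E, (GG hf).MengerSystem (VV.S g) (VV.R g) (c g) α := by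
  have : ∀ i : Fin (c g), ∃ P : List (GG hf).E, (GG hf).IsPathFrom (VV.S g) (VV.R g) P ∧
      ∀ x ∈ P, lab c N f g x = i := by
    intro i
    obtain ⟨P, h1, h2⟩ := exists_path hf g i N le_rfl
    refine ⟨_, h1.snoc (G := GG hf) (EE.t g i) rfl, ?_⟩
    intro x hx
    rcases mem_snoc (G := GG hf) hx with hx | rfl
    · exact h2 x hx
    · rfl
  choose α h1 h2 using this
  refine ⟨α, h1, fun i j hij x hx hx' => hij (Fin.ext ?_)⟩
  rw [← h2 i x hx, h2 j x hx']

theorem heads {g : Fin 2} {n : ℕ} {α : Fin n → List (GG hf).E}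
    (h : (GG hf).MengerSystem (VV.S g) (VV.R g) n α) :
    ∃ H : Fin n → Fin (c g), Function.Injective H ∧ ∀ j, EE.s g (H j) ∈ α j := by
  have : ∀ j, ∃ i : Fin (c g), EE.s g i ∈ α j := by
    intro j
    obtain ⟨h1, -, h3, -⟩ := h.1 j
    obtain ⟨i, hi⟩ := src_S hf (h3 ((α j).head h1) (by rw [List.head?_eq_some_head h1]; simp)).symm
    exact ⟨i, by rw [← hi]; exact List.head_mem h1⟩
  choose H hH using this
  refine ⟨H, fun i j hij => ?_, hH⟩
  by_contra hne
  have h1 := hH i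
  rw [hij] at h1
  exact h.2 i j hne _ h1 (hH j)

theorem minCut (g : Fin 2) : (GG hf).MinCut (VV.S g) (VV.R g) (c g) := by
  refine ⟨exists_system hf g, ?_⟩
  rintro ⟨α, h⟩
  obtain ⟨H, hH, -⟩ := heads hf h
  have := Fintype.card_le_of_injective H hH
  simp at this

variable {g : Fin 2} {α : Fin (c g) → List (GG hf).E}
  (h : (GG hf).MengerSystem (VV.S g) (VV.R g) (c g) α)

include h

theorem use_s (i : Fin (c g)) : ∃ j, EE.s g i ∈ α j := by
  obtain ⟨H, hH, h2⟩ := heads hf h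
  obtain ⟨j, rfl⟩ := (Finite.injective_iff_surjective.1 hH) i
  exact ⟨j, h2 j⟩

theorem not_t {g' : Fin 2} (hg : g' ≠ g) {i : Fin (c g')} {j : Fin (c g)} :
    EE.t g' i ∉ α j := by
  intro hx
  obtain ⟨x, -, hx2⟩ := (h.1 j).next hx (by intro hh; cases hh; exact hg rfl)
  exact src_R hf hx2

theorem pe {g' : Fin 2} {k : Fin N} {j : Fin (c g)} (hx : EE.p g' k ∈ α j) :
    [(EE.p g' k : EE c N), EE.e k] <:+: α j := by
  obtain ⟨x, hx1, hx2⟩ := (h.1 j).next hx (by intro hh; cases hh)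
  rw [src_A hf hx2] at hx1
  exact hx1

theorem use_p_none {w : Fin N} (hw : cur (f g) N w (f g w) = none) : ∃ j, EE.p g w ∈ α j := by
  obtain ⟨j, hj⟩ := use_s hf h ⟨f g w, hf g w w.2⟩
  refine ⟨j, ?_⟩
  obtain ⟨x, hx1, hx2⟩ := (h.1 j).next hj (by intro hh; cases hh)
  have hm : x ∈ α j := hx1.subset (by simp)
  have hwn := cur_none w.2.le hw
  cases x with
  | s g' i => cases hx2
  | p g' k =>
    obtain ⟨rfl, e1, e2⟩ := nd_St hx2
    have e3 := cur_none k.2.le e2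
    simp only at e1 e3
    have : k = w := by
      rcases lt_trichotomy k w with h1 | h1 | h1
      · exact absurd e1.symm (hwn k h1)
      · exact h1
      · exact absurd e1 (e3 w h1)
    rw [← this]; exact hm
  | e k => cases hx2
  | t g' i =>
    obtain ⟨rfl, e1, e2⟩ := nd_St hx2
    exact absurd e1 (cur_none le_rfl e2 w w.2)

theorem use_p_some {H : ℕ → ℕ}
    (c1 : ∀ w z : Fin N, cur (f g) N w (f g w) = some z → H z < H w)
    (c2 : ∀ g', g' ≠ g → ∀ w z u : Fin N, cur (f g) N w (f g w) = some z →
      cur (f g') N w (f g' w) = some u → H z < H u)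
    (a : ℕ) : ∀ y : Fin N, H y = a → ∀ w : Fin N, cur (f g) N w (f g w) = some y →
      ∃ j, EE.p g w ∈ α j := by
  induction a using Nat.strong_induction_on with
  | _ a ih =>
  rintro y rfl w hw
  have hy : ∃ j, EE.p g y ∈ α j := by
    cases hc : cur (f g) N y (f g y) with
    | none => exact use_p_none hf h hc
    | some z => exact ih _ (c1 y z hc) z rfl y hc
  obtain ⟨j, hj⟩ := hy
  refine ⟨j, ?_⟩
  have hpe := pe hf h hj
  have he : EE.e y ∈ α j := hpe.subset (by simp)
  obtain ⟨x, hx1, hx2⟩ := (h.1 j).next he (by intro hh; cases hh)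
  have hm : x ∈ α j := hx1.subset (by simp)
  obtain ⟨w1, w2, w3⟩ := cur_some w.2.le hw
  cases x with
  | s g' i => cases hx2
  | p g' k =>
    have hk := nd_B hx2
    simp only at hk
    by_cases hg : g' = g
    · subst hg
      obtain ⟨k1, k2, k3⟩ := cur_some k.2.le hk
      have : k = w := by
        rcases lt_trichotomy k w with h1 | h1 | h1
        · exact absurd (k2.symm.trans w2) (w3 k k1 h1)
        · exact h1
        · exact absurd (w2.symm.trans k2) (k3 w w1 h1)
      rw [← this]; exact hm
    · exfalso
      have hu : ∃ j, EE.p g k ∈ α j := by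
        cases hc : cur (f g) N k (f g k) with
        | none => exact use_p_none hf h hc
        | some z => exact ih _ (c2 g' hg k z y hc hk) z rfl k hc
      obtain ⟨j', hj'⟩ := hu
      have q1 := pe hf h hj'
      have q2 := pe hf h hm
      have hjj : j' = j := by
        by_contra hne
        exact h.2 j' j hne (EE.e k) (q1.subset (by simp)) (q2.subset (by simp))
      subst hjj
      have := (h.1 j').uniq rkk (rk_lt hf) q1 q2
      cases this
      exact hg rfl
  | e k => cases hx2
  | t g' i =>
    by_cases hg : g' = g
    · subst hg
      obtain ⟨k1, k2, k3⟩ := cur_some le_rfl (nd_B hx2)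
      exact absurd (w2.symm.trans k2) (k3 w w1 w.2)
    · exact absurd hm (not_t hf h hg)

theorem use_p {H : ℕ → ℕ}
    (c1 : ∀ w z : Fin N, cur (f g) N w (f g w) = some z → H z < H w)
    (c2 : ∀ g', g' ≠ g → ∀ w z u : Fin N, cur (f g) N w (f g w) = some z →
      cur (f g') N w (f g' w) = some u → H z < H u)
    (w : Fin N) : ∃ j, [(EE.p g w : EE c N), EE.e w] <:+: α j := by
  have : ∃ j, EE.p g w ∈ α j := by
    cases hc : cur (f g) N w (f g w) with
    | none => exact use_p_none hf h hc
    | some z => exact use_p_some hf h c1 c2 _ z rfl w hc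
  obtain ⟨j, hj⟩ := this
  exact ⟨j, pe hf h hj⟩

end graph

theorem pr_of_cur {f : ℕ → ℕ} {N : ℕ} {w z : Fin N} (h : cur f N w (f w) = some z) : Pr f z w :=
  cur_some w.2.le h

theorem atLeast_of_good {m n N : ℕ} (h : Good m n N) : MAtLeast ![m, n] N := by
  obtain ⟨r, c, a, b, h0, h1, h2, -, -, h3, h4, h5⟩ := h
  have hf : ∀ g k, k < N → (![r, c] : Fin 2 → ℕ → ℕ) g k < (![m, n] : Fin 2 → ℕ) g := by
    intro g k hk
    fin_cases g
    · exact h1 k hk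
    · exact h2 k hk
  refine ⟨GG hf, VV.S, VV.R, ⟨acyclic_of_rank rkk (rk_lt hf), ?_, minCut hf⟩, ?_, ?_⟩
  · intro x y hxy; cases hxy; rfl
  · intro x y hxy; cases hxy; rfl
  intro α hα
  have key : ∀ w : Fin N, (GG hf).MergingEdge α (EE.e w) := by
    intro w
    obtain ⟨j0, hj0⟩ := use_p hf (hα 0) (H := a)
      (fun w z hz => h3 w w.2 z (pr_of_cur hz))
      (fun g' hg w z u hz hu => by
        have : g' = 1 := by omega
        subst this
        exact (h5 w w.2 z u (pr_of_cur hz) (pr_of_cur hu)).1) w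
    obtain ⟨j1, hj1⟩ := use_p hf (hα 1) (H := b)
      (fun w z hz => h4 w w.2 z (pr_of_cur hz))
      (fun g' hg w z u hz hu => by
        have : g' = 0 := by omega
        subst this
        exact (h5 w w.2 u z (pr_of_cur hu) (pr_of_cur hz)).2) w
    refine ⟨0, 1, by decide, j0, j1, EE.p 0 w, EE.p 1 w, ?_, hj0, hj1⟩
    intro hh; cases hh
  unfold mergingCount
  have hsub : Set.range (fun w : Fin N => (EE.e w : (GG hf).E)) ⊆
      {e : (GG hf).E | (GG hf).MergingEdge α e} := by
    rintro _ ⟨w, rfl⟩; exact key w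
  haveI : Finite (GG hf).E := EEfin _ _
  have h6 := Set.ncard_le_ncard hsub (Set.toFinite _)
  have h7 : (Set.range (fun w : Fin N => (EE.e w : (GG hf).E))).ncard = N := by
    rw [← Set.image_univ, Set.ncard_image_of_injective, Set.ncard_univ, Nat.card_eq_fintype_card,
      Fintype.card_fin]
    intro x y hxy; cases hxy; rfl
  omega

/-- For all positive integers `m` and `n`, `M(m, n) ≥ 2mn − m − n + 1`:
there is an acyclic graph with two distinct sources, two distinct sinks and min-cuts `m`
and `n`, in which every choice of Menger path systems yields at least `2mn − m − n + 1`
mergings. -/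
theorem M_lower (m n : ℕ) (hm : 0 < m) (hn : 0 < n) :
    MAtLeast ![m, n] (2 * m * n - m - n + 1) := by
  obtain ⟨N, h1, h2⟩ := good_all (m + n) m n le_rfl hm hn
  have h3 : 2 * m * n - m - n + 1 = N := by
    have := h2
    obtain ⟨_, _, _, _, h0, _⟩ := this
    omega
  rw [h3]
  exact atLeast_of_good h2
end

section
/- For all positive integers m and n, M(m,n) ≤ (m + n - 1) + (mn - 2)·⌊(m + n - 2)/2⌋. That is, in every acyclic directed graph with two distinct sources S_1, S_2 and two distinct sinks R_1, R_2, with min-cut m from S_1 to R_1 and min-cut n from S_2 to R_2, one can choose the two Menger path systems so that the number of mergings between them is at most (m + n - 1) + (mn - 2)⌊(m + n - 2)/2⌋. -/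
open MultiDigraph

namespace MUp

variable {E : Type}

theorem infix_mem {l : List E} {f e : E} (h : [f, e] <:+: l) : f ∈ l ∧ e ∈ l := by
  obtain ⟨s, t, rfl⟩ := h
  simp

theorem chain_infix {r : E → E → Prop} {l : List E} (hl : l.IsChain r) {f e : E}
    (h : [f, e] <:+: l) : r f e := by
  obtain ⟨s, t, rfl⟩ := h
  exact List.isChain_iff_forall_rel_of_append_cons_cons.1 hl (l₁ := s) (l₂ := t) (by simp)

theorem head_or_pred {l : List E} {e : E} (h : e ∈ l) :
    l.head? = some e ∨ ∃ f, [f, e] <:+: l := by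
  obtain ⟨s, t, rfl⟩ := List.append_of_mem h
  rcases List.eq_nil_or_concat s with rfl | ⟨s', f, rfl⟩
  · left; simp
  · right; exact ⟨f, s', t, by simp⟩

theorem last_or_succ {l : List E} {e : E} (h : e ∈ l) :
    l.getLast? = some e ∨ ∃ f, [e, f] <:+: l := by
  obtain ⟨s, t, rfl⟩ := List.append_of_mem h
  rcases t with _ | ⟨f, t⟩
  · left; simp
  · right; exact ⟨f, s, t, by simp⟩

/-- edge-disjoint path systems, abstractly -/
structure Sys (r : E → E → Prop) (st en : E → Prop) {c : ℕ} (α : Fin c → List E) : Prop where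
  ne : ∀ i, α i ≠ []
  chain : ∀ i, (α i).IsChain r
  head : ∀ i, ∀ e ∈ (α i).head?, st e
  last : ∀ i, ∀ e ∈ (α i).getLast?, en e
  disj : ∀ i j, i ≠ j → ∀ e, e ∈ α i → e ∉ α j

def Arc {c : ℕ} (α : Fin c → List E) (f e : E) : Prop := ∃ i, [f, e] <:+: α i

def Inn {c : ℕ} (α : Fin c → List E) (e : E) : Prop := ∃ i, e ∈ α i

namespace Sys

variable {r : E → E → Prop} {st en : E → Prop} {c : ℕ} {α : Fin c → List E} {ht : E → ℕ}

theorem lab (h : Sys r st en α) {i j : Fin c} {e : E} (hi : e ∈ α i) (hj : e ∈ α j) : i = j := by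
  by_contra hne
  exact h.disj i j hne e hi hj

theorem sorted (h : Sys r st en α) (hht : ∀ e f, r e f → ht e < ht f) (i : Fin c) :
    (α i).Pairwise (fun e f => ht e < ht f) := by
  have : Trans (fun e f : E => ht e < ht f) (fun e f => ht e < ht f) (fun e f => ht e < ht f) :=
    ⟨fun h1 h2 => lt_trans h1 h2⟩
  exact List.IsChain.pairwise ((h.chain i).imp (fun a b hab => hht a b hab))

theorem arc_r (h : Sys r st en α) {f e : E} (ha : Arc α f e) : r f e := by
  obtain ⟨i, hi⟩ := ha
  exact chain_infix (h.chain i) hi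

theorem arc_lab_r (h : Sys r st en α) {f e : E} (ha : Arc α f e) {i : Fin c} (hi : e ∈ α i) :
    [f, e] <:+: α i := by
  obtain ⟨j, hj⟩ := ha
  rwa [h.lab hi (infix_mem hj).2]

theorem arc_lab_l (h : Sys r st en α) {f e : E} (ha : Arc α f e) {i : Fin c} (hi : f ∈ α i) :
    [f, e] <:+: α i := by
  obtain ⟨j, hj⟩ := ha
  rwa [h.lab hi (infix_mem hj).1]

theorem before (h : Sys r st en α) (hht : ∀ e f, r e f → ht e < ht f) {i : Fin c} {f e x : E}
    (ha : Arc α f e) (he : e ∈ α i) (hx : x ∈ α i) (hlt : ht x < ht e) : ht x ≤ ht f := by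
  have h1 := h.arc_lab_r ha he
  have hs := h.sorted hht i
  obtain ⟨s, t, hst⟩ := h1
  rw [← hst] at hs hx
  simp only [List.append_assoc, List.cons_append, List.nil_append, List.pairwise_append,
    List.pairwise_cons, List.mem_append, List.mem_cons] at hs hx
  grind

theorem after (h : Sys r st en α) (hht : ∀ e f, r e f → ht e < ht f) {i : Fin c} {f e x : E}
    (ha : Arc α f e) (hf : f ∈ α i) (hx : x ∈ α i) (hlt : ht f < ht x) : ht e ≤ ht x := by
  have h1 := h.arc_lab_l ha hf
  have hs := h.sorted hht i
  obtain ⟨s, t, hst⟩ := h1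
  rw [← hst] at hs hx
  simp only [List.append_assoc, List.cons_append, List.nil_append, List.pairwise_append,
    List.pairwise_cons, List.mem_append, List.mem_cons] at hs hx
  grind

theorem ht_inj (h : Sys r st en α) (hht : ∀ e f, r e f → ht e < ht f) {i : Fin c} {f e : E}
    (hf : f ∈ α i) (he : e ∈ α i) (heq : ht f = ht e) : f = e := by
  by_contra hne
  have hs := h.sorted hht i
  obtain ⟨s, t, hst⟩ := List.append_of_mem hf
  rw [hst] at hs he
  simp only [List.pairwise_append,
    List.pairwise_cons, List.mem_append, List.mem_cons] at hs he
  grind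

theorem arc_inj_r (h : Sys r st en α) (hht : ∀ e f, r e f → ht e < ht f) {f f' e : E}
    (ha : Arc α f e) (hb : Arc α f' e) : f = f' := by
  have ⟨i, hi⟩ := ha
  have he := (infix_mem hi).2
  have hf := (infix_mem hi).1
  have hf' := (infix_mem (h.arc_lab_r hb he)).1
  refine h.ht_inj hht hf hf' (le_antisymm ?_ ?_)
  · exact h.before hht hb he hf (hht _ _ (h.arc_r ha))
  · exact h.before hht ha he hf' (hht _ _ (h.arc_r hb))

theorem arc_inj_l (h : Sys r st en α) (hht : ∀ e f, r e f → ht e < ht f) {f e e' : E}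
    (ha : Arc α f e) (hb : Arc α f e') : e = e' := by
  have ⟨i, hi⟩ := ha
  have he := (infix_mem hi).2
  have hf := (infix_mem hi).1
  have he' := (infix_mem (h.arc_lab_l hb hf)).2
  refine h.ht_inj hht he he' (le_antisymm ?_ ?_)
  · exact h.after hht ha hf he' (hht _ _ (h.arc_r hb))
  · exact h.after hht hb hf he (hht _ _ (h.arc_r ha))

theorem arc_in_l {f e : E} (ha : Arc α f e) : Inn α f := by
  obtain ⟨i, hi⟩ := ha
  exact ⟨i, (infix_mem hi).1⟩

theorem arc_in_r {f e : E} (ha : Arc α f e) : Inn α e := by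
  obtain ⟨i, hi⟩ := ha
  exact ⟨i, (infix_mem hi).2⟩

theorem no_pred (h : Sys r st en α) (hht : ∀ e f, r e f → ht e < ht f) {i : Fin c} {s f : E}
    (hs : (α i).head? = some s) : ¬ Arc α f s := by
  intro ha
  have hm : s ∈ α i := List.mem_of_mem_head? hs
  have h1 := h.arc_lab_r ha hm
  have hso := h.sorted hht i
  have hlt := hht _ _ (h.arc_r ha)
  have hf := (infix_mem h1).1
  rcases hl : α i with _ | ⟨a, l⟩
  · rw [hl] at hf; simp at hf
  · rw [hl] at hs hf hso
    simp at hs hf hso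
    grind

end Sys

theorem exists_walk {ht : E → ℕ} {B : ℕ} (hB : ∀ e, ht e ≤ B) {P : E → Prop} {R : E → E → Prop}
    (hR : ∀ f e, R f e → ht f < ht e) (hcl : ∀ f e, R f e → P f → P e) :
    ∀ k e, P e → B ≤ ht e + k → ∃ l : List E, l.head? = some e ∧ l.IsChain R ∧ (∀ x ∈ l, P x) ∧
      ∀ x ∈ l.getLast?, ∀ h, ¬ R x h := by
  intro k
  induction k with
  | zero =>
    intro e he hk
    refine ⟨[e], by simp, by simp, by simpa using he, ?_⟩
    intro x hx h hr
    simp at hx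
    subst hx
    have := hR _ _ hr
    have := hB h
    omega
  | succ k ih =>
    intro e he hk
    by_cases hs : ∃ h, R e h
    · obtain ⟨h, hr⟩ := hs
      have := hR _ _ hr
      obtain ⟨l, h1, h2, h3, h4⟩ := ih h (hcl _ _ hr he) (by omega)
      rcases l with _ | ⟨a, l⟩
      · simp at h1
      · simp at h1
        subst h1
        refine ⟨e :: a :: l, by simp, ?_, ?_, ?_⟩
        · exact List.isChain_cons_cons.2 ⟨hr, h2⟩
        · intro x hx
          rcases List.mem_cons.1 hx with rfl | hx
          · exact he
          · exact h3 x hx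
        · simpa using h4
    · refine ⟨[e], by simp, by simp, by simpa using he, ?_⟩
      intro x hx h hr
      simp at hx
      subst hx
      exact hs ⟨h, hr⟩

theorem sys_of_rel [Finite E] {r : E → E → Prop} {st en : E → Prop} {ht : E → ℕ}
    (hht : ∀ e f, r e f → ht e < ht f) {c : ℕ} (P : E → Prop) (R : E → E → Prop) (s : Fin c → E)
    (hs : Function.Injective s) (hsP : ∀ i, P (s i)) (hst : ∀ i, st (s i))
    (hRr : ∀ f e, R f e → r f e) (hcl : ∀ f e, R f e → P f → P e)
    (hRs : ∀ f i, P f → ¬ R f (s i))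
    (hinj : ∀ f f' e, P f → P f' → R f e → R f' e → f = f')
    (hen : ∀ e, P e → (∀ h, ¬ R e h) → en e) :
    ∃ α : Fin c → List E, Sys r st en α ∧ ∀ f e, Arc α f e → P f ∧ R f e := by
  obtain ⟨B, hB⟩ : ∃ B, ∀ e, ht e ≤ B := by
    obtain ⟨B, hB⟩ := (Set.finite_range ht).bddAbove
    exact ⟨B, fun e => hB ⟨e, rfl⟩⟩
  have hw := fun i => exists_walk hB (fun f e h => hht _ _ (hRr f e h)) hcl B (s i) (hsP i) (by omega)
  choose α h1 h2 h3 h4 using hw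
  have key : ∀ k i j x, ht x ≤ k → x ∈ α i → x ∈ α j → i = j := by
    intro k
    induction k using Nat.strong_induction_on with
    | _ k ih =>
      intro i j x hk hi hj
      rcases head_or_pred hi with hi' | ⟨f, hf⟩
      · rw [h1 i] at hi'
        rcases head_or_pred hj with hj' | ⟨g, hg⟩
        · rw [h1 j, ← hi'] at hj'
          exact (hs (by simpa using hj')).symm
        · have := chain_infix (h2 j) hg
          have hx : s i = x := by simpa using hi'
          rw [← hx] at this
          exact (hRs _ _ (h3 j g (infix_mem hg).1) this).elim
      · have hfR := chain_infix (h2 i) hf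
        have hfP := h3 i f (infix_mem hf).1
        rcases head_or_pred hj with hj' | ⟨g, hg⟩
        · rw [h1 j] at hj'
          have hx : s j = x := by simpa using hj'
          rw [← hx] at hfR
          exact (hRs _ _ hfP hfR).elim
        · have hgR := chain_infix (h2 j) hg
          have hgP := h3 j g (infix_mem hg).1
          have := hinj _ _ _ hfP hgP hfR hgR
          subst this
          have hlt := hht _ _ (hRr _ _ hfR)
          exact ih (ht f) (by omega) i j f le_rfl (infix_mem hf).1 (infix_mem hg).1
  refine ⟨α, ⟨?_, ?_, ?_, ?_, ?_⟩, ?_⟩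
  · intro i h
    have := h1 i
    rw [h] at this
    simp at this
  · intro i
    exact (h2 i).imp (fun a b => hRr a b)
  · intro i e he
    rw [h1 i] at he
    have : s i = e := by simpa using he
    rw [← this]
    exact hst i
  · intro i e he
    exact hen e (h3 i e (List.mem_of_mem_getLast? he)) (h4 i e he)
  · intro i j hij e hi hj
    exact hij (key _ i j e le_rfl hi hj)
  · rintro f e ⟨i, hi⟩
    exact ⟨h3 i f (infix_mem hi).1, chain_infix (h2 i) hi⟩

inductive Step {m n : ℕ} (α : Fin m → List E) (β : Fin n → List E) : E × Bool → E × Bool → Prop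
  | bthru (e : E) : Inn β e → ¬ Inn α e → Step α β (e, false) (e, true)
  | aback (f e : E) : Arc α f e → ¬ Arc β f e → Step α β (e, false) (f, true)
  | athru (e : E) : Inn α e → ¬ Inn β e → Step α β (e, true) (e, false)
  | bfwd (e h : E) : Arc β e h → ¬ Arc α e h → Step α β (e, true) (h, false)

theorem Step.swap {m n : ℕ} {α : Fin m → List E} {β : Fin n → List E} {p q : E × Bool}
    (h : Step α β p q) : Step β α q p := by
  cases h with
  | bthru e h1 h2 => exact Step.athru e h1 h2
  | aback f e h1 h2 => exact Step.bfwd f e h1 h2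
  | athru e h1 h2 => exact Step.bthru e h1 h2
  | bfwd e h h1 h2 => exact Step.aback e h h1 h2

def rk (ht : E → ℕ) (p : E × Bool) : ℕ := 2 * ht p.1 + p.2.toNat

def Viol {m n : ℕ} (α : Fin m → List E) (β : Fin n → List E) (ht : E → ℕ) (k : ℕ) : Prop :=
  ∃ (c : ℕ → E × Bool) (i : Fin m), (∀ t < k, Step α β (c t) (c (t + 1))) ∧ (c 0).1 ∈ α i ∧
    (c k).1 ∈ α i ∧ rk ht (c 0) < rk ht (c k)

/-- Any rerouting of `α` inside `α ∪ β` uses all arcs which are only in `α`. -/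
def Rigid (r : E → E → Prop) (st en : E → Prop) {m n : ℕ} (α : Fin m → List E)
    (β : Fin n → List E) : Prop :=
  ∀ α' : Fin m → List E, Sys r st en α' → (∀ f e, Arc α' f e → Arc α f e ∨ Arc β f e) →
    ∀ f e, Arc α f e → ¬ Arc β f e → Arc α' f e

section
variable {r : E → E → Prop} {st en st' en' : E → Prop} {m n : ℕ} {α : Fin m → List E}
  {β : Fin n → List E} {ht : E → ℕ}

theorem no_viol [Finite E] (hht : ∀ e f, r e f → ht e < ht f) (hα : Sys r st en α)
    (hβ : Sys r st' en' β) (hrig : Rigid r st en α β) (k : ℕ) : ¬ Viol α β ht k := by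
  classical
  intro hk0
  obtain ⟨k, hk, hmin⟩ : ∃ k, Viol α β ht k ∧ ∀ k' < k, ¬ Viol α β ht k' :=
    ⟨Nat.find ⟨k, hk0⟩, Nat.find_spec ⟨k, hk0⟩, fun k' h => Nat.find_min ⟨k, hk0⟩ h⟩
  clear hk0
  obtain ⟨c, i, hstep, h0, hk, hlt⟩ := hk
  have hkpos : 0 < k := by
    rcases Nat.eq_zero_or_pos k with rfl | h
    · omega
    · exact h
  have hmid : ∀ t, 0 < t → t < k → (c t).1 ∉ α i := by
    intro t ht0 htk hmem
    have h1 : ¬ rk ht (c 0) < rk ht (c t) := fun h =>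
      hmin t htk ⟨c, i, fun s hs => hstep s (by omega), h0, hmem, h⟩
    have h2 : ¬ rk ht (c t) < rk ht (c k) := fun h =>
      hmin (k - t) (by omega) ⟨fun s => c (t + s), i, fun s hs => hstep (t + s) (by omega), hmem, by
        have : t + (k - t) = k := by omega
        simpa [this] using hk, by
        have : t + (k - t) = k := by omega
        simpa [this] using h⟩
    omega
  -- first step
  obtain ⟨ep, hc0, hepB⟩ : ∃ ep, c 0 = (ep, true) ∧ Inn β ep := by
    have hs := hstep 0 hkpos
    have hm1 : 1 = k ∨ (c 1).1 ∉ α i := by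
      by_cases h : 1 = k
      · exact Or.inl h
      · exact Or.inr (hmid 1 (by omega) (by omega))
    generalize hp : c 0 = p at *
    generalize hq : c (0 + 1) = q at *
    cases hs with
    | bthru e h1 h2 => exact (h2 ⟨i, h0⟩).elim
    | aback f e h1 h2 =>
      rcases hm1 with h | h
      · have hl := hht _ _ (hα.arc_r h1)
        rw [← h] at hlt
        simp only [zero_add] at hq
        simp [hq, rk] at hlt
        omega
      · exact (h (infix_mem (hα.arc_lab_r h1 h0)).1).elim
    | athru e h1 h2 =>
      simp only [zero_add] at hq
      rcases hm1 with h | h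
      · rw [← h] at hlt
        simp [hq, rk] at hlt
      · exact (h h0).elim
    | bfwd e h h1 h2 => exact ⟨e, rfl, Sys.arc_in_l h1⟩
  -- last step
  obtain ⟨g, hq, hck', hck, hgq, hgq'⟩ : ∃ g hq, c (k - 1) = (g, true) ∧ c k = (hq, false) ∧
      Arc β g hq ∧ ¬ Arc α g hq := by
    have hs := hstep (k - 1) (by omega)
    have hm1 : k - 1 = 0 ∨ (c (k - 1)).1 ∉ α i := by
      by_cases h : k - 1 = 0
      · exact Or.inl h
      · exact Or.inr (hmid _ (by omega) (by omega))
    have hkk : k - 1 + 1 = k := by omega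
    rw [hkk] at hs
    generalize hp : c (k - 1) = p at *
    generalize hqq : c k = q at *
    cases hs with
    | bthru e h1 h2 => exact (h2 ⟨i, hk⟩).elim
    | aback f e h1 h2 =>
      rcases hm1 with h | h
      · have hl := hht _ _ (hα.arc_r h1)
        rw [h] at hp
        simp [hp, rk] at hlt
        omega
      · exact (h (infix_mem (hα.arc_lab_l h1 hk)).2).elim
    | athru e h1 h2 =>
      rcases hm1 with h | h
      · rw [h] at hp
        simp [hp, rk] at hlt
      · exact (h hk).elim
    | bfwd e h h1 h2 => exact ⟨e, h, rfl, rfl, h1, h2⟩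
  rw [hc0] at h0 hlt
  rw [hck] at hk hlt
  have hlt' : ht ep < ht hq := by simp [rk] at hlt; omega
  -- chain facts
  have hout : ∀ t < k, ∀ e, c t = (e, true) → Inn β e → ∃ h, Arc β e h ∧ ¬ Arc α e h ∧
      c (t + 1) = (h, false) := by
    intro t htk e hct heB
    have hs := hstep t htk
    rw [hct] at hs
    generalize c (t + 1) = q at *
    cases hs with
    | athru e h1 h2 => exact (h2 heB).elim
    | bfwd e h h1 h2 => exact ⟨h, h1, h2, rfl⟩
  have hout' : ∀ t < k, ∀ e, c t = (e, true) → ¬ Inn β e → c (t + 1) = (e, false) ∧ Inn α e := by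
    intro t htk e hct heB
    have hs := hstep t htk
    rw [hct] at hs
    generalize c (t + 1) = q at *
    cases hs with
    | athru e h1 h2 => exact ⟨rfl, h1⟩
    | bfwd e h h1 h2 => exact (heB (Sys.arc_in_l h1)).elim
  have hin : ∀ t < k, ∀ e, c t = (e, false) → Inn α e → ∃ f, Arc α f e ∧ c (t + 1) = (f, true) := by
    intro t htk e hct heB
    have hs := hstep t htk
    rw [hct] at hs
    generalize c (t + 1) = q at *
    cases hs with
    | bthru e h1 h2 => exact (h2 heB).elim
    | aback f e h1 h2 => exact ⟨f, h1, rfl⟩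
  have hin' : ∀ t < k, ∀ e, c t = (e, false) → ¬ Inn α e → c (t + 1) = (e, true) ∧ Inn β e := by
    intro t htk e hct heB
    have hs := hstep t htk
    rw [hct] at hs
    generalize c (t + 1) = q at *
    cases hs with
    | bthru e h1 h2 => exact ⟨rfl, h1⟩
    | aback f e h1 h2 => exact (heB (Sys.arc_in_r h1)).elim
  have hnotk : ∀ t e, t ≤ k → c t = (e, true) → t < k := by
    intro t e h1 h2
    rcases Nat.lt_or_eq_of_le h1 with h | rfl
    · exact h
    · rw [hck] at h2; simp at h2
  have hisq : ∀ t e, t ≤ k → c t = (e, false) → e ≠ hq → t < k := by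
    intro t e h1 h2 h3
    rcases Nat.lt_or_eq_of_le h1 with h | rfl
    · exact h
    · rw [hck] at h2; simp at h2; exact (h3 h2.symm).elim
  let T : E → Prop := fun e => Inn β e ∧ ∃ t < k, c t = (e, true)
  let X : E → Prop := fun e => (¬ Inn β e ∧ ∃ t < k, c t = (e, true)) ∨
    (e ∈ α i ∧ ht ep < ht e ∧ ht e < ht hq)
  let P : E → Prop := fun e => (Inn α e ∧ ¬ X e) ∨ T e
  let R : E → E → Prop := fun f e => (T f ∧ Arc β f e) ∨ (¬ T f ∧ Arc α f e)
  have hTep : T ep := ⟨hepB, 0, hkpos, hc0⟩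
  have hTg : T g := ⟨Sys.arc_in_l hgq, k - 1, by omega, hck'⟩
  have hqpred : ∀ f, Arc α f hq → T f ∨ X f := by
    intro f hf
    have hfi := (infix_mem (hα.arc_lab_r hf hk)).1
    rcases Nat.lt_or_eq_of_le (hα.before hht hf hk h0 hlt') with h | h
    · exact Or.inr (Or.inr ⟨hfi, h, hht _ _ (hα.arc_r hf)⟩)
    · rw [← hα.ht_inj hht h0 hfi h]; exact Or.inl hTep
  have hTX : ∀ t < k, ∀ e, c t = (e, true) → T e ∨ X e := by
    intro t htk e hct
    by_cases h : Inn β e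
    · exact Or.inl ⟨h, t, htk, hct⟩
    · exact Or.inr (Or.inl ⟨h, t, htk, hct⟩)
  have hinpred : ∀ t ≤ k, ∀ e, c t = (e, false) → Inn α e → ∃ f, Arc α f e ∧ (T f ∨ X f) := by
    intro t htk e hct he
    by_cases h : t = k
    · subst h
      rw [hck] at hct
      obtain rfl : hq = e := by simpa using hct
      rcases head_or_pred hk with h | ⟨f, hf⟩
      · exfalso
        rcases hl : α i with _ | ⟨a, l⟩
        · rw [hl] at h; simp at h
        · have hso := hα.sorted hht i
          rw [hl] at h hso h0
          simp at h hso h0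
          grind
      · exact ⟨f, ⟨i, hf⟩, hqpred f ⟨i, hf⟩⟩
    · obtain ⟨f, hf, hc⟩ := hin t (by omega) e hct he
      have := hnotk (t + 1) f (by omega) hc
      exact ⟨f, hf, hTX (t + 1) this f hc⟩
  have hstart : ∀ i' : Fin m, ∃ s, (α i').head? = some s := by
    intro i'
    rcases h : α i' with _ | ⟨a, l⟩
    · exact (hα.ne i' h).elim
    · exact ⟨a, by simp⟩
  choose s hs using hstart
  have hsm : ∀ i', s i' ∈ α i' := fun i' => List.mem_of_mem_head? (hs i')
  have hcl : ∀ f e, R f e → P f → P e := by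
    rintro f e (⟨⟨hfB, t, htk, hct⟩, hfe⟩ | ⟨hfT, hfe⟩) hP
    · obtain ⟨h, h1, h2, h3⟩ := hout t htk f hct hfB
      obtain rfl := hβ.arc_inj_l hht hfe h1
      by_cases heA : Inn α e
      · left
        refine ⟨heA, ?_⟩
        rintro (⟨h4, _⟩ | ⟨h4, h5, h6⟩)
        · exact h4 (Sys.arc_in_r h1)
        · have : t + 1 < k := hisq (t + 1) e (by omega) h3 (by rintro rfl; omega)
          exact hmid (t + 1) (by omega) this (by rw [h3]; exact h4)
      · right
        have hlt2 : t + 1 < k := hisq (t + 1) e (by omega) h3 (by rintro rfl; exact heA ⟨i, hk⟩)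
        obtain ⟨h5, h6⟩ := hin' (t + 1) hlt2 e h3 heA
        exact ⟨h6, t + 1 + 1, hnotk _ _ (by omega) h5, h5⟩
    · have hfX : ¬ X f := by
        rcases hP with h | h
        · exact h.2
        · exact (hfT h).elim
      left
      refine ⟨Sys.arc_in_r hfe, ?_⟩
      rintro (⟨h4, t, htk, hct⟩ | ⟨h4, h5, h6⟩)
      · obtain ⟨h5, h6⟩ := hout' t htk e hct h4
        have hlt2 : t + 1 < k := hisq (t + 1) e (by omega) h5 (by
          rintro rfl; exact h4 (Sys.arc_in_r hgq))
        obtain ⟨f', h7, h8⟩ := hinpred (t + 1) (by omega) e h5 h6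
        obtain rfl := hα.arc_inj_r hht hfe h7
        exact h8.elim hfT hfX
      · have hfi := (infix_mem (hα.arc_lab_r hfe h4)).1
        rcases Nat.lt_or_eq_of_le (hα.before hht hfe h4 h0 h5) with h | h
        · exact hfX (Or.inr ⟨hfi, h, by have := hht _ _ (hα.arc_r hfe); omega⟩)
        · rw [← hα.ht_inj hht h0 hfi h] at hfT; exact hfT hTep
  have hPX : ∀ f, P f → ¬ T f → ¬ X f := by
    rintro f (h | h) h'
    · exact h.2
    · exact (h' h).elim
  have hTarc : ∀ f e, T f → Arc β f e → ∃ t ≤ k, c t = (e, false) := by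
    rintro f e ⟨hfB, t, htk, hct⟩ hfe
    obtain ⟨h, h1, h2, h3⟩ := hout t htk f hct hfB
    obtain rfl := hβ.arc_inj_l hht hfe h1
    exact ⟨t + 1, by omega, h3⟩
  have hcross : ∀ f f' e, P f' → T f → Arc β f e → ¬ T f' → Arc α f' e → False := by
    intro f f' e hP' hT hfe hT' hfe'
    obtain ⟨t, htk, hct⟩ := hTarc f e hT hfe
    obtain ⟨f'', h1, h2⟩ := hinpred t htk e hct (Sys.arc_in_r hfe')
    obtain rfl := hα.arc_inj_r hht hfe' h1
    exact h2.elim hT' (hPX _ hP' hT')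
  have hinj : ∀ f f' e, P f → P f' → R f e → R f' e → f = f' := by
    rintro f f' e hP hP' (⟨h1, h2⟩ | ⟨h1, h2⟩) (⟨h3, h4⟩ | ⟨h3, h4⟩)
    · exact hβ.arc_inj_r hht h2 h4
    · exact (hcross f f' e hP' h1 h2 h3 h4).elim
    · exact (hcross f' f e hP h3 h4 h1 h2).elim
    · exact hα.arc_inj_r hht h2 h4
  obtain ⟨α', hα', harc⟩ := sys_of_rel (r := r) (st := st) (en := en) hht P R s
    (by
      intro a b hab
      exact hα.lab (hsm a) (hab ▸ hsm b))
    (by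
      intro i'
      left
      refine ⟨⟨i', hsm i'⟩, ?_⟩
      rintro (⟨h4, t, htk, hct⟩ | ⟨h4, h5, h6⟩)
      · obtain ⟨h5, h6⟩ := hout' t htk _ hct h4
        obtain ⟨f', h7, h8⟩ := hinpred (t + 1) (by omega) _ h5 h6
        exact hα.no_pred hht (hs i') h7
      · obtain rfl := hα.lab h4 (hsm i')
        rcases hl : α i with _ | ⟨a, l⟩
        · rw [hl] at h0; simp at h0
        · have hso := hα.sorted hht i
          have hh := hs i
          rw [hl] at hh hso h0
          simp at hh hso h0
          grind)
    (fun i' => hα.head i' _ (hs i'))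
    (by
      rintro f e (⟨_, h⟩ | ⟨_, h⟩)
      · exact hβ.arc_r h
      · exact hα.arc_r h)
    hcl
    (by
      rintro f i' hP (⟨h1, h2⟩ | ⟨h1, h2⟩)
      · obtain ⟨t, htk, hct⟩ := hTarc f _ h1 h2
        obtain ⟨f', h7, h8⟩ := hinpred t htk _ hct ⟨i', hsm i'⟩
        exact hα.no_pred hht (hs i') h7
      · exact hα.no_pred hht (hs i') h2)
    hinj
    (by
      intro e hP hno
      have hT : ¬ T e := by
        intro hT
        obtain ⟨hfB, t, htk, hct⟩ := hT
        obtain ⟨h, h1, h2, h3⟩ := hout t htk e hct hfB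
        exact hno h (Or.inl ⟨⟨hfB, t, htk, hct⟩, h1⟩)
      rcases hP with hP | hP
      · obtain ⟨⟨j, hj⟩, _⟩ := hP
        rcases last_or_succ hj with h | ⟨h, hh⟩
        · exact hα.last j _ h
        · exact (hno h (Or.inr ⟨hT, j, hh⟩)).elim
      · exact (hT hP).elim)
  obtain ⟨f, hf, -⟩ := hinpred k le_rfl hq hck ⟨i, hk⟩
  have hfb : ¬ Arc β f hq := by
    intro h
    obtain rfl := hβ.arc_inj_r hht h hgq
    exact hgq' hf
  obtain ⟨hPf, hRf⟩ := harc f hq (hrig α' hα' (by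
    intro f e h
    rcases (harc f e h).2 with ⟨_, h⟩ | ⟨_, h⟩
    · exact Or.inr h
    · exact Or.inl h) f hq hf hfb)
  obtain rfl := hinj f g hq hPf (Or.inr hTg) hRf (Or.inl ⟨hTg, hgq⟩)
  exact hgq' hf

theorem reach_fun {m n : ℕ} {α : Fin m → List E} {β : Fin n → List E} {p q : E × Bool}
    (h : Relation.ReflTransGen (Step α β) p q) : ∃ (k : ℕ) (c : ℕ → E × Bool),
      (∀ t < k, Step α β (c t) (c (t + 1))) ∧ c 0 = p ∧ c k = q := by
  induction h with
  | refl => exact ⟨0, fun _ => p, by simp, rfl, rfl⟩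
  | tail _ h ih =>
    rename_i b d _
    obtain ⟨k, c, h1, h2, h3⟩ := ih
    refine ⟨k + 1, fun t => if t ≤ k then c t else d, ?_, by simp [h2], by simp⟩
    intro t ht
    by_cases htk : t = k
    · subst htk
      simpa [h3] using h
    · have e1 : t ≤ k := by omega
      have e2 : t + 1 ≤ k := by omega
      simp only [e1, e2, if_true]
      exact h1 t (by omega)

theorem le_of_reach [Finite E] (hht : ∀ e f, r e f → ht e < ht f) (hα : Sys r st en α)
    (hβ : Sys r st' en' β) (hrig : Rigid r st en α β) {i : Fin m} {p q : E × Bool}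
    (h : Relation.ReflTransGen (Step α β) p q) (hp : p.1 ∈ α i) (hq : q.1 ∈ α i) :
    rk ht q ≤ rk ht p := by
  by_contra hlt
  obtain ⟨k, c, h1, h2, h3⟩ := reach_fun h
  exact no_viol hht hα hβ hrig k ⟨c, i, h1, by rwa [h2], by rwa [h3], by rw [h2, h3]; omega⟩

end
section
variable {r : E → E → Prop} {st en st' en' : E → Prop} {m n : ℕ} {α : Fin m → List E}
  {β : Fin n → List E} {ht : E → ℕ}

theorem reach_swap {p q : E × Bool} (h : Relation.ReflTransGen (Step α β) p q) :
    Relation.ReflTransGen (Step β α) q p := by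
  induction h with
  | refl => exact .refl
  | tail _ h ih => exact .head h.swap ih

theorem step_unique (hht : ∀ e f, r e f → ht e < ht f) (hα : Sys r st en α)
    (hβ : Sys r st' en' β) : Relator.RightUnique (Step α β) := by
  intro a b c h1 h2
  cases h1 with
  | bthru e h3 h4 =>
    cases h2 with
    | bthru => rfl
    | aback f e h5 h6 => exact (h4 (Sys.arc_in_r h5)).elim
  | aback f e h3 h4 =>
    cases h2 with
    | bthru _ h5 h6 => exact (h6 (Sys.arc_in_r h3)).elim
    | aback f' e h5 h6 => rw [hα.arc_inj_r hht h3 h5]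
  | athru e h3 h4 =>
    cases h2 with
    | athru => rfl
    | bfwd e h h5 h6 => exact (h4 (Sys.arc_in_l h5)).elim
  | bfwd e h h3 h4 =>
    cases h2 with
    | athru _ h5 h6 => exact (h6 (Sys.arc_in_l h3)).elim
    | bfwd e h h5 h6 => rw [hβ.arc_inj_l hht h3 h5]

theorem eq_of_reach [Finite E] (hht : ∀ e f, r e f → ht e < ht f) (hα : Sys r st en α)
    (hβ : Sys r st' en' β) (hrig : Rigid r st en α β) (hrig' : Rigid r st' en' β α)
    {i : Fin m} {j : Fin n} {p q : E × Bool}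
    (h : Relation.ReflTransGen (Step α β) p q) (hp : p.1 ∈ α i) (hq : q.1 ∈ α i)
    (hp' : p.1 ∈ β j) (hq' : q.1 ∈ β j) : p = q := by
  have h1 := le_of_reach hht hα hβ hrig h hp hq
  have h2 := le_of_reach hht hβ hα hrig' (reach_swap h) hq' hp'
  obtain ⟨e, b⟩ := p
  obtain ⟨e', b'⟩ := q
  simp only [rk] at h1 h2
  have hb := Bool.toNat_le b
  have hb' := Bool.toNat_le b'
  have h3 : ht e = ht e' := by omega
  have h4 : b.toNat = b'.toNat := by omega
  have h5 : e = e' := hα.ht_inj hht hp hq h3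
  have h6 : b = b' := by
    revert h4
    cases b <;> cases b' <;> simp
  rw [h5, h6]

theorem no_cycle [Finite E] (hht : ∀ e f, r e f → ht e < ht f) (hα : Sys r st en α)
    (hβ : Sys r st' en' β) (hrig : Rigid r st en α β) (hrig' : Rigid r st' en' β α)
    {p q : E × Bool} (h : Step α β p q) (h' : Relation.ReflTransGen (Step α β) q p) : False := by
  cases h with
  | bthru e h1 h2 =>
    obtain ⟨j, hj⟩ := h1
    have := le_of_reach hht hβ hα hrig' (reach_swap h') hj hj
    simp [rk] at this
  | aback f e h1 h2 =>
    have hl := hht _ _ (hα.arc_r h1)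
    obtain ⟨i, hi⟩ := h1
    have := le_of_reach hht hα hβ hrig h' (infix_mem hi).1 (infix_mem hi).2
    simp [rk] at this
    omega
  | athru e h1 h2 =>
    obtain ⟨j, hj⟩ := h1
    have := le_of_reach hht hα hβ hrig h' hj hj
    simp [rk] at this
  | bfwd e h h1 h2 =>
    have hl := hht _ _ (hβ.arc_r h1)
    obtain ⟨i, hi⟩ := h1
    have := le_of_reach hht hβ hα hrig' (reach_swap h') (infix_mem hi).1 (infix_mem hi).2
    simp [rk] at this
    omega

def Live (α : Fin m → List E) (β : Fin n → List E) (p : E × Bool) : Prop :=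
  (Inn α p.1 ∨ Inn β p.1) ∧ (p.2 = false → ∀ f, Arc α f p.1 → ¬ Arc β f p.1) ∧
    (p.2 = true → ∀ h, Arc α p.1 h → ¬ Arc β p.1 h)

theorem Live.step (hht : ∀ e f, r e f → ht e < ht f) (hα : Sys r st en α)
    (hβ : Sys r st' en' β) {p q : E × Bool} (h : Step α β p q) : Live α β q := by
  cases h with
  | bthru e h1 h2 => exact ⟨Or.inr h1, by simp, fun _ h h3 => (h2 (Sys.arc_in_l h3)).elim⟩
  | aback f e h1 h2 =>
    exact ⟨Or.inl (Sys.arc_in_l h1), by simp, fun _ h h3 => by rwa [← hα.arc_inj_l hht h1 h3]⟩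
  | athru e h1 h2 => exact ⟨Or.inl h1, fun _ f _ h3 => h2 (Sys.arc_in_r h3), by simp⟩
  | bfwd e h h1 h2 =>
    refine ⟨Or.inr (Sys.arc_in_r h1), fun _ f h3 h4 => ?_, by simp⟩
    obtain rfl := hβ.arc_inj_r hht h1 h4
    exact h2 h3

theorem exists_term [Finite E] (hht : ∀ e f, r e f → ht e < ht f) (hα : Sys r st en α)
    (hβ : Sys r st' en' β) (hrig : Rigid r st en α β) (hrig' : Rigid r st' en' β α)
    (s : Fin m → E) (hs : ∀ i, (α i).head? = some (s i))
    (l : Fin n → E) (hl : ∀ j, (β j).getLast? = some (l j)) (p : E × Bool) (hp : Live α β p) :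
    ∃ z : Fin m ⊕ Fin n, Relation.ReflTransGen (Step α β) p
      (Sum.elim (fun i => (s i, false)) (fun j => (l j, true)) z) := by
  let r' : E × Bool → E × Bool → Prop := fun a b => Relation.TransGen (Step α β) b a
  have : IsTrans _ r' := ⟨fun a b c h1 h2 => Relation.TransGen.trans h2 h1⟩
  have : Std.Irrefl r' := ⟨fun a h => by
    obtain ⟨b, h1, h2⟩ := Relation.TransGen.head'_iff.1 h
    exact no_cycle hht hα hβ hrig hrig' h1 h2⟩
  have wf := Finite.wellFounded_of_trans_of_irrefl r'
  induction p using wf.induction with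
  | _ p ih =>
  by_cases h : ∃ q, Step α β p q
  · obtain ⟨q, hq⟩ := h
    obtain ⟨z, hz⟩ := ih q (Relation.TransGen.single hq) (Live.step hht hα hβ hq)
    exact ⟨z, .head hq hz⟩
  · obtain ⟨e, b⟩ := p
    obtain ⟨h1, h2, h3⟩ := hp
    simp only at h1 h2 h3
    cases b
    · have hA : Inn α e := by
        by_contra hA
        exact h ⟨_, Step.bthru e (h1.resolve_left hA) hA⟩
      obtain ⟨i, hi⟩ := hA
      rcases head_or_pred hi with h4 | ⟨f, h4⟩
      · rw [hs i] at h4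
        obtain rfl : s i = e := by simpa using h4
        exact ⟨Sum.inl i, .refl⟩
      · exact (h ⟨_, Step.aback f e ⟨i, h4⟩ (h2 rfl f ⟨i, h4⟩)⟩).elim
    · have hB : Inn β e := by
        by_contra hB
        exact h ⟨_, Step.athru e (h1.resolve_right hB) hB⟩
      obtain ⟨i, hi⟩ := hB
      rcases last_or_succ hi with h4 | ⟨f, h4⟩
      · rw [hl i] at h4
        obtain rfl : l i = e := by simpa using h4
        exact ⟨Sum.inr i, .refl⟩
      · exact (h ⟨_, Step.bfwd e f ⟨i, h4⟩ (fun h5 => h3 rfl f h5 ⟨i, h4⟩)⟩).elim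

theorem first_reach (hht : ∀ e f, r e f → ht e < ht f) (hα : Sys r st en α) {w : E}
    (hwA : Inn α w) (hmin : ∀ e, Inn α e → Inn β e → ht w ≤ ht e) {q : E × Bool}
    (h : Relation.ReflTransGen (Step α β) (w, false) q) :
    q = (w, false) ∨ (¬ Inn β q.1 ∧ ht q.1 < ht w) := by
  induction h with
  | refl => exact Or.inl rfl
  | tail _ h ih =>
    have hno : ∀ f, Inn α f → ht f < ht w → ¬ Inn β f := fun f h1 h2 h3 => by
      have := hmin f h1 h3
      omega
    right
    cases h with
    | bthru e h1 h2 =>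
      rcases ih with ih | ih
      · simp at ih; subst ih; exact (h2 hwA).elim
      · exact (ih.1 h1).elim
    | aback f e h1 h2 =>
      have hlt := hht _ _ (hα.arc_r h1)
      have : ht f < ht w := by
        rcases ih with ih | ih
        · simp at ih; subst ih; exact hlt
        · exact hlt.trans ih.2
      exact ⟨hno f (Sys.arc_in_l h1) this, this⟩
    | athru e h1 h2 =>
      rcases ih with ih | ih
      · simp at ih
      · exact ih
    | bfwd e h h1 h2 =>
      rcases ih with ih | ih
      · simp at ih
      · exact (ih.1 (Sys.arc_in_l h1)).elim

theorem last_reach (hht : ∀ e f, r e f → ht e < ht f) (hβ : Sys r st' en' β) {w : E}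
    (hwB : Inn β w) (hmax : ∀ e, Inn α e → Inn β e → ht e ≤ ht w) {q : E × Bool}
    (h : Relation.ReflTransGen (Step α β) (w, true) q) :
    q = (w, true) ∨ (¬ Inn α q.1 ∧ ht w < ht q.1) := by
  induction h with
  | refl => exact Or.inl rfl
  | tail _ h ih =>
    have hno : ∀ f, Inn β f → ht w < ht f → ¬ Inn α f := fun f h1 h2 h3 => by
      have := hmax f h3 h1
      omega
    right
    cases h with
    | athru e h1 h2 =>
      rcases ih with ih | ih
      · simp at ih; subst ih; exact (h2 hwB).elim
      · exact (ih.1 h1).elim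
    | bfwd e f h1 h2 =>
      have hlt := hht _ _ (hβ.arc_r h1)
      have : ht w < ht f := by
        rcases ih with ih | ih
        · simp at ih; subst ih; exact hlt
        · exact ih.2.trans hlt
      exact ⟨hno f (Sys.arc_in_r h1) this, this⟩
    | bthru e h1 h2 =>
      rcases ih with ih | ih
      · simp at ih
      · exact ih
    | aback f e h1 h2 =>
      rcases ih with ih | ih
      · simp at ih
      · exact (ih.1 (Sys.arc_in_r h1)).elim

theorem sum_bound {ι : Type} [Fintype ι] [DecidableEq ι] (x : ι → ℕ) (K : ℕ) (a b : ι)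
    (hx : ∀ i, 2 * x i ≤ K + (if i = a then 1 else 0) + (if i = b then 1 else 0)) :
    ∑ i, x i ≤ (K + 1) + (Fintype.card ι - 2) * (K / 2) := by
  have hpos : 0 < Fintype.card ι := Fintype.card_pos_iff.2 ⟨a⟩
  by_cases hab : a = b
  · subst hab
    have h1 : ∑ i, x i ≤ ∑ i : ι, (K / 2 + if i = a then 1 else 0) := by
      apply Finset.sum_le_sum
      intro i _
      have := hx i
      split_ifs at this ⊢ <;> omega
    simp [Finset.sum_add_distrib] at h1
    obtain ⟨N, hN⟩ : ∃ N, Fintype.card ι = N + 1 := ⟨_, (Nat.succ_pred_eq_of_pos hpos).symm⟩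
    rw [hN] at h1 ⊢
    rcases N with _ | N
    · simp at *; omega
    · have : N + 1 + 1 - 2 = N := by omega
      rw [this]
      have : (N + 1 + 1) * (K / 2) = N * (K / 2) + 2 * (K / 2) := by ring
      omega
  · have h2 : 2 ≤ Fintype.card ι := by
      have := Fintype.one_lt_card_iff.2 ⟨a, b, hab⟩
      omega
    obtain ⟨N, hN⟩ : ∃ N, Fintype.card ι = N + 2 := ⟨_, (Nat.sub_add_cancel h2).symm⟩
    have e1 : (N + 2) * (K / 2) = N * (K / 2) + 2 * (K / 2) := by ring
    rcases Nat.even_or_odd' K with ⟨k, hk | hk⟩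
    · have h1 : ∑ i, x i ≤ ∑ i : ι, (K / 2) := by
        apply Finset.sum_le_sum
        intro i _
        have := hx i
        split_ifs at this ⊢
        · subst_vars; simp at hab
        all_goals omega
      simp at h1
      rw [hN] at h1 ⊢
      simp only [Nat.add_sub_cancel]
      omega
    · have h1 : ∑ i, x i ≤ ∑ i : ι, (K / 2 + (if i = a then 1 else 0) + if i = b then 1 else 0) := by
        apply Finset.sum_le_sum
        intro i _
        have := hx i
        split_ifs at this ⊢ <;> omega
      simp [Finset.sum_add_distrib] at h1
      rw [hN] at h1 ⊢
      simp only [Nat.add_sub_cancel]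
      omega

theorem main_count [Fintype E] (hht : ∀ e f, r e f → ht e < ht f) (hα : Sys r st en α)
    (hβ : Sys r st' en' β) (hrig : Rigid r st en α β) (hrig' : Rigid r st' en' β α) :
    Set.ncard {e : E | Inn α e ∧ Inn β e ∧ ∀ f, Arc α f e → ¬ Arc β f e} ≤
      (m + n - 1) + (m * n - 2) * ((m + n - 2) / 2) := by
  classical
  let C : Finset E := Finset.univ.filter fun e => Inn α e ∧ Inn β e
  rcases C.eq_empty_or_nonempty with hC | hC
  · have : {e : E | Inn α e ∧ Inn β e ∧ ∀ f, Arc α f e → ¬ Arc β f e} = ∅ := by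
      ext e
      simp only [Set.mem_setOf_eq, Set.mem_empty_iff_false, iff_false]
      rintro ⟨h1, h2, -⟩
      have : e ∈ C := by simp [C, h1, h2]
      rw [hC] at this
      simp at this
    rw [this]
    simp
  obtain ⟨w0, hw0, hmin⟩ := Finset.exists_min_image C ht hC
  obtain ⟨w1, hw1, hmax⟩ := Finset.exists_max_image C ht hC
  simp only [C, Finset.mem_filter, Finset.mem_univ, true_and] at hw0 hw1 hmin hmax
  obtain ⟨⟨i0, hi0⟩, ⟨j0, hj0⟩⟩ := hw0
  obtain ⟨⟨i1, hi1⟩, ⟨j1, hj1⟩⟩ := hw1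
  have hstart : ∀ i : Fin m, ∃ s, (α i).head? = some s := by
    intro i'
    rcases h : α i' with _ | ⟨a, l⟩
    · exact (hα.ne i' h).elim
    · exact ⟨a, by simp⟩
  have hend : ∀ i : Fin n, ∃ s, (β i).getLast? = some s := by
    intro i'
    exact ⟨_, List.getLast?_eq_getLast_of_ne_nil (hβ.ne i')⟩
  choose s hs using hstart
  choose l hl using hend
  have hterm := exists_term hht hα hβ hrig hrig' s hs l hl
  have hnode : ∀ p, ∃ z : Fin m ⊕ Fin n, Live α β p → Relation.ReflTransGen (Step α β) p
      (Sum.elim (fun i => (s i, false)) (fun j => (l j, true)) z) := by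
    intro p
    by_cases hp : Live α β p
    · obtain ⟨z, hz⟩ := hterm p hp
      exact ⟨z, fun _ => hz⟩
    · exact ⟨Sum.inl i0, fun h => (hp h).elim⟩
  choose L hL using hnode
  have hcomp : ∀ p q, Live α β p → Live α β q → L p = L q →
      Relation.ReflTransGen (Step α β) p q ∨ Relation.ReflTransGen (Step α β) q p := by
    intro p q hp hq hpq
    have h1 := reach_swap (hL p hp)
    have h2 := reach_swap (hL q hq)
    rw [hpq] at h1
    rcases Relation.ReflTransGen.total_of_right_unique (step_unique hht hβ hα) h1 h2 with h | h
    · exact Or.inr (reach_swap h)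
    · exact Or.inl (reach_swap h)
  have hx0 : Live α β (w0, false) := by
    refine ⟨Or.inl ⟨i0, hi0⟩, fun _ f h1 h2 => ?_, by simp⟩
    have := hmin f ⟨Sys.arc_in_l h1, Sys.arc_in_l h2⟩
    have := hht _ _ (hα.arc_r h1)
    simp at this
    omega
  have hy1 : Live α β (w1, true) := by
    refine ⟨Or.inl ⟨i1, hi1⟩, by simp, fun _ f h1 h2 => ?_⟩
    have := hmax f ⟨Sys.arc_in_r h1, Sys.arc_in_r h2⟩
    have := hht _ _ (hα.arc_r h1)
    simp at this
    omega
  have hx0u : ∀ p, Live α β p → Inn α p.1 → Inn β p.1 → L p = L (w0, false) → p = (w0, false) := by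
    intro p hp hA hB hLp
    rcases hcomp p _ hp hx0 hLp with h | h
    · rcases first_reach hht hβ ⟨j0, hj0⟩ (fun e h1 h2 => hmin e ⟨h2, h1⟩) (reach_swap h) with h | h
      · exact h
      · exact (h.1 hA).elim
    · rcases first_reach hht hα ⟨i0, hi0⟩ (fun e h1 h2 => hmin e ⟨h1, h2⟩) h with h | h
      · exact h
      · exact (h.1 hB).elim
  have hy1u : ∀ p, Live α β p → Inn α p.1 → Inn β p.1 → L p = L (w1, true) → p = (w1, true) := by
    intro p hp hA hB hLp
    rcases hcomp p _ hp hy1 hLp with h | h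
    · rcases last_reach hht hα ⟨i1, hi1⟩ (fun e h1 h2 => hmax e ⟨h2, h1⟩) (reach_swap h) with h | h
      · exact h
      · exact (h.1 hB).elim
    · rcases last_reach hht hβ ⟨j1, hj1⟩ (fun e h1 h2 => hmax e ⟨h1, h2⟩) h with h | h
      · exact h
      · exact (h.1 hA).elim
  have hne : L (w0, false) ≠ L (w1, true) := by
    intro h
    have := hy1u (w0, false) hx0 ⟨i0, hi0⟩ ⟨j0, hj0⟩ h
    simp at this
  let X : Fin m × Fin n → Finset E := fun z => Finset.univ.filter fun e =>
    e ∈ α z.1 ∧ e ∈ β z.2 ∧ ∀ f, Arc α f e → ¬ Arc β f e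
  let Y : Fin m × Fin n → Finset E := fun z => Finset.univ.filter fun e =>
    e ∈ α z.1 ∧ e ∈ β z.2 ∧ ∀ f, Arc α e f → ¬ Arc β e f
  let Z : Fin m × Fin n → Finset E := fun z => Finset.univ.filter fun e => e ∈ α z.1 ∧ e ∈ β z.2
  let S : Fin m × Fin n → Finset (E × Bool) := fun z => Finset.univ.filter fun p =>
    p.1 ∈ α z.1 ∧ p.1 ∈ β z.2 ∧ Live α β p
  have hXY : ∀ z, (X z).card ≤ (Y z).card := by
    intro z
    have hXZ : X z ⊆ Z z := by
      intro e he
      simp only [X, Z, Finset.mem_filter, Finset.mem_univ, true_and] at he ⊢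
      exact ⟨he.1, he.2.1⟩
    have hYZ : Y z ⊆ Z z := by
      intro e he
      simp only [Y, Z, Finset.mem_filter, Finset.mem_univ, true_and] at he ⊢
      exact ⟨he.1, he.2.1⟩
    have hsu : ∀ e, ∃ h, e ∈ Z z \ Y z → Arc α e h ∧ Arc β e h := by
      intro e
      by_cases he : e ∈ Z z \ Y z
      · simp only [Y, Z, Finset.mem_sdiff, Finset.mem_filter, Finset.mem_univ, true_and] at he
        by_contra hcon
        push Not at hcon
        exact he.2 ⟨he.1.1, he.1.2, fun f h1 h2 => (hcon f).2 h1 h2⟩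
      · exact ⟨e, fun h => (he h).elim⟩
    choose su hsu using hsu
    have h1 : (Z z \ Y z).card ≤ (Z z \ X z).card := by
      apply Finset.card_le_card_of_injOn su
      · intro e he
        have he' := Finset.mem_coe.1 he
        obtain ⟨h1, h2⟩ := hsu e he'
        have he2 : e ∈ α z.1 ∧ e ∈ β z.2 := by
          have := (Finset.mem_sdiff.1 he').1
          simpa [Z] using this
        have g1 := (infix_mem (hα.arc_lab_l h1 he2.1)).2
        have g2 := (infix_mem (hβ.arc_lab_l h2 he2.2)).2
        simp only [X, Z, Finset.coe_sdiff, Set.mem_diff, Finset.mem_coe, Finset.mem_filter,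
          Finset.mem_univ, true_and]
        exact ⟨⟨g1, g2⟩, fun h => h.2.2 e h1 h2⟩
      · intro e he e' he' heq
        obtain ⟨h1, -⟩ := hsu e (Finset.mem_coe.1 he)
        obtain ⟨h2, -⟩ := hsu e' (Finset.mem_coe.1 he')
        rw [heq] at h1
        exact hα.arc_inj_r hht h1 h2
    have h2 := Finset.card_sdiff_add_card_eq_card hXZ
    have h3 := Finset.card_sdiff_add_card_eq_card hYZ
    omega
  have hXS : ∀ z, (X z).card + (Y z).card ≤ (S z).card := by
    intro z
    have hd : Disjoint ((X z) ×ˢ ({false} : Finset Bool)) ((Y z) ×ˢ ({true} : Finset Bool)) := by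
      rw [Finset.disjoint_left]
      rintro ⟨e, b⟩ h1 h2
      simp at h1 h2
      simp [h1.2] at h2
    have h1 := Finset.card_union_of_disjoint hd
    simp only [Finset.card_product, Finset.card_singleton, mul_one] at h1
    rw [← h1]
    apply Finset.card_le_card
    rintro ⟨e, b⟩ he
    simp only [X, Y, Finset.mem_union, Finset.mem_product, Finset.mem_filter, Finset.mem_univ,
      true_and, Finset.mem_singleton] at he
    simp only [S, Finset.mem_filter, Finset.mem_univ, true_and]
    rcases he with ⟨⟨h1, h2, h3⟩, rfl⟩ | ⟨⟨h1, h2, h3⟩, rfl⟩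
    · exact ⟨h1, h2, Or.inl ⟨_, h1⟩, fun _ => h3, by simp⟩
    · exact ⟨h1, h2, Or.inl ⟨_, h1⟩, by simp, fun _ => h3⟩
  have hS : ∀ z, (S z).card ≤ (m + n - 2) + (if z = (i0, j0) then 1 else 0) +
      (if z = (i1, j1) then 1 else 0) := by
    intro z
    have hmem : ∀ p, p ∈ S z ↔ p.1 ∈ α z.1 ∧ p.1 ∈ β z.2 ∧ Live α β p := by
      intro p; simp [S]
    have h1 : (((S z).erase (w0, false)).erase (w1, true)).card ≤
        ((Finset.univ.erase (L (w0, false))).erase (L (w1, true))).card := by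
      apply Finset.card_le_card_of_injOn L
      · intro p hp
        simp only [Finset.coe_erase, Set.mem_diff, Finset.mem_coe, Set.mem_singleton_iff] at hp
        obtain ⟨⟨hp, hp0⟩, hp1⟩ := hp
        rw [hmem] at hp
        simp only [Finset.coe_erase, Finset.coe_univ, Set.mem_diff, Set.mem_univ,
          Set.mem_singleton_iff, true_and]
        exact ⟨fun h => hp0 (hx0u p hp.2.2 ⟨_, hp.1⟩ ⟨_, hp.2.1⟩ h),
          fun h => hp1 (hy1u p hp.2.2 ⟨_, hp.1⟩ ⟨_, hp.2.1⟩ h)⟩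
      · intro p hp q hq hpq
        simp only [Finset.coe_erase, Set.mem_diff, Finset.mem_coe, Set.mem_singleton_iff] at hp hq
        have hp := hp.1.1
        have hq := hq.1.1
        rw [hmem] at hp hq
        rcases hcomp p q hp.2.2 hq.2.2 hpq with h | h
        · exact eq_of_reach hht hα hβ hrig hrig' h hp.1 hq.1 hp.2.1 hq.2.1
        · exact (eq_of_reach hht hα hβ hrig hrig' h hq.1 hp.1 hq.2.1 hp.2.1).symm
    have h2 : ((Finset.univ.erase (L (w0, false))).erase (L (w1, true))).card = m + n - 2 := by
      rw [Finset.card_erase_of_mem (by simp [hne.symm]), Finset.card_erase_of_mem (by simp)]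
      simp
      omega
    rw [h2] at h1
    have h3 : (S z).card ≤ ((S z).erase (w0, false)).card + (if z = (i0, j0) then 1 else 0) := by
      split_ifs with h
      · have := Finset.pred_card_le_card_erase (s := S z) (a := (w0, false)); omega
      · rw [Finset.erase_eq_of_notMem]
        · simp
        · rw [hmem]
          rintro ⟨g1, g2, -⟩
          exact h (Prod.ext (hα.lab g1 hi0) (hβ.lab g2 hj0))
    have h4 : ((S z).erase (w0, false)).card ≤ (((S z).erase (w0, false)).erase (w1, true)).card +
        (if z = (i1, j1) then 1 else 0) := by
      split_ifs with h
      · have := Finset.pred_card_le_card_erase (s := (S z).erase (w0, false)) (a := (w1, true)); omega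
      · rw [Finset.erase_eq_of_notMem (a := (w1, true))]
        · simp
        · intro hh
          have hh := Finset.mem_of_mem_erase hh
          rw [hmem] at hh
          obtain ⟨g1, g2, -⟩ := hh
          exact h (Prod.ext (hα.lab g1 hi1) (hβ.lab g2 hj1))
    omega
  have hsum := sum_bound (fun z => (X z).card) (m + n - 2) (i0, j0) (i1, j1) (by
    intro z
    have := hXY z
    have := hXS z
    have := hS z
    omega)
  have hle : Set.ncard {e : E | Inn α e ∧ Inn β e ∧ ∀ f, Arc α f e → ¬ Arc β f e} ≤
      ∑ z, (X z).card := by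
    refine le_trans ?_ (Finset.card_biUnion_le)
    rw [← Set.ncard_coe_finset]
    apply Set.ncard_le_ncard _ (Finset.finite_toSet _)
    rintro e ⟨⟨i, hi⟩, ⟨j, hj⟩, h⟩
    simp only [Finset.coe_biUnion, Set.mem_iUnion]
    exact ⟨(i, j), by simp, by simp only [X, Finset.coe_filter, Set.mem_setOf_eq]; exact ⟨by simp, hi, hj, h⟩⟩
  have hm : 0 < m := i0.pos
  have hn : 0 < n := j0.pos
  simp only [Fintype.card_prod, Fintype.card_fin] at hsum
  have e1 : m + n - 2 + 1 = m + n - 1 := by omega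
  rw [e1] at hsum
  exact hle.trans hsum

end

theorem exists_ht [Fintype E] {r : E → E → Prop} (hac : ∀ e, ¬ Relation.TransGen r e e) :
    ∃ ht : E → ℕ, ∀ e f, r e f → ht e < ht f := by
  classical
  refine ⟨fun e => (Finset.univ.filter fun f => Relation.TransGen r f e).card, ?_⟩
  intro e f hef
  apply Finset.card_lt_card
  rw [Finset.ssubset_iff_of_subset]
  · exact ⟨e, by simpa using Relation.TransGen.single hef, by simpa using hac e⟩
  · intro x hx
    simp only [Finset.mem_filter, Finset.mem_univ, true_and] at hx ⊢
    exact hx.tail hef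

theorem exists_rigid [Fintype E] {r : E → E → Prop} {st en st' en' : E → Prop} {m n : ℕ}
    (h1 : ∃ α : Fin m → List E, Sys r st en α) (h2 : ∃ β : Fin n → List E, Sys r st' en' β) :
    ∃ (α : Fin m → List E) (β : Fin n → List E), Sys r st en α ∧ Sys r st' en' β ∧
      Rigid r st en α β ∧ Rigid r st' en' β α := by
  classical
  let Q : ℕ → Prop := fun k => ∃ (α : Fin m → List E) (β : Fin n → List E), Sys r st en α ∧
    Sys r st' en' β ∧ Set.ncard {p : E × E | Arc α p.1 p.2 ∨ Arc β p.1 p.2} = k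
  have hQ : ∃ k, Q k := by
    obtain ⟨α, hα⟩ := h1
    obtain ⟨β, hβ⟩ := h2
    exact ⟨_, α, β, hα, hβ, rfl⟩
  obtain ⟨α, β, hα, hβ, hk⟩ := Nat.find_spec hQ
  refine ⟨α, β, hα, hβ, ?_, ?_⟩
  · intro α' hα' hsub f e hfe hfe'
    by_contra hno
    refine Nat.find_min hQ ?_ ⟨α', β, hα', hβ, rfl⟩
    rw [← hk]
    apply Set.ncard_lt_ncard _ (Set.toFinite _)
    refine ⟨?_, ?_⟩
    · rintro ⟨a, b⟩ (h | h)
      · exact hsub a b h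
      · exact Or.inr h
    · intro h
      rcases h (show (f, e) ∈ _ from Or.inl hfe) with h | h
      · exact hno h
      · exact hfe' h
  · intro β' hβ' hsub f e hfe hfe'
    by_contra hno
    refine Nat.find_min hQ ?_ ⟨α, β', hα, hβ', rfl⟩
    rw [← hk]
    apply Set.ncard_lt_ncard _ (Set.toFinite _)
    refine ⟨?_, ?_⟩
    · rintro ⟨a, b⟩ (h | h)
      · exact Or.inl h
      · exact (hsub a b h).symm
    · intro h
      rcases h (show (f, e) ∈ _ from Or.inr hfe) with h | h
      · exact hfe' h
      · exact hno h

theorem acyclic_trans {G : MultiDigraph} (hG : G.Acyclic) (e : G.E) :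
    ¬ Relation.TransGen (fun e f => G.dst e = G.src f) e e := by
  have key : ∀ f, Relation.TransGen (fun e f => G.dst e = G.src f) e f →
      ∃ l : List G.E, (e :: l).IsChain (fun e f => G.dst e = G.src f) ∧
        ∀ x ∈ (e :: l).getLast?, G.dst x = G.src f := by
    intro f hf
    induction hf with
    | single h => exact ⟨[], by simp, by simpa using h⟩
    | tail _ h ih =>
      rename_i b d _
      obtain ⟨l, h1, h2⟩ := ih
      refine ⟨l ++ [b], ?_, ?_⟩
      · rw [← List.cons_append, List.isChain_append]
        refine ⟨h1, by simp, ?_⟩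
        intro x hx y hy
        simp at hy
        subst hy
        exact h2 x hx
      · intro x hx
        rw [← List.cons_append, List.getLast?_append] at hx
        simp at hx
        subst hx
        exact h
  intro h
  obtain ⟨l, h1, h2⟩ := key e h
  exact hG (G.src e) (e :: l) ⟨by simp, h1, by simp, h2⟩

theorem sys_iff {G : MultiDigraph} {u v : G.V} {c : ℕ} {α : Fin c → List G.E} :
    G.MengerSystem u v c α ↔
      Sys (fun e f => G.dst e = G.src f) (fun e => G.src e = u) (fun e => G.dst e = v) α := by
  constructor
  · rintro ⟨h1, h2⟩
    exact ⟨fun i => (h1 i).1, fun i => (h1 i).2.1, fun i => (h1 i).2.2.1, fun i => (h1 i).2.2.2, h2⟩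
  · rintro ⟨h1, h2, h3, h4, h5⟩
    exact ⟨fun i => ⟨h1 i, h2 i, h3 i, h4 i⟩, h5⟩

end MUp

/-- For all positive integers `m` and `n`,
`M(m, n) ≤ (m + n − 1) + (mn − 2)·⌊(m + n − 2)/2⌋`: in every acyclic graph with two
distinct sources, two distinct sinks and min-cuts `m` and `n`, some choice of the two
Menger path systems yields at most this many mergings. -/
theorem M_upper (m n : ℕ) (hm : 0 < m) (hn : 0 < n) :
    MAtMost ![m, n] ((m + n - 1) + (m * n - 2) * ((m + n - 2) / 2)) := by
  intro G S R hG _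
  obtain ⟨hac, -, hcut⟩ := hG
  let _ := G.fintE
  obtain ⟨ht, hht⟩ := MUp.exists_ht (MUp.acyclic_trans hac)
  obtain ⟨α₀, hα₀⟩ := (hcut 0).1
  obtain ⟨β₀, hβ₀⟩ := (hcut 1).1
  obtain ⟨α, β, hα, hβ, h1, h2⟩ := MUp.exists_rigid (m := m) (n := n)
    ⟨α₀, MUp.sys_iff.1 hα₀⟩ ⟨β₀, MUp.sys_iff.1 hβ₀⟩
  have hmain := MUp.main_count hht hα hβ h1 h2
  let γ : (i : Fin 2) → Fin (![m, n] i) → List G.E := fun i => match i with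
    | 0 => α
    | 1 => β
  refine ⟨γ, ?_, le_trans ?_ hmain⟩
  · intro i
    fin_cases i
    · exact MUp.sys_iff.2 hα
    · exact MUp.sys_iff.2 hβ
  · apply Set.ncard_le_ncard _ (Set.toFinite _)
    have key : ∀ (a : Fin m) (b : Fin n) (e f g : G.E), f ≠ g → [f, e] <:+: α a →
        [g, e] <:+: β b → MUp.Inn α e ∧ MUp.Inn β e ∧
          ∀ f, MUp.Arc α f e → ¬ MUp.Arc β f e := by
      intro a b e f g hfg hf hg
      refine ⟨⟨a, (MUp.infix_mem hf).2⟩, ⟨b, (MUp.infix_mem hg).2⟩, ?_⟩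
      intro x hx hy
      have e1 := hα.arc_inj_r hht ⟨a, hf⟩ hx
      have e2 := hβ.arc_inj_r hht ⟨b, hg⟩ hy
      exact hfg (e1.trans e2.symm)
    rintro e ⟨i, j, hij, a, b, f, g, hfg, hf, hg⟩
    fin_cases i <;> fin_cases j
    · exact (hij rfl).elim
    · exact key a b e f g hfg hf hg
    · exact key b a e g f hfg.symm hg hf
    · exact (hij rfl).elim
end

section
/- For every positive integer n, M(3,n) ≤ 14n. That is, in every acyclic directed graph with two distinct sources S_1, S_2 and two distinct sinks R_1, R_2, with min-cut 3 from S_1 to R_1 and min-cut n from S_2 to R_2, one can choose a set of 3 edge-disjoint paths from S_1 to R_1 and a set of n edge-disjoint paths from S_2 to R_2 whose number of mergings is at most 14n. -/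
open MultiDigraph

namespace MTN

/-- Abstract configuration of mergings on `3` tracks and `n` strands. -/
structure Conf (X : Type) (n : ℕ) where
  i : X → Fin 3
  j : X → Fin n
  g : X → ℕ
  hi : ∀ x y, i x = i y → g x = g y → x = y
  hj : ∀ x y, j x = j y → g x = g y → x = y

variable {X : Type} {n : ℕ}

/-- consecutive on a strand -/
def Conf.S (C : Conf X n) (q v : X) : Prop :=
  C.j q = C.j v ∧ C.g q < C.g v ∧ ∀ w, C.j w = C.j q → C.g q < C.g w → C.g w < C.g v → False

/-- consecutive on a track -/
def Conf.R (C : Conf X n) (q v : X) : Prop :=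
  C.i q = C.i v ∧ C.g q < C.g v ∧ ∀ w, C.i w = C.i q → C.g q < C.g w → C.g w < C.g v → False

/-- admissible time functions -/
structure Conf.Time (C : Conf X n) (τ : X → ℚ) : Prop where
  inj : Function.Injective τ
  F0 : ∀ x u, C.i x = C.i u → C.g x < C.g u → τ x < τ u
  F1 : ∀ q v u, C.S q v → C.i q = C.i u → C.g q < C.g u → τ v < τ u

theorem Conf.S_pred_unique (C : Conf X n) {a b v : X} (h1 : C.S a v) (h2 : C.S b v) : a = b := by
  obtain ⟨p1, p2, p3⟩ := h1
  obtain ⟨q1, q2, q3⟩ := h2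
  rcases lt_trichotomy (C.g a) (C.g b) with h | h | h
  · exact (p3 b (by rw [p1, q1]) h q2).elim
  · exact C.hj a b (by rw [p1, q1]) h
  · exact (q3 a (by rw [p1, q1]) h p2).elim

theorem Conf.S_succ_unique (C : Conf X n) {a b v : X} (h1 : C.S v a) (h2 : C.S v b) : a = b := by
  obtain ⟨p1, p2, p3⟩ := h1
  obtain ⟨q1, q2, q3⟩ := h2
  rcases lt_trichotomy (C.g a) (C.g b) with h | h | h
  · exact (q3 a p1.symm p2 h).elim
  · exact C.hj a b (by rw [← p1, q1]) h
  · exact (p3 b q1.symm q2 h).elim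

theorem Conf.Time.S_ne {C : Conf X n} {τ : X → ℚ} (T : C.Time τ) {q v : X} (h : C.S q v) :
    C.i q ≠ C.i v := fun e => lt_irrefl _ (T.F1 q v v h e h.2.1)

/-- number of births -/
noncomputable def Conf.births (C : Conf X n) (τ : X → ℚ) : ℕ :=
  Set.ncard {v | ∃ q, C.S q v ∧ τ v < τ q}

theorem Conf.improve [Finite X] (C : Conf X n) (τ : X → ℚ) (T : C.Time τ) {r q v w : X}
    (h1 : C.S r q) (h2 : C.S q v) (h3 : C.S v w) (h : τ v < τ q) :
    ∃ τ', C.Time τ' ∧ C.births τ' < C.births τ := by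
  classical
  have := Fintype.ofFinite X
  have hqv : q ≠ v := by rintro rfl; exact lt_irrefl _ h
  have hrv : C.i r ≠ C.i v := fun e => by
    have := T.F1 r q v h1 e (h1.2.1.trans h2.2.1)
    exact lt_asymm h this
  have hqw : τ q < τ w := by
    have a1 := T.S_ne h1
    have a2 := T.S_ne h2
    have a3 := T.S_ne h3
    have : C.i w = C.i q ∨ C.i w = C.i r := by omega
    rcases this with e | e
    · exact T.F0 q w e.symm (h2.2.1.trans h3.2.1)
    · exact T.F1 r q w h1 e.symm (h1.2.1.trans (h2.2.1.trans h3.2.1))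
  obtain ⟨t, ht1, ht2⟩ : ∃ t, τ q < t ∧ ∀ x, τ q < τ x → t < τ x := by
    obtain ⟨t, h1, h2⟩ := Order.exists_between_finsets (lo := {τ q})
      (hi := (Finset.univ.image τ).filter (fun y => τ q < y)) (by simp)
    exact ⟨t, h1 _ (by simp), fun x hx => h2 _ (by simp [hx])⟩
  have tne : ∀ x, x ≠ v → τ x ≠ t := by
    intro x hx e
    have h5 := ht2 x (by rw [e]; exact ht1)
    rw [e] at h5
    exact lt_irrefl _ h5
  have hu : ∀ x, x ≠ v → Function.update τ v t x = τ x := fun x hx => Function.update_of_ne hx _ _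
  have hv : Function.update τ v t v = t := Function.update_self _ _ _
  refine ⟨Function.update τ v t, ⟨?_, ?_, ?_⟩, ?_⟩
  · intro x y hxy
    by_cases hx : x = v <;> by_cases hy : y = v
    · rw [hx, hy]
    · rw [hx, hv, hu y hy] at hxy; exact absurd hxy.symm (tne y hy)
    · rw [hy, hv, hu x hx] at hxy; exact absurd hxy (tne x hx)
    · rw [hu x hx, hu y hy] at hxy; exact T.inj hxy
  · intro x u e l
    have h0 := T.F0 x u e l
    by_cases hx : x = v <;> by_cases hy : u = v
    · subst hx; subst hy; omega
    · subst hx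
      rw [hv, hu u hy]
      exact ht2 u (hqw.trans (T.F1 _ w u h3 e l))
    · subst hy
      rw [hv, hu x hx]; linarith
    · rw [hu x hx, hu u hy]; exact h0
  · intro a b u hab e l
    have h0 := T.F1 a b u hab e l
    by_cases hx : b = v <;> by_cases hy : u = v
    · subst hx; subst hy; exact absurd h0 (lt_irrefl _)
    · subst hx
      rw [hv, hu u hy]
      have := C.S_pred_unique hab h2
      subst this
      exact ht2 u (T.F0 _ u e l)
    · subst hy
      rw [hv, hu b hx]; linarith
    · rw [hu b hx, hu u hy]; exact h0
  · apply Set.ncard_lt_ncard _ (Set.toFinite _)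
    rw [Set.ssubset_iff_of_subset]
    · refine ⟨v, ⟨q, h2, h⟩, ?_⟩
      rintro ⟨q', h5, h6⟩
      have := C.S_pred_unique h5 h2
      subst this
      rw [hv, hu _ hqv] at h6
      exact lt_asymm h6 ht1
    · rintro b ⟨a, h5, h6⟩
      refine ⟨a, h5, ?_⟩
      by_cases hb : b = v
      · subst hb
        have := C.S_pred_unique h5 h2
        subst this
        exact h
      · by_cases ha : a = v
        · subst ha
          have := C.S_succ_unique h5 h3
          subst this
          rw [hv, hu _ hb] at h6
          exact absurd (ht2 _ hqw) (not_lt_of_gt h6)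
        · rwa [hu _ hb, hu _ ha] at h6

theorem Conf.exists_best [Finite X] (C : Conf X n) (τ : X → ℚ) (T : C.Time τ) :
    ∃ τ', C.Time τ' ∧ ∀ r q v w, C.S r q → C.S q v → C.S v w → τ' q < τ' v := by
  classical
  let P : ℕ → Prop := fun k => ∃ τ', C.Time τ' ∧ C.births τ' = k
  have hP : ∃ k, P k := ⟨_, τ, T, rfl⟩
  obtain ⟨τ', T', e⟩ := Nat.find_spec hP
  refine ⟨τ', T', ?_⟩
  intro r q v w h1 h2 h3
  by_contra hcon
  have hqv : τ' v ≠ τ' q := fun e => by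
    have := T'.inj e
    subst this
    exact lt_irrefl _ h2.2.1
  obtain ⟨τ2, T2, h5⟩ := C.improve τ' T' h1 h2 h3 (lt_of_le_of_ne (not_lt.mp hcon) hqv)
  have := Nat.find_min' hP ⟨τ2, T2, rfl⟩
  omega

/-- good elements -/
def Conf.good (C : Conf X n) (τ : X → ℚ) (v : X) : Prop :=
  ∃ q w, C.S q v ∧ C.S v w ∧ τ q < τ v ∧ τ v < τ w

theorem Conf.Time.F1' {C : Conf X n} {τ : X → ℚ} (T : C.Time τ) {q v x : X} (h : C.S q v)
    (e : C.i x = C.i q) (l : τ q < τ x) : τ v < τ x := by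
  refine T.F1 q v x h e.symm ?_
  rcases lt_trichotomy (C.g q) (C.g x) with h1 | h1 | h1
  · exact h1
  · rw [C.hi x q e h1.symm] at l; exact absurd l (lt_irrefl _)
  · exact absurd (T.F0 x q e h1) (not_lt_of_gt l)

theorem Conf.Time.mkR {C : Conf X n} {τ : X → ℚ} (T : C.Time τ) {q u : X} 
    (e : C.i u = C.i q) (l : τ q < τ u) (h : ∀ x, C.i x = C.i q → τ q < τ x → τ x < τ u → False) :
    C.R q u := by
  refine ⟨e.symm, ?_, ?_⟩
  · rcases lt_trichotomy (C.g q) (C.g u) with h1 | h1 | h1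
    · exact h1
    · rw [C.hi u q e h1.symm] at l; exact absurd l (lt_irrefl _)
    · exact absurd (T.F0 u q e h1) (not_lt_of_gt l)
  · intro w e2 h1 h2
    exact h w e2 (T.F0 q w e2.symm h1) (T.F0 w u (e2.trans e.symm) h2)

theorem Conf.window (C : Conf X n) (τ : X → ℚ) (T : C.Time τ) (ρ : X → ℕ)
    (H0 : ∀ x u, C.j x = C.j u → C.g x < C.g u → ρ x < ρ u)
    (H1 : ∀ q u v, C.R q u → C.j q = C.j v → C.g q < C.g v → ρ u < ρ v)
    (v0 v1 v2 : X) (g0 : C.good τ v0) (g1 : C.good τ v1) (g2 : C.good τ v2)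
    (l01 : τ v0 < τ v1) (l12 : τ v1 < τ v2)
    (a01 : ∀ x, τ v0 < τ x → τ x < τ v1 → False)
    (a12 : ∀ x, τ v1 < τ x → τ x < τ v2 → False) : False := by
  obtain ⟨q0, w0, s0, t0, b0, c0⟩ := g0
  obtain ⟨q1, w1, s1, t1, b1, c1⟩ := g1
  obtain ⟨q2, w2, s2, t2, b2, c2⟩ := g2
  have cmp : ∀ x y, τ x < τ y ∨ x = y ∨ τ y < τ x := fun x y => by
    rcases lt_trichotomy (τ x) (τ y) with h | h | h
    · exact Or.inl h
    · exact Or.inr (Or.inl (T.inj h))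
    · exact Or.inr (Or.inr h)
  -- elements between v0 and v2
  have a02 : ∀ x, τ v0 < τ x → τ x < τ v2 → x = v1 := by
    intro x h1 h2
    rcases cmp x v1 with h | h | h
    · exact (a01 x h1 h).elim
    · exact h
    · exact (a12 x h h2).elim
  have hs : ∀ q v, C.S q v → ρ q < ρ v := fun q v h => H0 q v h.1 h.2.1
  have hr : ∀ q u v, C.R q u → C.S q v → ρ u < ρ v := fun q u v h h' => H1 q u v h h'.1 h'.2.1
  have n0 := T.S_ne s0
  have n1 := T.S_ne s1
  have n2 := T.S_ne s2
  -- generic pair step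
  have pair : ∀ q v w q' v', C.S q v → C.S v w → C.S q' v' → τ q < τ v → τ v < τ w → τ q' < τ v' →
      τ v < τ v' → (∀ x, τ v < τ x → τ x < τ v' → False) → 
      (C.i v' = C.i q ∧ C.R q v' ∧ C.i q' ≠ C.i v) ∨ (C.i v' ≠ C.i q ∧ q' = v) := by
    intro q v w q' v' s t s' b c b' l a
    have n := T.S_ne s
    have n' := T.S_ne s'
    have hne : C.i v' ≠ C.i v := fun e => a w c (T.F1' t e l)
    have cur : C.i q' = C.i v → q' = v := by
      intro e
      rcases cmp q' v with h | h | h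
      · exact absurd (T.F1' s' e.symm h) (not_lt_of_gt l)
      · exact h
      · exact (a _ h b').elim
    by_cases e : C.i v' = C.i q
    · left
      have hR : C.R q v' := T.mkR e (b.trans l) (fun x e2 h1 h2 => a x (T.F1' s e2 h1) h2)
      refine ⟨e, hR, fun e2 => ?_⟩
      have e3 := cur e2
      subst e3
      have := hs _ _ s'
      have := hr _ _ _ hR s
      omega
    · right
      refine ⟨e, ?_⟩
      have : C.i q' = C.i v ∨ C.i q' = C.i q := by omega
      rcases this with h | h
      · exact cur h
      · exfalso
        rcases cmp q' q with h1 | h1 | h1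
        · have := T.F1' s' h.symm h1
          linarith
        · subst h1
          have := C.S_succ_unique s s'
          subst this
          exact lt_irrefl _ l
        · exact a q' (T.F1' s h h1) b'
  have p01 := pair q0 v0 w0 q1 v1 s0 t0 s1 b0 c0 b1 l01 a01
  have p12 := pair q1 v1 w1 q2 v2 s1 t1 s2 b1 c1 b2 l12 a12
  have e21 : C.i v2 ≠ C.i v1 := fun e => a12 w1 c1 (T.F1' t1 e l12)
  have e10 : C.i v1 ≠ C.i v0 := fun e => a01 w0 c0 (T.F1' t0 e l01)
  rcases p01 with ⟨x1, x2, x3⟩ | ⟨x1, x2⟩ <;> rcases p12 with ⟨y1, y2, y3⟩ | ⟨y1, y2⟩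
  · have e : C.i q2 = C.i v0 := by omega
    have : q2 = v0 := by
      rcases cmp q2 v0 with h | h | h
      · have := T.F1' s2 e.symm h
        linarith
      · exact h
      · have := a02 q2 h b2
        subst this
        exact absurd e e10
    subst this
    have := hs _ _ s2
    have := hr _ _ _ x2 s0
    have := hr _ _ _ y2 s1
    omega
  · have e : C.i v2 = C.i v0 := by omega
    have h := T.F1' t0 e (l01.trans l12)
    have := a02 w0 c0 h
    subst this
    have := C.S_pred_unique t0 s1
    subst this
    exact x3 rfl
  · subst x2
    have e : C.i q2 = C.i q0 := by omega
    have h : q2 = q0 := by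
      rcases cmp q2 q0 with h | h | h
      · have := T.F1' s2 e.symm h
        linarith
      · exact h
      · have h' := T.F1' s0 e h
        have := a02 q2 h' b2
        subst this
        exact absurd e x1
    subst h
    have := C.S_succ_unique s0 s2
    subst this
    linarith
  · subst x2
    subst y2
    have e : C.i v2 = C.i q0 := by omega
    have hR : C.R q0 v2 := T.mkR e (by linarith) (fun x e2 h1 h2 => by
      have := a02 x (T.F1' s0 e2 h1) h2
      subst this
      exact x1 e2)
    have := hr _ _ _ hR s0
    have := hs _ _ s1
    have := hs _ _ s2
    omega

theorem Conf.exists_pred [Finite X] (C : Conf X n) {u v : X} (e : C.j u = C.j v)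
    (l : C.g u < C.g v) : ∃ q, C.S q v := by
  obtain ⟨q, hq, hm⟩ := Set.exists_max_image {q | C.j q = C.j v ∧ C.g q < C.g v} C.g
    (Set.toFinite _) ⟨u, e, l⟩
  refine ⟨q, hq.1, hq.2, fun w h1 h2 h3 => ?_⟩
  have := hm w ⟨h1.trans hq.1, h3⟩
  omega

theorem Conf.exists_succ [Finite X] (C : Conf X n) {u v : X} (e : C.j u = C.j v)
    (l : C.g v < C.g u) : ∃ q, C.S v q := by
  obtain ⟨q, hq, hm⟩ := Set.exists_min_image {q | C.j q = C.j v ∧ C.g v < C.g q} C.g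
    (Set.toFinite _) ⟨u, e, l⟩
  refine ⟨q, hq.1.symm, hq.2, fun w h1 h2 h3 => ?_⟩
  have := hm w ⟨h1, h2⟩
  omega

theorem Conf.first_unique [Finite X] (C : Conf X n) {u v : X} (hu : ∀ q, ¬ C.S q u)
    (hv : ∀ q, ¬ C.S q v) (e : C.j u = C.j v) : u = v := by
  rcases lt_trichotomy (C.g u) (C.g v) with h | h | h
  · obtain ⟨q, hq⟩ := C.exists_pred e h
    exact (hv q hq).elim
  · exact C.hj u v e h
  · obtain ⟨q, hq⟩ := C.exists_pred e.symm h
    exact (hu q hq).elim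

theorem Conf.last_unique [Finite X] (C : Conf X n) {u v : X} (hu : ∀ q, ¬ C.S u q)
    (hv : ∀ q, ¬ C.S v q) (e : C.j u = C.j v) : u = v := by
  rcases lt_trichotomy (C.g u) (C.g v) with h | h | h
  · obtain ⟨q, hq⟩ := C.exists_succ e.symm h
    exact (hu q hq).elim
  · exact C.hj u v e h
  · obtain ⟨q, hq⟩ := C.exists_succ e h
    exact (hv q hq).elim

theorem ncard_le_of_inj {X : Type} [Finite X] {n : ℕ} (A : Set X) (j : X → Fin n)
    (h : ∀ u ∈ A, ∀ v ∈ A, j u = j v → u = v) : A.ncard ≤ n := by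
  have h1 := Set.ncard_le_ncard_of_injOn (s := A) (t := Set.univ) j (fun _ _ => trivial)
    (fun u hu v hv e => h u hu v hv e) Set.finite_univ
  simpa [Set.ncard_univ] using h1

theorem Conf.bad_card [Finite X] (C : Conf X n) (τ : X → ℚ) (T : C.Time τ)
    (hb : ∀ r q v w, C.S r q → C.S q v → C.S v w → τ q < τ v) :
    {v | ¬ C.good τ v}.ncard ≤ 4 * n := by
  let A1 : Set X := {v | ∀ q, ¬ C.S q v}
  let A2 : Set X := {v | ∃ q, C.S q v ∧ q ∈ A1}
  let B1 : Set X := {v | ∀ q, ¬ C.S v q}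
  let B2 : Set X := {v | ∃ q, C.S v q ∧ q ∈ B1}
  have hA1 : A1.ncard ≤ n := ncard_le_of_inj A1 C.j (fun u hu v hv e => C.first_unique hu hv e)
  have hB1 : B1.ncard ≤ n := ncard_le_of_inj B1 C.j (fun u hu v hv e => C.last_unique hu hv e)
  have hA2 : A2.ncard ≤ n := by
    refine ncard_le_of_inj A2 C.j ?_
    rintro u ⟨q, h1, h2⟩ v ⟨q', h3, h4⟩ e
    have := C.first_unique h2 h4 (by rw [h1.1, h3.1, e])
    subst this
    exact C.S_succ_unique h1 h3
  have hB2 : B2.ncard ≤ n := by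
    refine ncard_le_of_inj B2 C.j ?_
    rintro u ⟨q, h1, h2⟩ v ⟨q', h3, h4⟩ e
    have := C.last_unique h2 h4 (by rw [← h1.1, ← h3.1, e])
    subst this
    exact C.S_pred_unique h1 h3
  have hsub : {v | ¬ C.good τ v} ⊆ (A1 ∪ A2) ∪ (B1 ∪ B2) := by
    intro v hv
    by_contra hcon
    simp only [Set.mem_union, not_or] at hcon
    obtain ⟨⟨h1, h2⟩, h3, h4⟩ := hcon
    have h1' : ∃ q, C.S q v := by simpa [A1] using h1
    have h3' : ∃ q, C.S v q := by simpa [B1] using h3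
    obtain ⟨q, hq⟩ := h1'
    obtain ⟨w, hw⟩ := h3'
    have h2' : ∃ r, C.S r q := by
      by_contra h
      exact h2 ⟨q, hq, fun r hr => h ⟨r, hr⟩⟩
    have h4' : ∃ r, C.S w r := by
      by_contra h
      exact h4 ⟨w, hw, fun r hr => h ⟨r, hr⟩⟩
    obtain ⟨r, hr⟩ := h2'
    obtain ⟨s, hs⟩ := h4'
    exact hv ⟨q, w, hq, hw, hb r q v w hr hq hw, hb q v w s hq hw hs⟩
  have h1 := Set.ncard_le_ncard hsub (Set.toFinite _)
  have h2 := Set.ncard_union_le (A1 ∪ A2) (B1 ∪ B2)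
  have h3 := Set.ncard_union_le A1 A2
  have h4 := Set.ncard_union_le B1 B2
  omega

theorem count_windows [Fintype X] (τ : X → ℚ) (hτ : Function.Injective τ) (B : Set X)
    (h : ∀ v0 v1 v2, τ v0 < τ v1 → τ v1 < τ v2 → (∀ x, τ v0 < τ x → τ x < τ v1 → False) →
      (∀ x, τ v1 < τ x → τ x < τ v2 → False) → v0 ∈ B ∨ v1 ∈ B ∨ v2 ∈ B) :
    Fintype.card X ≤ 3 * B.ncard + 2 := by
  classical
  letI : LinearOrder X := LinearOrder.lift' τ hτ
  have hlt : ∀ x y : X, x < y ↔ τ x < τ y := fun x y => Iff.rfl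
  obtain ⟨N, hN⟩ : ∃ N, N = Fintype.card X := ⟨_, rfl⟩
  let e : Fin N ≃o X := Fintype.orderIsoFinOfCardEq X hN.symm
  have key : ∀ t : Fin (N / 3), ∃ x : X, x ∈ B ∧ (e.symm x).val / 3 = t.val := by
    intro t
    have ht := t.2
    have l0 : 3 * t.val < N := by omega
    have l1 : 3 * t.val + 1 < N := by omega
    have l2 : 3 * t.val + 2 < N := by omega
    have adj : ∀ (a : ℕ) (ha : a < N) (hb : a + 1 < N) (x : X), τ (e ⟨a, ha⟩) < τ x →
        τ x < τ (e ⟨a + 1, hb⟩) → False := by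
      intro a ha hb x h1 h2
      rw [← hlt] at h1 h2
      rw [← e.lt_symm_apply] at h1
      rw [← e.symm_apply_lt] at h2
      have h1' : a < (e.symm x).val := h1
      have h2' : (e.symm x).val < a + 1 := h2
      omega
    have := h (e ⟨3 * t.val, l0⟩) (e ⟨3 * t.val + 1, l1⟩) (e ⟨3 * t.val + 2, l2⟩)
      ((hlt _ _).1 (e.lt_iff_lt.2 (by simp [Fin.lt_def])))
      ((hlt _ _).1 (e.lt_iff_lt.2 (by simp [Fin.lt_def])))
      (adj _ l0 l1) (adj _ l1 l2)
    rcases this with h | h | h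
    · exact ⟨_, h, by simp⟩
    · exact ⟨_, h, by simp; omega⟩
    · exact ⟨_, h, by simp; omega⟩
  choose f hf using key
  have finj : Function.Injective f := by
    intro a b hab
    have h1 := (hf a).2
    have h2 := (hf b).2
    rw [hab] at h1
    exact Fin.ext (h1.symm.trans h2)
  have : N / 3 ≤ B.ncard := by
    have h1 : (Set.range f).ncard ≤ B.ncard :=
      Set.ncard_le_ncard (by rintro _ ⟨t, rfl⟩; exact (hf t).1) (Set.toFinite _)
    have h2 : (Set.range f).ncard = N / 3 := by
      rw [← Set.image_univ, Set.ncard_image_of_injective _ finj, Set.ncard_univ]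
      simp
    omega
  omega

theorem Conf.card_le [Fintype X] (C : Conf X n) (τ ρ : X → ℕ)
    (F0 : ∀ x u, C.i x = C.i u → C.g x < C.g u → τ x < τ u)
    (F1 : ∀ q v u, C.S q v → C.i q = C.i u → C.g q < C.g u → τ v < τ u)
    (H0 : ∀ x u, C.j x = C.j u → C.g x < C.g u → ρ x < ρ u)
    (H1 : ∀ q u v, C.R q u → C.j q = C.j v → C.g q < C.g v → ρ u < ρ v) :
    Fintype.card X ≤ 12 * n + 2 := by
  classical
  let N := Fintype.card X
  let e : X ≃ Fin N := Fintype.equivFin X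
  let σ : X → ℕ := fun x => N * τ x + (e x).val
  have hlt : ∀ x y, τ x < τ y → σ x < σ y := by
    intro x y h
    have h1 := (e x).2
    have h2 : N * (τ x + 1) ≤ N * τ y := Nat.mul_le_mul_left _ h
    simp only [σ]
    rw [Nat.mul_add] at h2
    omega
  have hinj : Function.Injective σ := by
    intro x y h
    rcases lt_trichotomy (τ x) (τ y) with h1 | h1 | h1
    · have := hlt x y h1; omega
    · simp only [σ, h1] at h
      exact e.injective (Fin.ext (by omega))
    · have := hlt y x h1; omega
  have T0 : C.Time (fun x => (σ x : ℚ)) :=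
    ⟨fun x y h => hinj (by exact_mod_cast h),
      fun x u h1 h2 => by exact_mod_cast hlt _ _ (F0 x u h1 h2),
      fun q v u h1 h2 h3 => by exact_mod_cast hlt _ _ (F1 q v u h1 h2 h3)⟩
  obtain ⟨τ', T, hb⟩ := C.exists_best _ T0
  have h1 := C.bad_card τ' T hb
  have h2 := count_windows τ' T.inj {v | ¬ C.good τ' v} (by
    intro v0 v1 v2 l1 l2 a1 a2
    by_contra hcon
    simp only [Set.mem_setOf_eq, not_or, not_not] at hcon
    exact C.window τ' T ρ H0 H1 v0 v1 v2 hcon.1 hcon.2.1 hcon.2.2 l1 l2 a1 a2)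
  omega

open Relation

theorem rank_exists {E : Type} [Finite E] (D : E → E → Prop) (h : ∀ z, ¬ TransGen D z z) :
    ∃ τ : E → ℕ, ∀ z z', D z z' → τ z' < τ z := by
  classical
  refine ⟨fun z => Set.ncard {w | TransGen D z w}, fun z z' hz => ?_⟩
  apply Set.ncard_lt_ncard _ (Set.toFinite _)
  constructor
  · intro w hw
    exact TransGen.head hz hw
  · intro hs
    exact h z' (hs (TransGen.single hz))

theorem perm_exists {E : Type} [Finite E] (D : E → E → Prop)
    (h : ∃ z, TransGen D z z) :
    ∃ c : Equiv.Perm E, (∃ z, D z (c z)) ∧ ∀ z, c z ≠ z → D z (c z) := by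
  classical
  obtain ⟨z0, hz0⟩ := h
  have key : ∀ z : {z // TransGen D z z}, ∃ w : {z // TransGen D z z}, D z.1 w.1 := by
    rintro ⟨z, hz⟩
    obtain ⟨b, hb, hbz⟩ := TransGen.head'_iff.1 hz
    exact ⟨⟨b, TransGen.tail' hbz hb⟩, hb⟩
  choose f hf using key
  -- periodic points
  have hb := Function.bijOn_periodicPts (f := f)
  obtain ⟨p, hp⟩ : (Function.periodicPts f).Nonempty := by
    have : ¬ Function.Injective (fun n : ℕ => f^[n] ⟨z0, hz0⟩) := not_injective_infinite_finite _
    simp only [Function.Injective, not_forall] at this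
    obtain ⟨a, b, hab, hne⟩ := this
    wlog hlt : a < b generalizing a b
    · exact this b a hab.symm (Ne.symm hne) (by omega)
    refine ⟨f^[a] ⟨z0, hz0⟩, b - a, by omega, ?_⟩
    change f^[b - a] (f^[a] ⟨z0, hz0⟩) = _
    rw [← Function.iterate_add_apply, Nat.sub_add_cancel hlt.le]
    exact hab.symm
  let g : E → E := fun z => if hz : TransGen D z z then
    (if (⟨z, hz⟩ : {z // TransGen D z z}) ∈ Function.periodicPts f then (f ⟨z, hz⟩).1 else z) else z
  have g1 : ∀ z : {z // TransGen D z z}, z ∈ Function.periodicPts f → g z.1 = (f z).1 := by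
    rintro ⟨z, hz⟩ hp
    simp [g, hz, hp]
  have g2 : ∀ z : E, (∃ hz : TransGen D z z, (⟨z, hz⟩ : {z // TransGen D z z}) ∈ Function.periodicPts f) ∨ g z = z := by
    intro z
    by_cases hz : TransGen D z z
    · by_cases hp : (⟨z, hz⟩ : {z // TransGen D z z}) ∈ Function.periodicPts f
      · exact Or.inl ⟨hz, hp⟩
      · right; simp [g, hp]
    · right; simp [g, hz]
  have ginj : Function.Injective g := by
    intro a b hab
    by_cases hA : ∃ hz : TransGen D a a, (⟨a, hz⟩ : {z // TransGen D z z}) ∈ Function.periodicPts f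
    · by_cases hB : ∃ hz : TransGen D b b, (⟨b, hz⟩ : {z // TransGen D z z}) ∈ Function.periodicPts f
      · obtain ⟨ha, hpa⟩ := hA
        obtain ⟨hb', hpb⟩ := hB
        have e1 := g1 _ hpa
        have e2 := g1 _ hpb
        have : f ⟨a, ha⟩ = f ⟨b, hb'⟩ := Subtype.ext (by rw [← e1, ← e2]; exact hab)
        exact congrArg Subtype.val (hb.injOn hpa hpb this)
      · obtain ⟨ha, hpa⟩ := hA
        have e1 := g1 _ hpa
        have e2 := (g2 b).resolve_left hB
        exfalso; apply hB
        have hm := hb.mapsTo hpa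
        have : (f ⟨a, ha⟩).1 = b := by rw [← e1, ← e2]; exact hab
        have h3 : f ⟨a, ha⟩ = ⟨b, this ▸ (f ⟨a, ha⟩).2⟩ := Subtype.ext this
        exact ⟨_, h3 ▸ hm⟩
    · by_cases hB : ∃ hz : TransGen D b b, (⟨b, hz⟩ : {z // TransGen D z z}) ∈ Function.periodicPts f
      · obtain ⟨ha, hpa⟩ := hB
        have e1 := g1 _ hpa
        have e2 := (g2 a).resolve_left hA
        exfalso; apply hA
        have hm := hb.mapsTo hpa
        have : (f ⟨b, ha⟩).1 = a := by rw [← e1, ← e2]; exact hab.symm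
        have h3 : f ⟨b, ha⟩ = ⟨a, this ▸ (f ⟨b, ha⟩).2⟩ := Subtype.ext this
        exact ⟨_, h3 ▸ hm⟩
      · rw [← (g2 a).resolve_left hA, ← (g2 b).resolve_left hB]; exact hab
  refine ⟨Equiv.ofBijective g (Finite.injective_iff_bijective.1 ginj), ⟨p.1, ?_⟩, ?_⟩
  · change D p.1 (g p.1)
    rw [g1 p hp]; exact hf p
  · intro z hz
    change g z ≠ z at hz
    change D z (g z)
    obtain ⟨h1, h2⟩ := (g2 z).resolve_right hz
    have := g1 _ h2
    rw [this]; exact hf ⟨z, h1⟩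

/-- The main walking lemma. -/
theorem walk {E : Type} (P Q : E → E → Prop) (A : E → Prop) (X : Set E) (τ : E → ℕ)
    (Pf : ∀ a b b', P a b → P a b' → b = b')
    (Qi : ∀ a a' b, Q a b → Q a' b → a = a')
    (PA : ∀ a b, P a b → A a)
    (T0 : ∀ y z, P y z → τ y < τ z)
    (T1 : ∀ y z w, P y z → Q y w → w ≠ z → τ w < τ z)
    (T2 : ∀ y w, ¬ A y → Q y w → τ w < τ y)
    (X1 : ∀ e ∈ X, ∀ f, ¬ (P f e ∧ Q f e))
    (X2 : ∀ e b, A e → Q e b → (∀ f, ¬ (P f e ∧ Q f e)) → e ∈ X)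
    (q v u : E) (hv : v ∈ X) (hu : u ∈ X) (hqv : TransGen Q q v)
    (hno : ∀ w ∈ X, TransGen Q q w → TransGen Q w v → False)
    (hqu : TransGen P q u) : τ v < τ u := by
  have T0' : ∀ a b, ReflTransGen P a b → τ a ≤ τ b := by
    intro a b h
    induction h with
    | refl => exact le_rfl
    | tail _ h ih => exact ih.trans (T0 _ _ h).le
  have S2 : ∀ c, ReflTransGen Q c v → τ c < τ u → TransGen Q q c →
      (∀ f, ¬ (P f c ∧ Q f c)) → τ v < τ u := by
    intro c hc
    induction hc using ReflTransGen.head_induction_on with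
    | refl => intro h _ _; exact h
    | head hcc hcv ih =>
      rename_i c c'
      intro h1 h2 h3
      by_cases hA : A c
      · exact (hno c (X2 c c' hA hcc h3) h2 (TransGen.head' hcc hcv)).elim
      · refine ih ((T2 _ _ hA hcc).trans h1) (h2.tail hcc) ?_
        rintro f ⟨f1, f2⟩
        have := Qi _ _ _ f2 hcc
        subst this
        exact hA (PA _ _ f1)
  have S1 : ∀ b, TransGen Q b v → ReflTransGen Q q b → TransGen P b u → τ v < τ u := by
    intro b hb
    induction hb using TransGen.head_induction_on with
    | single hbv =>
      rename_i b
      intro _ h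
      obtain ⟨z, hz, hzu⟩ := TransGen.head'_iff.1 h
      have : v ≠ z := by
        rintro rfl; exact X1 _ hv _ ⟨hz, hbv⟩
      exact (T1 _ _ _ hz hbv this).trans_le (T0' _ _ hzu)
    | head hbc hcv ih =>
      rename_i b c
      intro hqb h
      obtain ⟨z, hz, hzu⟩ := TransGen.head'_iff.1 h
      by_cases hcz : c = z
      · subst hcz
        apply ih (hqb.tail hbc)
        rcases reflTransGen_iff_eq_or_transGen.1 hzu with h | h
        · subst h; exact (X1 _ hu _ ⟨hz, hbc⟩).elim
        · exact h
      · refine S2 c hcv.to_reflTransGen ((T1 _ _ _ hz hbc hcz).trans_le (T0' _ _ hzu)) (TransGen.tail' hqb hbc) ?_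
        rintro f ⟨f1, f2⟩
        have := Qi _ _ _ f2 hbc
        subst this
        exact hcz (Pf _ _ _ f1 hz)
  exact S1 q hqv ReflTransGen.refl hqu

/-- next-edge relation of a permutation -/
def Nx {E : Type} {c : ℕ} (σ : Equiv.Perm (E ⊕ Fin c)) (a b : E) : Prop :=
  σ (Sum.inl a) = Sum.inl b ∧ a ≠ b

/-- active edges -/
def Act {E : Type} {c : ℕ} (σ : Equiv.Perm (E ⊕ Fin c)) (a : E) : Prop :=
  σ (Sum.inl a) ≠ Sum.inl a

/-- A permutation coding a path system. -/
structure Valid {E V : Type} {c : ℕ} (src dst : E → V) (u v : V)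
    (σ : Equiv.Perm (E ⊕ Fin c)) : Prop where
  ee : ∀ a b, σ (Sum.inl a) = Sum.inl b → a ≠ b → dst a = src b
  ek : ∀ a k, σ (Sum.inl a) = Sum.inr k → dst a = v
  ke : ∀ k a, σ (Sum.inr k) = Sum.inl a → src a = u
  kk : ∀ k k', σ (Sum.inr k) ≠ Sum.inr k'

theorem Nx.fn {E : Type} {c : ℕ} {σ : Equiv.Perm (E ⊕ Fin c)} {a b b' : E}
    (h : Nx σ a b) (h' : Nx σ a b') : b = b' := by
  have := h.1.symm.trans h'.1
  exact Sum.inl.inj this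

theorem Nx.inj {E : Type} {c : ℕ} {σ : Equiv.Perm (E ⊕ Fin c)} {a a' b : E}
    (h : Nx σ a b) (h' : Nx σ a' b) : a = a' := by
  have := h.1.trans h'.1.symm
  exact Sum.inl.inj (σ.injective this)

theorem Nx.actl {E : Type} {c : ℕ} {σ : Equiv.Perm (E ⊕ Fin c)} {a b : E}
    (h : Nx σ a b) : Act σ a := by
  intro h'
  exact h.2 (Sum.inl.inj (h'.symm.trans h.1))

theorem Nx.actr {E : Type} {c : ℕ} {σ : Equiv.Perm (E ⊕ Fin c)} {a b : E}
    (h : Nx σ a b) : Act σ b := by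
  intro h'
  exact h.2 (Sum.inl.inj (σ.injective (h.1.trans h'.symm)))

/-- One exchange step: existence of the rank function for a minimal pair. -/
theorem exchange {E V : Type} [Finite E] {c d : ℕ} {src dst : E → V} {u v u' v' : V}
    (r : E → ℕ) (hr : ∀ a b, dst a = src b → r a < r b)
    (σ : Equiv.Perm (E ⊕ Fin c)) (σ' : Equiv.Perm (E ⊕ Fin d))
    (hσ : Valid src dst u v σ) (hσ' : Valid src dst u' v' σ')
    (hmin : ∀ s : Equiv.Perm (E ⊕ Fin c), Valid src dst u v s →
      Set.ncard {p : E × E | Nx σ p.1 p.2 ∨ Nx σ' p.1 p.2} ≤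
      Set.ncard {p : E × E | Nx s p.1 p.2 ∨ Nx σ' p.1 p.2}) :
    ∃ τ : E → ℕ, (∀ y z, Nx σ y z → τ y < τ z) ∧
      (∀ y z w, Nx σ y z → Nx σ' y w → w ≠ z → τ w < τ z) ∧
      (∀ y w, ¬ Act σ y → Nx σ' y w → τ w < τ y) := by
  classical
  let D : E → E → Prop := fun z z' =>
    ∃ y, σ (Sum.inl y) = Sum.inl z ∧ z ≠ z' ∧ (z' = y ∨ Nx σ' y z')
  have hD : ∀ z, ¬ TransGen D z z := by
    intro z0 hz0
    obtain ⟨c, ⟨z1, hz1⟩, hc⟩ := perm_exists D ⟨z0, hz0⟩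
    let s : Equiv.Perm (E ⊕ Fin _) := (Equiv.sumCongr c 1) * σ
    have s1 : ∀ x e, σ x = Sum.inl e → s x = Sum.inl (c e) := by
      intro x e h
      simp [s, Equiv.Perm.mul_apply, h]
    have s2 : ∀ x k, σ x = Sum.inr k → s x = Sum.inr k := by
      intro x e h
      simp [s, Equiv.Perm.mul_apply, h]
    have hmv : ∀ y z, σ (Sum.inl y) = Sum.inl z → c z ≠ z → (c z = y ∨ Nx σ' y (c z)) := by
      intro y z h1 h2
      obtain ⟨y', hy', _, h3⟩ := hc z h2
      have : y' = y := Sum.inl.inj (σ.injective (hy'.trans h1.symm))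
      subst this
      exact h3
    have hA : ∀ a b, Nx s a b → Nx σ a b ∨ Nx σ' a b := by
      rintro a b ⟨h1, h2⟩
      rcases h : σ (Sum.inl a) with z | k
      · have h3 := s1 _ _ h
        have h4 : c z = b := Sum.inl.inj (h3.symm.trans h1)
        by_cases hcz : c z = z
        · left
          refine ⟨?_, h2⟩
          rw [h, ← hcz, h4]
        · rcases hmv a z h hcz with h5 | h5
          · exact (h2 (h5.symm.trans h4)).elim
          · right; rw [← h4]; exact h5
      · have h3 := s2 _ _ h
        rw [h3] at h1; cases h1
    have hs : Valid src dst u v s := by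
      constructor
      · intro a b h1 h2
        rcases hA a b ⟨h1, h2⟩ with h | h
        · exact hσ.ee _ _ h.1 h.2
        · exact hσ'.ee _ _ h.1 h.2
      · intro a k h1
        rcases h : σ (Sum.inl a) with z | k'
        · rw [s1 _ _ h] at h1; cases h1
        · exact hσ.ek _ _ h
      · intro k a h1
        rcases h : σ (Sum.inr k) with z | k'
        · have h3 := s1 _ _ h
          have h4 : c z = a := Sum.inl.inj (h3.symm.trans h1)
          by_cases hcz : c z = z
          · apply hσ.ke k; rw [h, ← hcz, h4]
          · obtain ⟨y, hy, _⟩ := hc z hcz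
            have := σ.injective (hy.trans h.symm)
            cases this
        · exact (hσ.kk _ _ h).elim
      · intro k k' h1
        rcases h : σ (Sum.inr k) with z | k''
        · rw [s1 _ _ h] at h1; cases h1
        · exact (hσ.kk _ _ h).elim
    have hge := hmin s hs
    have hsub : {p : E × E | Nx s p.1 p.2 ∨ Nx σ' p.1 p.2} ⊆
        {p : E × E | Nx σ p.1 p.2 ∨ Nx σ' p.1 p.2} := by
      rintro ⟨a, b⟩ (h | h)
      · exact hA _ _ h
      · exact Or.inr h
    have heq := Set.eq_of_subset_of_ncard_le hsub hge (Set.toFinite _)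
    -- every moved z with predecessor y is either fixed or shared
    have hsh : ∀ y z, Nx σ y z → c z ≠ z → Nx σ' y z := by
      intro y z h1 h2
      have : (y, z) ∈ {p : E × E | Nx s p.1 p.2 ∨ Nx σ' p.1 p.2} := by
        rw [heq]; exact Or.inl h1
      rcases this with h | h
      · have h3 := s1 _ _ h1.1
        have h4 := h.1.symm.trans h3
        exact (h2 (Sum.inl.inj h4).symm).elim
      · exact h
    have noshared : ∀ m z, r z = m → ∀ y, Nx σ y z → c z = z := by
      intro m
      induction m using Nat.strong_induction_on with
      | _ m ih =>
        intro z hz y hyz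
        by_contra hcz
        have h1 := hsh y z hyz hcz
        have h2 : c z = y := by
          rcases hmv y z hyz.1 hcz with h | h
          · exact h
          · exact (hcz (Nx.fn h h1)).elim
        have hry : r y < m := hz ▸ hr _ _ (hσ.ee _ _ hyz.1 hyz.2)
        have hcy : c y ≠ y := by
          intro h
          rw [← h2] at h
          exact hcz (c.injective h)
        obtain ⟨x, hx, _⟩ := hc y hcy
        have hxy : x ≠ y := by
          rintro rfl
          exact hyz.2 (Sum.inl.inj (hx.symm.trans hyz.1))
        exact hcy (ih _ hry y rfl x ⟨hx, hxy⟩)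
    have hm1 : z1 ∈ {z | c z ≠ z} := by
      obtain ⟨_, _, h, _⟩ := hz1
      exact Ne.symm h
    obtain ⟨z, hz, hmax⟩ := Set.exists_max_image {z | c z ≠ z} r (Set.toFinite _) ⟨z1, hm1⟩
    obtain ⟨y, hy, _⟩ := hc z hz
    have hyz : y = z := by
      by_contra hne
      exact hz (noshared _ z rfl y ⟨hy, hne⟩)
    subst hyz
    have h1 : Nx σ' y (c y) := (hmv y y hy hz).resolve_left hz
    have h2 := hr _ _ (hσ'.ee _ _ h1.1 h1.2)
    have h3 := hmax (c y) (fun h => hz (c.injective h))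
    omega
  obtain ⟨τ, hτ⟩ := rank_exists D hD
  refine ⟨τ, ?_, ?_, ?_⟩
  · intro y z h
    exact hτ z y ⟨y, h.1, Ne.symm h.2, Or.inl rfl⟩
  · intro y z w h1 h2 h3
    exact hτ z w ⟨y, h1.1, Ne.symm h3, Or.inr h2⟩
  · intro y w h1 h2
    exact hτ y w ⟨y, not_not.1 h1, h2.2, Or.inr h2⟩


theorem decode_tail {E : Type} [Finite E] {V : Type} {c : ℕ} {src dst : E → V} {u v : V}
    (r : E → ℕ) (hr : ∀ a b, dst a = src b → r a < r b)
    (σ : Equiv.Perm (E ⊕ Fin c)) (hσ : Valid src dst u v σ) (e : E) (he : Act σ e) :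
    ∃ p : List E, List.IsChain (Nx σ) (e :: p) ∧
      ∀ x ∈ (e :: p).getLast?, ∃ k, σ (Sum.inl x) = Sum.inr k := by
  obtain ⟨M, hM⟩ : ∃ M, ∀ e, r e ≤ M := by
    obtain ⟨M, hM⟩ := (Set.finite_range r).bddAbove
    exact ⟨M, fun e => hM ⟨e, rfl⟩⟩
  have key : ∀ m e, M - r e = m → Act σ e → ∃ p : List E, List.IsChain (Nx σ) (e :: p) ∧
      ∀ x ∈ (e :: p).getLast?, ∃ k, σ (Sum.inl x) = Sum.inr k := by
    intro m
    induction m using Nat.strong_induction_on with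
    | _ m ih =>
      intro e hm ha
      rcases h : σ (Sum.inl e) with z | k
      · have hne : e ≠ z := by
          rintro rfl; exact ha h
        have hN : Nx σ e z := ⟨h, hne⟩
        have h1 := hr _ _ (hσ.ee _ _ h hne)
        have h2 := hM z
        obtain ⟨p, hp, hl⟩ := ih (M - r z) (by omega) z rfl hN.actr
        exact ⟨z :: p, List.isChain_cons_cons.2 ⟨hN, hp⟩, by simpa using hl⟩
      · exact ⟨[], by simp, by simp [h]⟩
  exact key _ e rfl he

theorem decode {E : Type} [Finite E] {V : Type} {c : ℕ} {src dst : E → V} {u v : V}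
    (r : E → ℕ) (hr : ∀ a b, dst a = src b → r a < r b)
    (σ : Equiv.Perm (E ⊕ Fin c)) (hσ : Valid src dst u v σ) :
    ∃ α : Fin c → List E, (∀ k, α k ≠ [] ∧ List.IsChain (Nx σ) (α k) ∧
      (∀ e ∈ (α k).head?, σ (Sum.inr k) = Sum.inl e) ∧
      ∀ x ∈ (α k).getLast?, ∃ k', σ (Sum.inl x) = Sum.inr k') := by
  have : ∀ k : Fin c, ∃ p : List E, p ≠ [] ∧ List.IsChain (Nx σ) p ∧
      (∀ e ∈ p.head?, σ (Sum.inr k) = Sum.inl e) ∧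
      ∀ x ∈ p.getLast?, ∃ k', σ (Sum.inl x) = Sum.inr k' := by
    intro k
    rcases h : σ (Sum.inr k) with z | k'
    · have ha : Act σ z := by
        intro h'
        have := σ.injective (h'.trans h.symm)
        cases this
      obtain ⟨p, hp, hl⟩ := decode_tail r hr σ hσ z ha
      exact ⟨z :: p, by simp, hp, by simp, hl⟩
    · exact (hσ.kk _ _ h).elim
  choose α hα using this
  exact ⟨α, hα⟩

/-- in a chain, each member is the head or has a predecessor -/
theorem chain_pred {E : Type} {R : E → E → Prop} : ∀ (p : List E), List.IsChain R p → ∀ e ∈ p,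
    e ∈ p.head? ∨ ∃ f ∈ p, R f e
  | [], _, e, he => by simp at he
  | [a], _, e, he => by simp at he; simp [he]
  | a :: b :: p, h, e, he => by
    rw [List.isChain_cons_cons] at h
    rcases List.mem_cons.1 he with rfl | he
    · simp
    · rcases chain_pred (b :: p) h.2 e he with h1 | ⟨f, hf, h1⟩
      · simp at h1; subst h1
        right; exact ⟨a, by simp, h.1⟩
      · right; exact ⟨f, List.mem_cons_of_mem _ hf, h1⟩

theorem chain_succ {E : Type} {R : E → E → Prop} : ∀ (p : List E), List.IsChain R p → ∀ e ∈ p,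
    e ∈ p.getLast? ∨ ∃ f ∈ p, R e f
  | [], _, e, he => by simp at he
  | [a], _, e, he => by simp at he; simp [he]
  | a :: b :: p, h, e, he => by
    rw [List.isChain_cons_cons] at h
    rcases List.mem_cons.1 he with rfl | he
    · right; exact ⟨b, by simp, h.1⟩
    · rcases chain_succ (b :: p) h.2 e he with h1 | ⟨f, hf, h1⟩
      · left; simpa using h1
      · right; exact ⟨f, List.mem_cons_of_mem _ hf, h1⟩

structure Dec {E : Type} {c : ℕ} (σ : Equiv.Perm (E ⊕ Fin c)) (α : Fin c → List E) : Prop where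
  ne : ∀ k, α k ≠ []
  ch : ∀ k, List.IsChain (Nx σ) (α k)
  hd : ∀ k, ∀ e ∈ (α k).head?, σ (Sum.inr k) = Sum.inl e
  la : ∀ k, ∀ x ∈ (α k).getLast?, ∃ k', σ (Sum.inl x) = Sum.inr k'
  act : ∀ k, ∀ e ∈ α k, Act σ e
  cov : ∀ e, Act σ e → ∃ k, e ∈ α k
  dis : ∀ e k k', e ∈ α k → e ∈ α k' → k = k'
  cmp : ∀ k a b, a ∈ α k → b ∈ α k → a = b ∨ TransGen (Nx σ) a b ∨ TransGen (Nx σ) b a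
  cl : ∀ k a b, a ∈ α k → Nx σ a b → b ∈ α k

theorem decode' {E : Type} [Finite E] {V : Type} {c : ℕ} {src dst : E → V} {u v : V}
    (r : E → ℕ) (hr : ∀ a b, dst a = src b → r a < r b)
    (σ : Equiv.Perm (E ⊕ Fin c)) (hσ : Valid src dst u v σ) :
    ∃ α : Fin c → List E, Dec σ α := by
  obtain ⟨α, hα⟩ := decode r hr σ hσ
  have cl : ∀ k a b, a ∈ α k → Nx σ a b → b ∈ α k := by
    intro k a b ha hab
    rcases chain_succ _ (hα k).2.1 a ha with h | ⟨f, hf, h⟩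
    · obtain ⟨k', hk'⟩ := (hα k).2.2.2 a h
      have := hk'.symm.trans hab.1
      cases this
    · rw [hab.fn h]; exact hf
  have rN : ∀ a b, Nx σ a b → r a < r b := fun a b h => hr _ _ (hσ.ee _ _ h.1 h.2)
  refine ⟨α, fun k => (hα k).1, fun k => (hα k).2.1, fun k => (hα k).2.2.1,
    fun k => (hα k).2.2.2, ?_, ?_, ?_, ?_, cl⟩
  · intro k e he
    rcases chain_succ _ (hα k).2.1 e he with h | ⟨f, _, h⟩
    · obtain ⟨k', hk'⟩ := (hα k).2.2.2 e h
      intro h'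
      have := hk'.symm.trans h'
      cases this
    · exact h.actl
  · have key : ∀ m e, r e = m → Act σ e → ∃ k, e ∈ α k := by
      intro m
      induction m using Nat.strong_induction_on with
      | _ m ih =>
        intro e hm he
        rcases h : σ.symm (Sum.inl e) with f | k
        · have h1 : σ (Sum.inl f) = Sum.inl e := by rw [← h]; simp
          have hN : Nx σ f e := ⟨h1, by rintro rfl; exact he h1⟩
          obtain ⟨k, hk⟩ := ih (r f) (hm ▸ rN _ _ hN) f rfl hN.actl
          exact ⟨k, cl k f e hk hN⟩
        · have h1 : σ (Sum.inr k) = Sum.inl e := by rw [← h]; simp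
          refine ⟨k, ?_⟩
          obtain ⟨x, p, hp⟩ := List.exists_cons_of_ne_nil (hα k).1
          have h2 := (hα k).2.2.1 x (by simp [hp])
          have : x = e := Sum.inl.inj (h2.symm.trans h1)
          simp [hp, this]
    exact fun e => key _ e rfl
  · have key : ∀ m e, r e = m → ∀ k k', e ∈ α k → e ∈ α k' → k = k' := by
      intro m
      induction m using Nat.strong_induction_on with
      | _ m ih =>
        intro e hm k k' hk hk'
        rcases chain_pred _ (hα k).2.1 e hk with h | ⟨f, hf, h⟩ <;>
        rcases chain_pred _ (hα k').2.1 e hk' with h' | ⟨f', hf', h'⟩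
        · have h1 := (hα k).2.2.1 e h
          have h2 := (hα k').2.2.1 e h'
          exact Sum.inr.inj (σ.injective (h1.trans h2.symm))
        · have h1 := (hα k).2.2.1 e h
          have := σ.injective (h1.trans h'.1.symm)
          cases this
        · have h1 := (hα k').2.2.1 e h'
          have := σ.injective (h1.trans h.1.symm)
          cases this
        · have := h.inj h'
          subst this
          exact ih (r f) (hm ▸ rN _ _ h) f rfl k k' hf hf'
    exact fun e => key _ e rfl
  · intro k a b ha hb
    have h1 : List.IsChain (TransGen (Nx σ)) (α k) :=
      (hα k).2.1.imp (fun a b h => TransGen.single h)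
    have h2 := List.isChain_iff_pairwise.1 h1
    haveI : Std.Symm (fun a b : E => a = b ∨ TransGen (Nx σ) a b ∨ TransGen (Nx σ) b a) :=
      ⟨fun a b h => by
        rcases h with h | h | h
        · exact Or.inl h.symm
        · exact Or.inr (Or.inr h)
        · exact Or.inr (Or.inl h)⟩
    exact List.Pairwise.forall_of_forall
      (R := fun a b => a = b ∨ TransGen (Nx σ) a b ∨ TransGen (Nx σ) b a)
      (fun x _ => Or.inl rfl) (h2.imp fun h => Or.inr (Or.inl h)) ha hb

theorem infix_of_chain {E : Type} {R : E → E → Prop} {p : List E} (h : List.IsChain R p)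
    {f e : E} (hi : [f, e] <:+: p) : R f e := by
  have := h.infix hi
  simpa using this

theorem encode {E : Type} [Finite E] {V : Type} {c : ℕ} {src dst : E → V} {u v : V}
    (r : E → ℕ) (hr : ∀ a b, dst a = src b → r a < r b) (α : Fin c → List E)
    (hne : ∀ k, α k ≠ []) (hch : ∀ k, List.IsChain (fun e f => dst e = src f) (α k))
    (hhd : ∀ k, ∀ e ∈ (α k).head?, src e = u) (hla : ∀ k, ∀ e ∈ (α k).getLast?, dst e = v)
    (hdis : ∀ i j, i ≠ j → ∀ e, e ∈ α i → e ∉ α j) :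
    ∃ σ : Equiv.Perm (E ⊕ Fin c), Valid src dst u v σ := by
  classical
  have hnd : ∀ k, (α k).Nodup := by
    intro k
    have h1 : List.IsChain (fun a b => r a < r b) (α k) := (hch k).imp (fun a b h => hr a b h)
    haveI : Trans (fun a b => r a < r b) (fun a b => r a < r b) (fun a b : E => r a < r b) :=
      ⟨fun h h' => lt_trans h h'⟩
    have h2 := List.isChain_iff_pairwise.1 h1
    refine h2.imp ?_
    rintro a b h rfl
    exact lt_irrefl _ h
  let L : Fin c → List (E ⊕ Fin c) := fun k => Sum.inr k :: (α k).map Sum.inl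
  have Lnd : ∀ k, (L k).Nodup := by
    intro k
    simp only [L, List.nodup_cons]
    refine ⟨by simp, (hnd k).map Sum.inl_injective⟩
  have Ldis : ∀ y k k', y ∈ L k → y ∈ L k' → k = k' := by
    intro y k k' h h'
    by_contra hkk
    rcases y with e | j
    · simp [L] at h h'
      exact hdis k k' hkk e h h'
    · simp [L] at h h'
      exact hkk (h.symm.trans h')
  let f : E ⊕ Fin c → E ⊕ Fin c := fun y =>
    if h : ∃ k, y ∈ L k then (L h.choose).formPerm y else y
  have f1 : ∀ y k, y ∈ L k → f y = (L k).formPerm y := by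
    intro y k hk
    have h : ∃ k, y ∈ L k := ⟨k, hk⟩
    have : h.choose = k := Ldis y _ _ h.choose_spec hk
    simp only [f, dif_pos h, this]
  have f2 : ∀ y, (¬ ∃ k, y ∈ L k) → f y = y := by
    intro y h
    simp only [f, dif_neg h]
  have f3 : ∀ y k, y ∈ L k → f y ∈ L k := by
    intro y k hk
    rw [f1 y k hk]
    exact List.formPerm_apply_mem_of_mem hk
  have finj : Function.Injective f := by
    intro a b hab
    by_cases hA : ∃ k, a ∈ L k
    · obtain ⟨k, hk⟩ := hA
      by_cases hB : ∃ k, b ∈ L k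
      · obtain ⟨k', hk'⟩ := hB
        have : k = k' := Ldis (f a) k k' (f3 a k hk) (hab ▸ f3 b k' hk')
        subst this
        rw [f1 a k hk, f1 b k hk'] at hab
        exact Equiv.injective _ hab
      · exfalso; apply hB
        rw [f2 b hB] at hab
        exact ⟨k, hab ▸ f3 a k hk⟩
    · by_cases hB : ∃ k, b ∈ L k
      · obtain ⟨k, hk⟩ := hB
        exfalso; apply hA
        rw [f2 a hA] at hab
        exact ⟨k, hab ▸ f3 b k hk⟩
      · rwa [f2 a hA, f2 b hB] at hab
  have fhd : ∀ k, ∃ e ∈ (α k).head?, f (Sum.inr k) = Sum.inl e := by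
    intro k
    obtain ⟨x, p, hp⟩ := List.exists_cons_of_ne_nil (hne k)
    refine ⟨x, by simp [hp], ?_⟩
    rw [f1 _ k (by simp [L])]
    have hl : L k = Sum.inr k :: Sum.inl x :: p.map Sum.inl := by simp [L, hp]
    have := List.formPerm_apply_getElem (L k) (Lnd k) 0 (by simp [L])
    simpa [hl] using this
  have fel : ∀ k, ∀ e ∈ α k, (∃ e', dst e = src e' ∧ f (Sum.inl e) = Sum.inl e') ∨
      (dst e = v ∧ f (Sum.inl e) = Sum.inr k) := by
    intro k e he
    obtain ⟨i, hi, rfl⟩ := List.getElem_of_mem he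
    rw [f1 _ k (by simp [L])]
    have h0 := List.formPerm_apply_getElem (L k) (Lnd k) (i + 1) (by simp [L]; omega)
    have h1 : (L k)[i + 1]'(by simp [L]; omega) = Sum.inl ((α k)[i]) := by simp [L]
    rw [h1] at h0
    have hlen : (L k).length = (α k).length + 1 := by simp [L]
    by_cases hlast : i + 1 < (α k).length
    · left
      refine ⟨(α k)[i + 1], List.isChain_iff_getElem.1 (hch k) i hlast, ?_⟩
      rw [h0]
      have : (i + 1 + 1) % (L k).length = i + 1 + 1 := Nat.mod_eq_of_lt (by omega)
      simp only [this]
      simp [L]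
    · right
      have hi' : i + 1 = (α k).length := by omega
      constructor
      · apply hla k
        rw [List.getLast?_eq_getElem?]
        have : (α k).length - 1 = i := by omega
        simp [this]
      · rw [h0]
        have : (i + 1 + 1) % (L k).length = 0 := by
          rw [hlen, ← hi', Nat.mod_self]
        simp only [this]
        simp [L]
  have fno : ∀ e, (∃ k, e ∈ α k) ∨ f (Sum.inl e) = Sum.inl e := by
    intro e
    by_cases h : ∃ k, e ∈ α k
    · exact Or.inl h
    · right; apply f2
      simpa [L] using h
  refine ⟨Equiv.ofBijective f (Finite.injective_iff_bijective.1 finj), ?_, ?_, ?_, ?_⟩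
  · intro a b h hab
    change f _ = _ at h
    rcases fno a with ⟨k, hk⟩ | h'
    · rcases fel k a hk with ⟨e', h1, h2⟩ | ⟨h1, h2⟩
      · rw [h1, Sum.inl.inj (h2.symm.trans h)]
      · cases h2.symm.trans h
    · exact (hab (Sum.inl.inj (h'.symm.trans h))).elim
  · intro a k h
    change f _ = _ at h
    rcases fno a with ⟨k, hk⟩ | h'
    · rcases fel k a hk with ⟨e', h1, h2⟩ | ⟨h1, h2⟩
      · cases h2.symm.trans h
      · exact h1
    · cases h'.symm.trans h
  · intro k a h
    change f _ = _ at h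
    obtain ⟨e, he, h1⟩ := fhd k
    rw [← Sum.inl.inj (h1.symm.trans h)]
    exact hhd k e he
  · intro k k' h
    change f _ = _ at h
    obtain ⟨e, he, h1⟩ := fhd k
    cases h1.symm.trans h

/-- Abstract core: minimal pair of path systems has few mergings. -/
theorem core {E V : Type} [Finite E] {n : ℕ} (hn : 0 < n) {src dst : E → V} {u v u' v' : V}
    (r : E → ℕ) (hr : ∀ a b, dst a = src b → r a < r b)
    (h1 : ∃ σ : Equiv.Perm (E ⊕ Fin 3), Valid src dst u v σ)
    (h2 : ∃ σ : Equiv.Perm (E ⊕ Fin n), Valid src dst u' v' σ) :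
    ∃ (σ : Equiv.Perm (E ⊕ Fin 3)) (σ' : Equiv.Perm (E ⊕ Fin n)),
      Valid src dst u v σ ∧ Valid src dst u' v' σ' ∧
      Set.ncard {e | Act σ e ∧ Act σ' e ∧ ∀ f, ¬ (Nx σ f e ∧ Nx σ' f e)} ≤ 12 * n + 2 := by
  classical
  let P : Equiv.Perm (E ⊕ Fin 3) × Equiv.Perm (E ⊕ Fin n) → Prop := fun s =>
    Valid src dst u v s.1 ∧ Valid src dst u' v' s.2
  obtain ⟨σ0, hσ0⟩ := h1
  obtain ⟨σ1, hσ1⟩ := h2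
  obtain ⟨⟨σ, σ'⟩, ⟨hσ, hσ'⟩, hmin⟩ := Set.exists_min_image {s | P s}
    (fun s => Set.ncard {p : E × E | Nx s.1 p.1 p.2 ∨ Nx s.2 p.1 p.2}) (Set.toFinite _)
    ⟨(σ0, σ1), hσ0, hσ1⟩
  refine ⟨σ, σ', hσ, hσ', ?_⟩
  obtain ⟨τ, t0, t1, t2⟩ := exchange r hr σ σ' hσ hσ' (fun s hs => hmin (s, σ') ⟨hs, hσ'⟩)
  obtain ⟨ρ, p0, p1, p2⟩ := exchange r hr σ' σ hσ' hσ (fun s hs => by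
    have := hmin (σ, s) ⟨hσ, hs⟩
    simp only [or_comm (a := Nx σ _ _)] at this
    exact this)
  obtain ⟨α, dα⟩ := decode' r hr σ hσ
  obtain ⟨β, dβ⟩ := decode' r hr σ' hσ'
  set X : Set E := {e | Act σ e ∧ Act σ' e ∧ ∀ f, ¬ (Nx σ f e ∧ Nx σ' f e)} with hX
  have rN : ∀ a b, TransGen (Nx σ) a b → r a < r b := by
    intro a b h
    induction h with
    | single h => exact hr _ _ (hσ.ee _ _ h.1 h.2)
    | tail _ h ih => exact ih.trans (hr _ _ (hσ.ee _ _ h.1 h.2))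
  have rN' : ∀ a b, TransGen (Nx σ') a b → r a < r b := by
    intro a b h
    induction h with
    | single h => exact hr _ _ (hσ'.ee _ _ h.1 h.2)
    | tail _ h ih => exact ih.trans (hr _ _ (hσ'.ee _ _ h.1 h.2))
  have cl : ∀ k a b, a ∈ α k → TransGen (Nx σ) a b → b ∈ α k := by
    intro k a b ha h
    induction h with
    | single h => exact dα.cl _ _ _ ha h
    | tail _ h ih => exact dα.cl _ _ _ ih h
  have cl' : ∀ k a b, a ∈ β k → TransGen (Nx σ') a b → b ∈ β k := by
    intro k a b ha h
    induction h with
    | single h => exact dβ.cl _ _ _ ha h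
    | tail _ h ih => exact dβ.cl _ _ _ ih h
  have hI : ∀ x : X, ∃ k, x.1 ∈ α k := fun x => dα.cov _ x.2.1
  have hJ : ∀ x : X, ∃ k, x.1 ∈ β k := fun x => dβ.cov _ x.2.2.1
  choose I hI using hI
  choose J hJ using hJ
  have cI : ∀ x y : X, I x = I y → r x.1 < r y.1 → TransGen (Nx σ) x.1 y.1 := by
    intro x y h hlt
    rcases dα.cmp (I x) x.1 y.1 (hI x) (h ▸ hI y) with h1 | h1 | h1
    · rw [h1] at hlt; omega
    · exact h1
    · have := rN _ _ h1; omega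
  have cJ : ∀ x y : X, J x = J y → r x.1 < r y.1 → TransGen (Nx σ') x.1 y.1 := by
    intro x y h hlt
    rcases dβ.cmp (J x) x.1 y.1 (hJ x) (h ▸ hJ y) with h1 | h1 | h1
    · rw [h1] at hlt; omega
    · exact h1
    · have := rN' _ _ h1; omega
  let C : Conf X n :=
    { i := I
      j := J
      g := fun x => r x.1
      hi := by
        intro x y h hg
        rcases dα.cmp (I x) x.1 y.1 (hI x) (h ▸ hI y) with h1 | h1 | h1
        · exact Subtype.ext h1
        · have := rN _ _ h1; omega
        · have := rN _ _ h1; omega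
      hj := by
        intro x y h hg
        rcases dβ.cmp (J x) x.1 y.1 (hJ x) (h ▸ hJ y) with h1 | h1 | h1
        · exact Subtype.ext h1
        · have := rN' _ _ h1; omega
        · have := rN' _ _ h1; omega }
  haveI : Fintype X := Fintype.ofFinite _
  have hcard := C.card_le (fun x => τ x.1) (fun x => ρ x.1) ?_ ?_ ?_ ?_
  · rw [← Nat.card_coe_set_eq, Nat.card_eq_fintype_card]; exact hcard
  · intro x u h hg
    have h1 := cI x u h hg
    have : ∀ a b, TransGen (Nx σ) a b → τ a < τ b := by
      intro a b h
      induction h with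
      | single h => exact t0 _ _ h
      | tail _ h ih => exact ih.trans (t0 _ _ h)
    exact this _ _ h1
  · rintro q v u ⟨hj, hg, hno⟩ hi hg'
    refine walk (Nx σ) (Nx σ') (Act σ) X τ (fun a b b' h h' => h.fn h') (fun a a' b h h' => h.inj h')
      (fun a b h => h.actl) t0 t1 t2 (fun e he => he.2.2) (fun e b h1 h2 h3 => ⟨h1, h2.actl, h3⟩)
      q.1 v.1 u.1 v.2 u.2 (cJ _ _ hj hg) ?_ (cI _ _ hi hg')
    intro w hw hqw hwv
    refine hno ⟨w, hw⟩ ?_ (rN' _ _ hqw) (rN' _ _ hwv)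
    exact dβ.dis w _ _ (hJ ⟨w, hw⟩) (cl' _ _ _ (hJ q) hqw)
  · intro x u h hg
    have h1 := cJ x u h hg
    have : ∀ a b, TransGen (Nx σ') a b → ρ a < ρ b := by
      intro a b h
      induction h with
      | single h => exact p0 _ _ h
      | tail _ h ih => exact ih.trans (p0 _ _ h)
    exact this _ _ h1
  · rintro q v u ⟨hj, hg, hno⟩ hi hg'
    refine walk (Nx σ') (Nx σ) (Act σ') X ρ (fun a b b' h h' => h.fn h') (fun a a' b h h' => h.inj h')
      (fun a b h => h.actl) p0 p1 p2 (fun e he f hf => he.2.2 f ⟨hf.2, hf.1⟩)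
      (fun e b h1 h2 h3 => ⟨h2.actl, h1, fun f hf => h3 f ⟨hf.2, hf.1⟩⟩)
      q.1 v.1 u.1 v.2 u.2 (cI _ _ hj hg) ?_ (cJ _ _ hi hg')
    intro w hw hqw hwv
    refine hno ⟨w, hw⟩ ?_ (rN _ _ hqw) (rN _ _ hwv)
    exact dα.dis w _ _ (hI ⟨w, hw⟩) (cl _ _ _ (hI q) hqw)

end MTN

namespace MTN
open Relation

theorem graph_rank (G : MultiDigraph) (hG : G.Acyclic) :
    ∃ r : G.E → ℕ, ∀ a b, G.dst a = G.src b → r a < r b := by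
  haveI := G.fintE
  have key : ∀ a b, TransGen (fun e f : G.E => G.dst f = G.src e) a b →
      ∃ p, G.IsPathFrom (G.src b) (G.src a) p := by
    intro a b h
    induction h with
    | single h =>
      rename_i b
      exact ⟨[b], by simp, List.isChain_singleton _, by simp, by simpa using h⟩
    | tail hab h ih =>
      rename_i b c
      obtain ⟨p, h1, h2, h3, h4⟩ := ih
      obtain ⟨x, q, rfl⟩ := List.exists_cons_of_ne_nil h1
      refine ⟨c :: x :: q, by simp, ?_, by simp, by simpa using h4⟩
      have hx : G.src x = G.src b := h3 x (by simp)
      exact List.isChain_cons_cons.2 ⟨h.trans hx.symm, h2⟩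
  obtain ⟨r, hr⟩ := rank_exists (fun e f : G.E => G.dst f = G.src e) (fun z hz => by
    obtain ⟨p, hp⟩ := key z z hz
    exact hG _ p hp)
  exact ⟨r, fun a b h => hr b a h⟩

theorem menger_encode (G : MultiDigraph) {u v : G.V} {c : ℕ} (r : G.E → ℕ)
    (hr : ∀ a b, G.dst a = G.src b → r a < r b)
    (h : ∃ α : Fin c → List G.E, G.MengerSystem u v c α) :
    ∃ σ : Equiv.Perm (G.E ⊕ Fin c), Valid G.src G.dst u v σ := by
  haveI := G.fintE
  obtain ⟨α, h1, h2⟩ := h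
  exact encode r hr α (fun k => (h1 k).1) (fun k => (h1 k).2.1) (fun k => (h1 k).2.2.1)
    (fun k => (h1 k).2.2.2) h2

theorem menger_decode (G : MultiDigraph) {u v : G.V} {c : ℕ} (σ : Equiv.Perm (G.E ⊕ Fin c))
    (hσ : Valid G.src G.dst u v σ) (α : Fin c → List G.E) (d : Dec σ α) :
    G.MengerSystem u v c α := by
  refine ⟨fun k => ⟨d.ne k, ?_, ?_, ?_⟩, ?_⟩
  · exact (d.ch k).imp (fun a b h => hσ.ee _ _ h.1 h.2)
  · intro e he
    exact hσ.ke _ _ (d.hd k e he)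
  · intro e he
    obtain ⟨k', hk'⟩ := d.la k e he
    exact hσ.ek _ _ hk'
  · intro i j hij e hi hj
    exact hij (d.dis e i j hi hj)

end MTN

/-- For every positive integer `n`, `M(3, n) ≤ 14n`: in every acyclic
graph with two distinct sources, two distinct sinks, min-cut `3` from `S₁` to `R₁` and
min-cut `n` from `S₂` to `R₂`, some choice of the two Menger path systems yields at most
`14n` mergings. -/
theorem M_three_n_upper (n : ℕ) (hn : 0 < n) : MAtMost ![3, n] (14 * n) := by
  rintro G S R ⟨hG, _, hcut⟩ _
  haveI := G.fintE
  obtain ⟨r, hr⟩ := MTN.graph_rank G hG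
  obtain ⟨σ, σ', hσ, hσ', hcard⟩ := MTN.core hn r hr
    (MTN.menger_encode G r hr (hcut 0).1) (MTN.menger_encode G r hr (hcut 1).1)
  obtain ⟨α, dα⟩ := MTN.decode' r hr σ hσ
  obtain ⟨β, dβ⟩ := MTN.decode' r hr σ' hσ'
  let γ : (i : Fin 2) → Fin (![3, n] i) → List G.E :=
    fun i => match i with
      | 0 => α
      | 1 => β
  have hact : ∀ (k : Fin 3) (f e : G.E), [f, e] <:+: α k → MTN.Nx σ f e :=
    fun k f e h => MTN.infix_of_chain (dα.ch k) h
  have hact' : ∀ (k : Fin n) (f e : G.E), [f, e] <:+: β k → MTN.Nx σ' f e :=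
    fun k f e h => MTN.infix_of_chain (dβ.ch k) h
  refine ⟨γ, ?_, ?_⟩
  · intro i
    match i with
    | 0 => exact MTN.menger_decode G σ hσ α dα
    | 1 => exact MTN.menger_decode G σ' hσ' β dβ
  · have hsub : {e : G.E | G.MergingEdge γ e} ⊆
        {e | MTN.Act σ e ∧ MTN.Act σ' e ∧ ∀ f, ¬ (MTN.Nx σ f e ∧ MTN.Nx σ' f e)} := by
      rintro e ⟨i, j, hij, a, b, f, g, hfg, h1, h2⟩
      have fin : ∀ f g, f ≠ g → MTN.Nx σ f e → MTN.Nx σ' g e →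
          MTN.Act σ e ∧ MTN.Act σ' e ∧ ∀ f, ¬ (MTN.Nx σ f e ∧ MTN.Nx σ' f e) := by
        intro f g hfg k1 k2
        refine ⟨k1.actr, k2.actr, ?_⟩
        rintro x ⟨x1, x2⟩
        exact hfg ((k1.inj x1).trans (x2.inj k2))
      match i, j, hij, a, b, h1, h2 with
      | 0, 0, hij, _, _, _, _ => exact (hij rfl).elim
      | 1, 1, hij, _, _, _, _ => exact (hij rfl).elim
      | 0, 1, _, a, b, h1, h2 => exact fin f g hfg (hact a f e h1) (hact' b g e h2)
      | 1, 0, _, a, b, h1, h2 => exact fin g f hfg.symm (hact b g e h2) (hact' a f e h1)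
    have := Set.ncard_le_ncard hsub (Set.toFinite _)
    unfold MultiDigraph.mergingCount
    omega
end
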